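/- Every nonempty, compact, connected, simply connected topological 2-manifold without boundary (Hausdorff and second countable) is homeomorphic to the 2-sphere {x ∈ ℝ³ : ‖x‖ = 1}. -/

import Mathlib

open Set Filter Topology Metric

/-! ### Continuous logarithms on subsets of a space -/

/-- `f` has a continuous logarithm on `X`. -/
def HasLogOn {α : Type*} [TopologicalSpace α] (X : Set α) (f : α → ℂ) : Prop :=
  ∃ L : α → ℂ, ContinuousOn L X ∧ ∀ z ∈ X, f z = Complex.exp (L z)

section Log
variable {α : Type*} [TopologicalSpace α] {X Y : Set α} {f g : α → ℂ}

lemma HasLogOn.congr (h : HasLogOn X f) (hfg : ∀ z ∈ X, g z = f z) : HasLogOn X g := by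
  obtain ⟨L, hL, h⟩ := h
  exact ⟨L, hL, fun z hz => (hfg z hz).trans (h z hz)⟩

lemma HasLogOn.mono (h : HasLogOn X f) (hXY : Y ⊆ X) : HasLogOn Y f := by
  obtain ⟨L, hL, h⟩ := h
  exact ⟨L, hL.mono hXY, fun z hz => h z (hXY hz)⟩

lemma HasLogOn.mul (hf : HasLogOn X f) (hg : HasLogOn X g) :
    HasLogOn X (fun z => f z * g z) := by
  obtain ⟨L, hL, h⟩ := hf
  obtain ⟨L', hL', h'⟩ := hg
  exact ⟨fun z => L z + L' z, hL.add hL', fun z hz => by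
    simp only [Complex.exp_add, h z hz, h' z hz]⟩

lemma HasLogOn.zpow (hf : HasLogOn X f) (k : ℤ) : HasLogOn X (fun z => f z ^ k) := by
  obtain ⟨L, hL, h⟩ := hf
  exact ⟨fun z => k * L z, continuousOn_const.mul hL, fun z hz => by
    simp only [Complex.exp_int_mul, h z hz]⟩

lemma hasLogOn_const {c : ℂ} (hc : c ≠ 0) : HasLogOn X (fun _ => c) :=
  ⟨fun _ => Complex.log c, continuousOn_const, fun _ _ => (Complex.exp_log hc).symm⟩

/-- Homotopy lifting for the exponential. -/
lemma HasLogOn.of_homotopy {H : α → ℝ → ℂ}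
    (hH : ContinuousOn (fun p : α × ℝ => H p.1 p.2) (X ×ˢ Icc 0 1))
    (h0 : ∀ z ∈ X, ∀ s ∈ Icc (0 : ℝ) 1, H z s ≠ 0)
    (h : HasLogOn X (fun z => H z 0)) : HasLogOn X (fun z => H z 1) := by
  obtain ⟨L, hL, hLe⟩ := h
  let K : C(unitInterval × X, {z : ℂ // z ≠ 0}) :=
    ⟨fun p => ⟨H p.2 p.1, h0 _ p.2.2 _ p.1.2⟩, by
      refine Continuous.subtype_mk ?_ _
      exact hH.comp_continuous (f := fun p : unitInterval × X => ((p.2 : α), (p.1 : ℝ)))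
        (by fun_prop) (fun p => ⟨p.2.2, p.1.2⟩)⟩
  let l0 : C(X, ℂ) := ⟨X.domRestrict L, hL.domRestrict⟩
  have hK : ∀ a : X, K (0, a) = (fun z : ℂ => (⟨_, z.exp_ne_zero⟩ : {z : ℂ // z ≠ 0})) (l0 a) := by
    intro a
    apply Subtype.ext
    exact hLe a a.2
  let G := Complex.isCoveringMap_exp.liftHomotopy K l0 hK
  have hG := Complex.isCoveringMap_exp.liftHomotopy_lifts K l0 hK
  classical
  refine ⟨fun z => if hz : z ∈ X then G (1, ⟨z, hz⟩) else 0, ?_, ?_⟩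
  · rw [continuousOn_iff_continuous_domRestrict]
    have : X.domRestrict (fun z => if hz : z ∈ X then G (1, ⟨z, hz⟩) else 0) = fun z => G (1, z) := by
      ext z; simp [Set.domRestrict]
    rw [this]
    fun_prop
  · intro z hz
    have := congrFun hG (1, ⟨z, hz⟩)
    have := congrArg Subtype.val this
    simp only [hz, dif_pos]
    exact this.symm

lemma HasLogOn.union_of_eqOn {l l' : α → ℂ} (hX : IsClosed X) (hY : IsClosed Y)
    (hl : ContinuousOn l X) (hl' : ContinuousOn l' Y) (hf : ∀ z ∈ X, f z = Complex.exp (l z))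
    (hf' : ∀ z ∈ Y, f z = Complex.exp (l' z)) (h : ∀ z ∈ X ∩ Y, l z = l' z) :
    HasLogOn (X ∪ Y) f := by
  classical
  refine ⟨X.piecewise l l', ?_, ?_⟩
  · refine ContinuousOn.union_of_isClosed ?_ ?_ hX hY
    · exact hl.congr fun z hz => by simp [hz]
    · refine hl'.congr fun z hz => ?_
      by_cases hzX : z ∈ X
      · simp [hzX, h z ⟨hzX, hz⟩]
      · simp [hzX]
  · intro z hz
    by_cases hzX : z ∈ X
    · simp [hzX, hf z hzX]
    · simp [hzX, hf' z (hz.resolve_left hzX)]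

lemma exists_int_of_exp_eq {x y : ℂ} (h : Complex.exp x = Complex.exp y) :
    ∃ n : ℤ, x - y = n * (2 * Real.pi * Complex.I) := by
  obtain ⟨n, hn⟩ := Complex.exp_eq_exp_iff_exists_int.1 h
  exact ⟨n, by rw [hn]; ring⟩

lemma exp_add_int_mul (x : ℂ) (n : ℤ) :
    Complex.exp (x + n * (2 * Real.pi * Complex.I)) = Complex.exp x := by
  rw [Complex.exp_eq_exp_iff_exists_int]; exact ⟨n, rfl⟩

/-- Two logarithms of the same function on a preconnected set differ by a constant. -/
lemma IsPreconnected.log_sub_const {l l' : α → ℂ} (hX : IsPreconnected X)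
    (hl : ContinuousOn l X) (hl' : ContinuousOn l' X)
    (h : ∀ z ∈ X, Complex.exp (l z) = Complex.exp (l' z)) :
    ∃ n : ℤ, ∀ z ∈ X, l z = l' z + n * (2 * Real.pi * Complex.I) := by
  rcases X.eq_empty_or_nonempty with rfl | ⟨x₀, hx₀⟩
  · exact ⟨0, by simp⟩
  choose! n hn using fun z hz => exists_int_of_exp_eq (h z hz)
  have hcont : ContinuousOn (fun z => ((l z - l' z) / (2 * Real.pi * Complex.I)).re) X := by
    apply Complex.continuous_re.comp_continuousOn
    exact (hl.sub hl').div_const _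
  have hval : ∀ z ∈ X, ((l z - l' z) / (2 * Real.pi * Complex.I)).re = n z := by
    intro z hz
    rw [hn z hz, mul_div_cancel_right₀ _ Complex.two_pi_I_ne_zero]
    simp
  refine ⟨n x₀, fun z hz => ?_⟩
  have hT : IsDiscrete (range (fun k : ℤ => (k : ℝ))) :=
    ⟨Int.isClosedEmbedding_coe_real.isEmbedding.toHomeomorph.symm.isEmbedding.discreteTopology⟩
  obtain ⟨y, -, hy⟩ := hX.eqOn_const_of_mapsTo hT hcont
    (fun z hz => ⟨n z, (hval z hz).symm⟩) ⟨0, 0, by simp⟩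
  have h1 : (n z : ℝ) = n x₀ := by
    rw [← hval z hz, ← hval x₀ hx₀]; exact (hy hz).trans (hy hx₀).symm
  have h2 : n z = n x₀ := by exact_mod_cast h1
  rw [← h2, ← hn z hz]; ring

lemma HasLogOn.union (hX : IsClosed X) (hY : IsClosed Y) (h : IsPreconnected (X ∩ Y))
    (hfX : HasLogOn X f) (hfY : HasLogOn Y f) : HasLogOn (X ∪ Y) f := by
  obtain ⟨l, hl, hfl⟩ := hfX
  obtain ⟨l', hl', hfl'⟩ := hfY
  obtain ⟨n, hn⟩ := h.log_sub_const (hl.mono inter_subset_left) (hl'.mono inter_subset_right)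
    (fun z hz => by rw [← hfl z hz.1, ← hfl' z hz.2])
  refine HasLogOn.union_of_eqOn hX hY hl
    (l' := fun z => l' z + n * (2 * Real.pi * Complex.I)) (hl'.add continuousOn_const) hfl ?_ hn
  intro z hz
  rw [exp_add_int_mul, hfl' z hz]

end Log

/-! ### Arcs -/

lemma exists_arc_inverse {M : Type*} [TopologicalSpace M] [T2Space M] {γ : ℝ → M} {a b : ℝ}
    (hγ : ContinuousOn γ (Icc a b)) (hinj : InjOn γ (Icc a b)) :
    ∃ e : M → ℝ, ContinuousOn e (γ '' Icc a b) ∧ ∀ t ∈ Icc a b, e (γ t) = t := by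
  rcases (Icc a b).eq_empty_or_nonempty with hE | hne
  · exact ⟨fun _ => 0, by simp [hE], by simp [hE]⟩
  refine ⟨Function.invFunOn γ (Icc a b), ?_, fun t ht => hinj.leftInvOn_invFunOn ht⟩
  rw [continuousOn_iff_isClosed]
  intro C hC
  refine ⟨γ '' (C ∩ Icc a b), ?_, ?_⟩
  · exact ((isCompact_Icc.inter_left hC).image_of_continuousOn
      (hγ.mono inter_subset_right)).isClosed
  · ext x
    constructor
    · rintro ⟨hx, t, ht, rfl⟩
      rw [mem_preimage, hinj.leftInvOn_invFunOn ht] at hx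
      exact ⟨⟨t, ⟨hx, ht⟩, rfl⟩, t, ht, rfl⟩
    · rintro ⟨⟨t, ⟨ht, ht'⟩, rfl⟩, h2⟩
      refine ⟨?_, h2⟩
      rw [mem_preimage, hinj.leftInvOn_invFunOn ht']
      exact ht

/-- A nonvanishing continuous function on an arc has a logarithm. -/
lemma hasLogOn_arc {M : Type*} [TopologicalSpace M] [T2Space M] {γ : ℝ → M} {a b : ℝ}
    {f : M → ℂ} (hγ : ContinuousOn γ (Icc a b)) (hinj : InjOn γ (Icc a b))
    (hf : ContinuousOn f (γ '' Icc a b)) (h0 : ∀ z ∈ γ '' Icc a b, f z ≠ 0) :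
    HasLogOn (γ '' Icc a b) f := by
  rcases lt_or_ge b a with hab | hab
  · exact ⟨fun _ => 0, by simp [hab], by simp [hab]⟩
  obtain ⟨e, he, hee⟩ := exists_arc_inverse hγ hinj
  have hmem : ∀ z ∈ γ '' Icc a b, ∀ s ∈ Icc (0 : ℝ) 1, a + s * (e z - a) ∈ Icc a b := by
    rintro _ ⟨t, ht, rfl⟩ s hs
    rw [hee t ht]
    constructor
    · nlinarith [ht.1, hs.1]
    · nlinarith [ht.1, ht.2, hs.1, hs.2]
  have := HasLogOn.of_homotopy (X := γ '' Icc a b) (H := fun z s => f (γ (a + s * (e z - a)))) ?_ ?_ ?_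
  · refine this.congr ?_
    rintro _ ⟨t, ht, rfl⟩
    simp [hee t ht]
  · refine hf.comp (hγ.comp ?_ ?_) ?_
    · refine continuousOn_const.add (continuousOn_snd.mul ((he.comp continuousOn_fst ?_).sub
        continuousOn_const))
      exact fun p hp => hp.1
    · exact fun p hp => hmem _ hp.1 _ hp.2
    · exact fun p hp => mem_image_of_mem _ (hmem _ hp.1 _ hp.2)
  · exact fun z hz s hs => h0 _ (mem_image_of_mem _ (hmem _ hz _ hs))
  · simp only [zero_mul, add_zero]
    exact hasLogOn_const (h0 _ (mem_image_of_mem _ ⟨le_rfl, hab⟩))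

/-- Moving the pole along a path avoiding `X`. -/
lemma hasLogOn_path {X : Set ℂ} {δ : ℝ → ℂ} {a b : ℝ} (hab : a ≤ b)
    (hδ : ContinuousOn δ (Icc a b)) (hX : ∀ t ∈ Icc a b, δ t ∉ X) :
    HasLogOn X (fun z => (z - δ b) / (z - δ a)) := by
  have hmem : ∀ s ∈ Icc (0 : ℝ) 1, a + s * (b - a) ∈ Icc a b := by
    intro s hs
    constructor
    · nlinarith [hs.1]
    · nlinarith [hs.1, hs.2]
  have hne : ∀ z ∈ X, ∀ t ∈ Icc a b, z - δ t ≠ 0 := by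
    intro z hz t ht h
    rw [sub_eq_zero] at h
    exact hX t ht (h ▸ hz)
  have := HasLogOn.of_homotopy (X := X)
    (H := fun z s => (z - δ (a + s * (b - a))) / (z - δ a)) ?_ ?_ ?_
  · simpa using this
  · refine ContinuousOn.div ?_ ?_ ?_
    · refine continuousOn_fst.sub (hδ.comp (by fun_prop) ?_)
      exact fun p hp => hmem _ hp.2
    · fun_prop
    · exact fun p hp => hne _ hp.1 _ ⟨le_rfl, hab⟩
  · exact fun z hz s hs => div_ne_zero (hne z hz _ (hmem s hs)) (hne z hz _ ⟨le_rfl, hab⟩)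
  · refine (hasLogOn_const one_ne_zero).congr fun z hz => ?_
    simp only [zero_mul, add_zero]
    exact div_self (hne z hz _ ⟨le_rfl, hab⟩)

/-! ### Winding number obstruction in the plane -/

lemma eq_zero_of_eq_zpow_at_infinity {F : ℂ → ℂ} (hF : Continuous F) (h0 : ∀ z, F z ≠ 0)
    {q : ℂ} {k : ℤ} {R : ℝ} (h : ∀ z, R ≤ ‖z - q‖ → F z = (z - q) ^ k) : k = 0 := by
  set R' := max R 1
  have hR' : 0 < R' := lt_of_lt_of_le one_pos (le_max_right _ _)
  have hlog : HasLogOn (sphere (0 : ℂ) 1) (fun z => F (q + R' * z)) := by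
    have := HasLogOn.of_homotopy (X := sphere (0 : ℂ) 1)
      (H := fun z s => F (q + s * (R' * z))) ?_ (fun z _ s _ => h0 _) ?_
    · simpa using this
    · exact Continuous.continuousOn (by fun_prop)
    · simpa using hasLogOn_const (h0 q)
  obtain ⟨L, hL, hLe⟩ := hlog
  have hmem : ∀ θ : ℝ, Complex.exp (θ * Complex.I) ∈ sphere (0 : ℂ) 1 := by
    intro θ; simp [Complex.norm_exp_ofReal_mul_I]
  have hval : ∀ θ : ℝ, (R' : ℂ) ^ k * Complex.exp (θ * Complex.I) ^ k
      = Complex.exp (L (Complex.exp (θ * Complex.I))) := by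
    intro θ
    rw [← hLe _ (hmem θ)]
    simp only []
    rw [h, ← mul_zpow]
    · congr 1; ring
    · simp [Complex.norm_exp_ofReal_mul_I, abs_of_pos hR', R']
  have hR0 : (R' : ℂ) ^ k ≠ 0 := zpow_ne_zero _ (by exact_mod_cast hR'.ne')
  obtain ⟨n, hn⟩ := isPreconnected_univ.log_sub_const (X := (univ : Set ℝ))
    (l := fun θ : ℝ => L (Complex.exp (θ * Complex.I)))
    (l' := fun θ : ℝ => Complex.log ((R' : ℂ) ^ k) + k * (θ * Complex.I))
    (Continuous.continuousOn (hL.comp_continuous (by fun_prop) hmem))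
    (Continuous.continuousOn (by fun_prop))
    (fun θ _ => by
      rw [← hval, Complex.exp_add, Complex.exp_log hR0, Complex.exp_int_mul])
  have e0 := hn 0 (mem_univ _)
  have e1 := hn (2 * Real.pi) (mem_univ _)
  have : Complex.exp (((2 * Real.pi : ℝ) : ℂ) * Complex.I) = Complex.exp (((0 : ℝ) : ℂ) * Complex.I) := by
    push_cast
    rw [Complex.exp_two_pi_mul_I]; simp
  rw [this, e0] at e1
  have e2 : (k : ℂ) * (2 * Real.pi * Complex.I) = 0 := by
    push_cast at e1
    linear_combination -e1
  rcases mul_eq_zero.1 e2 with h | h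
  · exact_mod_cast h
  · exact absurd h Complex.two_pi_I_ne_zero

lemma eq_zero_of_log_on_frontier {U : Set ℂ} (hU : IsOpen U) (hb : Bornology.IsBounded U) {q : ℂ}
    (hq : q ∈ U) {H L : ℂ → ℂ} (hH : ContinuousOn H (closure U)) (h0 : ∀ z ∈ closure U, H z ≠ 0)
    (hL : ContinuousOn L (frontier U)) {k : ℤ}
    (h : ∀ z ∈ frontier U, (z - q) ^ k = Complex.exp (L z) * H z) : k = 0 := by
  classical
  obtain ⟨L', hL'⟩ := ContinuousMap.exists_restrict_eq (isClosed_frontier (s := U))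
    (⟨(frontier U).domRestrict L, hL.domRestrict⟩ : C(frontier U, ℂ))
  have hLL : ∀ z ∈ frontier U, L' z = L z := fun z hz =>
    congrArg (fun (F : C(frontier U, ℂ)) => F ⟨z, hz⟩) hL'
  obtain ⟨R, hR⟩ := hb.subset_ball q
  let F : ℂ → ℂ := U.piecewise (fun z => Complex.exp (L' z) * H z) (fun z => (z - q) ^ k)
  have hqc : q ∉ closure Uᶜ := by rw [closure_compl, hU.interior_eq]; simpa using hq
  refine eq_zero_of_eq_zpow_at_infinity (F := F) (q := q) (R := R) ?_ ?_ ?_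
  · rw [← continuousOn_univ]
    refine ContinuousOn.piecewise ?_ ?_ ?_
    · rintro z ⟨-, hz⟩
      rw [h z hz, hLL z hz]
    · rw [univ_inter]
      exact (L'.continuous.cexp).continuousOn.mul hH
    · rw [univ_inter]
      refine ContinuousOn.zpow₀ (by fun_prop) k ?_
      intro z hz
      left
      rw [sub_ne_zero]
      rintro rfl
      exact hqc hz
  · intro z
    by_cases hz : z ∈ U
    · simp only [F, piecewise_eq_of_mem _ _ _ hz]
      exact mul_ne_zero (Complex.exp_ne_zero _) (h0 z (subset_closure hz))
    · simp only [F, piecewise_eq_of_notMem _ _ _ hz]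
      refine zpow_ne_zero _ ?_
      rw [sub_ne_zero]
      rintro rfl
      exact hz hq
  · intro z hz
    have : z ∉ U := fun hzU => by
      have := hR hzU
      rw [mem_ball, dist_eq_norm] at this
      linarith
    simp only [F, piecewise_eq_of_notMem _ _ _ this]

/-! ### Points joined inside a set -/

/-- `p` and `q` lie in a common preconnected subset of `Ω`. -/
def ConnIn {M : Type*} [TopologicalSpace M] (Ω : Set M) (p q : M) : Prop :=
  ∃ C ⊆ Ω, IsPreconnected C ∧ p ∈ C ∧ q ∈ C

section ConnIn
variable {M : Type*} [TopologicalSpace M] {Ω Ω' : Set M} {p q r : M}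

lemma ConnIn.symm (h : ConnIn Ω p q) : ConnIn Ω q p := by
  obtain ⟨C, hC, hc, hp, hq⟩ := h
  exact ⟨C, hC, hc, hq, hp⟩

lemma ConnIn.trans (h : ConnIn Ω p q) (h' : ConnIn Ω q r) : ConnIn Ω p r := by
  obtain ⟨C, hC, hc, hp, hq⟩ := h
  obtain ⟨C', hC', hc', hp', hq'⟩ := h'
  exact ⟨C ∪ C', union_subset hC hC', hc.union q hq hp' hc', Or.inl hp, Or.inr hq'⟩

lemma ConnIn.mono (h : ConnIn Ω p q) (hΩ : Ω ⊆ Ω') : ConnIn Ω' p q := by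
  obtain ⟨C, hC, h⟩ := h
  exact ⟨C, hC.trans hΩ, h⟩

lemma ConnIn.left_mem (h : ConnIn Ω p q) : p ∈ Ω := by
  obtain ⟨C, hC, -, hp, -⟩ := h
  exact hC hp

lemma ConnIn.refl (h : p ∈ Ω) : ConnIn Ω p p :=
  ⟨{p}, by simpa, isPreconnected_singleton, rfl, rfl⟩

lemma IsPreconnected.connIn (h : IsPreconnected Ω) (hp : p ∈ Ω) (hq : q ∈ Ω) : ConnIn Ω p q :=
  ⟨Ω, Subset.rfl, h, hp, hq⟩

lemma ConnIn.mem_component (h : ConnIn Ω p q) : q ∈ connectedComponentIn Ω p := by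
  obtain ⟨C, hC, hc, hp, hq⟩ := h
  exact hc.subset_connectedComponentIn hp hC hq

lemma connIn_of_mem_component (h : q ∈ connectedComponentIn Ω p) : ConnIn Ω p q :=
  ⟨_, connectedComponentIn_subset _ _, isPreconnected_connectedComponentIn,
    mem_connectedComponentIn (connectedComponentIn_nonempty_iff.1 ⟨q, h⟩), h⟩

lemma isPreconnected_of_connIn (h : ∀ p ∈ Ω, ∀ q ∈ Ω, ConnIn Ω p q) : IsPreconnected Ω :=
  isPreconnected_of_forall_pair fun x hx y hy => by
    obtain ⟨C, hC, hc, hp, hq⟩ := h x hx y hy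
    exact ⟨C, hC, hp, hq, hc⟩

lemma ConnIn.image {N : Type*} [TopologicalSpace N] {f : M → N} (h : ConnIn Ω p q)
    (hf : ContinuousOn f Ω) : ConnIn (f '' Ω) (f p) (f q) := by
  obtain ⟨C, hC, hc, hp, hq⟩ := h
  exact ⟨f '' C, image_mono hC, hc.image _ (hf.mono hC), mem_image_of_mem _ hp,
    mem_image_of_mem _ hq⟩

lemma closure_component_inter [LocallyConnectedSpace M] (hΩ : IsOpen Ω) :
    closure (connectedComponentIn Ω p) ∩ Ω ⊆ connectedComponentIn Ω p := by
  rintro x ⟨hx, hxΩ⟩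
  obtain ⟨y, hy1, hy2⟩ := mem_closure_iff.1 hx _ (hΩ.connectedComponentIn (x := x))
    (mem_connectedComponentIn hxΩ)
  exact ((connIn_of_mem_component hy2).trans (connIn_of_mem_component hy1).symm).mem_component

lemma frontier_component_subset [LocallyConnectedSpace M] (hΩ : IsOpen Ω) :
    frontier (connectedComponentIn Ω p) ⊆ frontier Ω := by
  intro x hx
  rw [hΩ.connectedComponentIn.frontier_eq] at hx
  rw [hΩ.frontier_eq]
  exact ⟨closure_mono (connectedComponentIn_subset _ _) hx.1,
    fun h => hx.2 (closure_component_inter hΩ ⟨hx.1, h⟩)⟩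

end ConnIn

/-! ### Separation in the unit disc -/

lemma exponent_eq_zero_of_log_frontier {Ω : Set ℂ} (hΩ : IsOpen Ω) (hb : Bornology.IsBounded Ω)
    {q : ℂ} (hq : q ∈ Ω) {k : ℤ} {H : ℂ → ℂ}
    (hH : ContinuousOn H (closure (connectedComponentIn Ω q)))
    (h0 : ∀ z ∈ closure (connectedComponentIn Ω q), H z ≠ 0)
    (h : HasLogOn (frontier Ω) (fun z => (z - q) ^ k * H z)) : k = 0 := by
  obtain ⟨L, hL, hLe⟩ := h
  have hsub := frontier_component_subset (p := q) hΩ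
  refine eq_zero_of_log_on_frontier (U := connectedComponentIn Ω q) hΩ.connectedComponentIn
    (hb.subset (connectedComponentIn_subset _ _)) (mem_connectedComponentIn hq)
    (H := fun z => (H z)⁻¹) (hH.inv₀ h0) (fun z hz => inv_ne_zero (h0 z hz)) (hL.mono hsub) ?_
  intro z hz
  rw [← hLe z (hsub hz)]
  simp only []
  rw [mul_assoc, mul_inv_cancel₀ (h0 z (frontier_subset_closure hz)), mul_one]

lemma sub_ne_zero_of_not_connIn {Ω : Set ℂ} (hΩ : IsOpen Ω) {p q : ℂ} (hp : p ∈ Ω)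
    (h : ¬ ConnIn Ω q p) : ∀ z ∈ closure (connectedComponentIn Ω q), z - p ≠ 0 := by
  intro z hz h0
  rw [sub_eq_zero] at h0
  subst h0
  exact h (connIn_of_mem_component (closure_component_inter hΩ ⟨hz, hp⟩))

lemma connIn_of_hasLogOn {Ω : Set ℂ} (hΩ : IsOpen Ω) (hb : Bornology.IsBounded Ω)
    {p q : ℂ} (hp : p ∈ Ω) (hq : q ∈ Ω)
    (h : HasLogOn (frontier Ω) (fun z => (z - p) / (z - q))) : ConnIn Ω q p := by
  by_contra hc
  have : (-1 : ℤ) = 0 := by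
    refine exponent_eq_zero_of_log_frontier hΩ hb hq (H := fun z => z - p)
      (by fun_prop) (sub_ne_zero_of_not_connIn hΩ hp hc) (h.congr fun z hz => ?_)
    simp [div_eq_mul_inv, mul_comm]
  simp at this

lemma connIn_of_hasLogOn_three {Ω : Set ℂ} (hΩ : IsOpen Ω) (hb : Bornology.IsBounded Ω)
    {p q r : ℂ} (hp : p ∈ Ω) (hq : q ∈ Ω) (hr : r ∈ Ω) {k l : ℤ} (hkl : k ≠ 0 ∨ l ≠ 0)
    (h : HasLogOn (frontier Ω)
      (fun z => ((z - p) / (z - q)) ^ k * ((z - p) / (z - r)) ^ l)) :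
    ConnIn Ω p q ∨ ConnIn Ω p r ∨ ConnIn Ω q r := by
  by_contra hc
  push Not at hc
  obtain ⟨h1, h2, h3⟩ := hc
  have hne : ∀ s ∈ Ω, ∀ z ∈ frontier Ω, z - s ≠ 0 := by
    intro s hs z hz h0
    rw [sub_eq_zero] at h0
    subst h0
    rw [hΩ.frontier_eq] at hz
    exact hz.2 hs
  have hk : -k = 0 := by
    have hp' := sub_ne_zero_of_not_connIn hΩ hp (fun h => h1 h.symm)
    have hr' := sub_ne_zero_of_not_connIn hΩ hr h3
    refine exponent_eq_zero_of_log_frontier hΩ hb hq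
      (H := fun z => (z - p) ^ (k + l) * (z - r) ^ (-l)) ?_ ?_ (h.congr fun z hz => ?_)
    · exact (ContinuousOn.zpow₀ (by fun_prop) _ fun z hz => Or.inl (hp' z hz)).mul
        (ContinuousOn.zpow₀ (by fun_prop) _ fun z hz => Or.inl (hr' z hz))
    · exact fun z hz => mul_ne_zero (zpow_ne_zero _ (hp' z hz)) (zpow_ne_zero _ (hr' z hz))
    · have := hne p hp z hz
      simp only [div_zpow, zpow_add₀ this, zpow_neg]
      field_simp
  have hl : -l = 0 := by
    have hp' := sub_ne_zero_of_not_connIn hΩ hp (fun h => h2 h.symm)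
    have hq' := sub_ne_zero_of_not_connIn hΩ hq (fun h => h3 h.symm)
    refine exponent_eq_zero_of_log_frontier hΩ hb hr
      (H := fun z => (z - p) ^ (k + l) * (z - q) ^ (-k)) ?_ ?_ (h.congr fun z hz => ?_)
    · exact (ContinuousOn.zpow₀ (by fun_prop) _ fun z hz => Or.inl (hp' z hz)).mul
        (ContinuousOn.zpow₀ (by fun_prop) _ fun z hz => Or.inl (hq' z hz))
    · exact fun z hz => mul_ne_zero (zpow_ne_zero _ (hp' z hz)) (zpow_ne_zero _ (hq' z hz))
    · have := hne p hp z hz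
      simp only [div_zpow, zpow_add₀ this, zpow_neg]
      field_simp
  rcases hkl with h | h <;> omega

lemma hasLogOn_of_convex {X C : Set ℂ} (hC : Convex ℝ C) (hX : Disjoint C X) {p q : ℂ}
    (hp : p ∈ C) (hq : q ∈ C) : HasLogOn X (fun z => (z - p) / (z - q)) := by
  have := hasLogOn_path (X := X) (δ := fun t : ℝ => q + t • (p - q)) (a := 0) (b := 1) zero_le_one
    (by fun_prop) (fun t ht => ?_)
  · simpa using this
  · exact disjoint_left.1 hX (hC.add_smul_sub_mem hq hp ht)

lemma isPreconnected_unit_sphere : IsPreconnected (sphere (0 : ℂ) 1) :=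
  isPreconnected_sphere (by rw [Complex.rank_real_complex]; norm_num) _ _

lemma isCompact_arc {M : Type*} [TopologicalSpace M] {γ : ℝ → M} {a b : ℝ}
    (hγ : ContinuousOn γ (Icc a b)) : IsCompact (γ '' Icc a b) :=
  isCompact_Icc.image_of_continuousOn hγ

lemma frontier_ball_diff_subset {A : Set ℂ} (hA : IsClosed A) :
    frontier (ball (0 : ℂ) 1 \ A) ⊆ sphere 0 1 ∪ A := by
  intro z hz
  rw [(isOpen_ball.sdiff hA).frontier_eq] at hz
  have h1 : z ∈ closedBall (0 : ℂ) 1 := by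
    rw [← closure_ball _ one_ne_zero]
    exact closure_mono sdiff_subset hz.1
  by_contra h
  simp only [mem_union, not_or] at h
  exact hz.2 ⟨lt_of_le_of_ne h1 h.1, h.2⟩

section Disc
variable {γ : ℝ → ℂ} {a b : ℝ} {T C : Set ℂ}

lemma continuousOn_sub_div_sub {X : Set ℂ} {p q : ℂ} (hq : q ∉ X) :
    ContinuousOn (fun z => (z - p) / (z - q)) X :=
  ContinuousOn.div (by fun_prop) (by fun_prop) fun _ hz h => by
    rw [sub_eq_zero] at h; exact hq (h ▸ hz)

lemma sub_div_sub_ne_zero {X : Set ℂ} {p q : ℂ} (hp : p ∉ X) (hq : q ∉ X) :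
    ∀ z ∈ X, (z - p) / (z - q) ≠ 0 := fun _ hz =>
  div_ne_zero (fun h => hp (sub_eq_zero.1 h ▸ hz)) (fun h => hq (sub_eq_zero.1 h ▸ hz))

/-- Near the interior end of an arc issuing from the circle, the arc does not separate. -/
lemma connIn_disc_of_arc_end (hγ : ContinuousOn γ (Icc a b))
    (hinj : InjOn γ (Icc a b)) (hsph : ∀ t ∈ Icc a b, γ t ∈ sphere (0 : ℂ) 1 ↔ t = a)
    (hT : IsCompact T) (hTγ : T ∩ γ '' Icc a b ⊆ sphere 0 1)
    (hC : Convex ℝ C) (hCb : C ⊆ ball 0 1) (hCT : Disjoint C T) {p q : ℂ}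
    (hp : p ∈ C) (hq : q ∈ C) (hpγ : p ∉ γ '' Icc a b) (hqγ : q ∉ γ '' Icc a b) :
    ConnIn (ball (0 : ℂ) 1 \ (γ '' Icc a b ∪ T)) p q := by
  have hcl : IsClosed (γ '' Icc a b) := (isCompact_arc hγ).isClosed
  have hclA : IsClosed (γ '' Icc a b ∪ T) := hcl.union hT.isClosed
  have hCs : Disjoint C (sphere (0 : ℂ) 1) := disjoint_left.2 fun z hz hz' =>
    (mem_ball.1 (hCb hz)).ne hz'
  have h1 : HasLogOn (sphere (0 : ℂ) 1 ∪ γ '' Icc a b) (fun z => (z - q) / (z - p)) := by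
    refine HasLogOn.union isClosed_sphere hcl ?_ (hasLogOn_of_convex hC hCs hq hp)
      (hasLogOn_arc hγ hinj (continuousOn_sub_div_sub hpγ) (sub_div_sub_ne_zero hqγ hpγ))
    have : sphere (0 : ℂ) 1 ∩ γ '' Icc a b ⊆ {γ a} := by
      rintro _ ⟨hz, t, ht, rfl⟩
      rw [(hsph t ht).1 hz]; rfl
    exact (subsingleton_singleton.anti this).isPreconnected
  have h2 : HasLogOn (sphere (0 : ℂ) 1 ∪ T) (fun z => (z - q) / (z - p)) :=
    hasLogOn_of_convex hC (disjoint_union_right.2 ⟨hCs, hCT⟩) hq hp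
  have h3 := h1.union (isClosed_sphere.union hcl) (isClosed_sphere.union hT.isClosed) (by
    have : (sphere (0 : ℂ) 1 ∪ γ '' Icc a b) ∩ (sphere 0 1 ∪ T) = sphere 0 1 := by
      rw [← union_inter_distrib_left, union_eq_left, inter_comm]
      exact hTγ
    rw [this]
    exact isPreconnected_unit_sphere) h2
  refine connIn_of_hasLogOn (isOpen_ball.sdiff hclA) (isBounded_ball.subset sdiff_subset)
    ⟨hCb hq, ?_⟩ ⟨hCb hp, ?_⟩ (h3.mono ((frontier_ball_diff_subset hclA).trans ?_))
  · rintro (h | h)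
    exacts [hqγ h, disjoint_left.1 hCT hq h]
  · rintro (h | h)
    exacts [hpγ h, disjoint_left.1 hCT hp h]
  · rintro z (h | h | h)
    exacts [Or.inl (Or.inl h), Or.inl (Or.inr h), Or.inr (Or.inr h)]

/-- A crosscut of the disc has locally at most two sides. -/
lemma connIn_disc_of_crosscut (hγ : ContinuousOn γ (Icc a b))
    (hinj : InjOn γ (Icc a b)) (hsph : ∀ t ∈ Icc a b, γ t ∈ sphere (0 : ℂ) 1 ↔ t = a ∨ t = b)
    (hab : a ≤ b)
    (hT : IsCompact T) (hTγ : T ∩ γ '' Icc a b ⊆ sphere 0 1)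
    (hC : Convex ℝ C) (hCb : C ⊆ ball 0 1) (hCT : Disjoint C T) {p q r : ℂ}
    (hp : p ∈ C) (hq : q ∈ C) (hr : r ∈ C) (hpγ : p ∉ γ '' Icc a b) (hqγ : q ∉ γ '' Icc a b)
    (hrγ : r ∉ γ '' Icc a b) :
    ConnIn (ball (0 : ℂ) 1 \ (γ '' Icc a b ∪ T)) p q ∨
    ConnIn (ball (0 : ℂ) 1 \ (γ '' Icc a b ∪ T)) p r ∨
    ConnIn (ball (0 : ℂ) 1 \ (γ '' Icc a b ∪ T)) q r := by
  have hcl : IsClosed (γ '' Icc a b) := (isCompact_arc hγ).isClosed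
  have hclA : IsClosed (γ '' Icc a b ∪ T) := hcl.union hT.isClosed
  have hCs : Disjoint C (sphere (0 : ℂ) 1) := disjoint_left.2 fun z hz hz' =>
    (mem_ball.1 (hCb hz)).ne hz'
  have hΩ : ∀ s ∈ C, s ∉ γ '' Icc a b → s ∈ ball (0 : ℂ) 1 \ (γ '' Icc a b ∪ T) := by
    intro s hs hsγ
    refine ⟨hCb hs, ?_⟩
    rintro (h | h)
    exacts [hsγ h, disjoint_left.1 hCT hs h]
  have key : ∀ s ∈ C, s ∉ γ '' Icc a b → ∃ n : ℤ, ∃ l l' : ℂ → ℂ,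
      ContinuousOn l (sphere 0 1) ∧ ContinuousOn l' (γ '' Icc a b) ∧
      (∀ z ∈ sphere (0 : ℂ) 1, (z - p) / (z - s) = Complex.exp (l z)) ∧
      (∀ z ∈ γ '' Icc a b, (z - p) / (z - s) = Complex.exp (l' z)) ∧
      l (γ a) = l' (γ a) ∧ l (γ b) = l' (γ b) + n * (2 * Real.pi * Complex.I) := by
    intro s hs hsγ
    obtain ⟨l, hl, hle⟩ := hasLogOn_of_convex hC hCs hp hs
    obtain ⟨l', hl', hle'⟩ :=
      hasLogOn_arc hγ hinj (continuousOn_sub_div_sub hsγ) (sub_div_sub_ne_zero hpγ hsγ)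
    have ha : a ∈ Icc a b := ⟨le_rfl, hab⟩
    have hb : b ∈ Icc a b := ⟨hab, le_rfl⟩
    obtain ⟨n, hn⟩ := exists_int_of_exp_eq
      ((hle _ ((hsph a ha).2 (Or.inl rfl))).symm.trans (hle' _ (mem_image_of_mem _ ha)))
    obtain ⟨m, hm⟩ := exists_int_of_exp_eq
      ((hle _ ((hsph b hb).2 (Or.inr rfl))).symm.trans (hle' _ (mem_image_of_mem _ hb)))
    refine ⟨m - n, l, fun z => l' z + n * (2 * Real.pi * Complex.I), hl,
      hl'.add continuousOn_const, hle, fun z hz => ?_, ?_, ?_⟩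
    · rw [exp_add_int_mul]; exact hle' z hz
    · linear_combination hn
    · push_cast
      linear_combination hm
  obtain ⟨n, f, f', hf, hf', hfe, hfe', hfa, hfb⟩ := key q hq hqγ
  obtain ⟨m, g, g', hg, hg', hge, hge', hga, hgb⟩ := key r hr hrγ
  obtain ⟨k, l, hkl, hkl'⟩ : ∃ k l : ℤ, (k ≠ 0 ∨ l ≠ 0) ∧ k * n + l * m = 0 := by
    by_cases hm : m = 0
    · exact ⟨0, 1, by simp, by simp [hm]⟩
    · exact ⟨m, -n, Or.inl hm, by ring⟩
  have hkl'' : (k : ℂ) * n + l * m = 0 := by exact_mod_cast hkl'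
  refine connIn_of_hasLogOn_three (k := k) (l := l) (isOpen_ball.sdiff hclA)
    (isBounded_ball.subset sdiff_subset) (hΩ p hp hpγ) (hΩ q hq hqγ) (hΩ r hr hrγ) hkl ?_
  have h1 : HasLogOn (sphere (0 : ℂ) 1 ∪ γ '' Icc a b)
      (fun z => ((z - p) / (z - q)) ^ k * ((z - p) / (z - r)) ^ l) := by
    refine HasLogOn.union_of_eqOn (l := fun z => k * f z + l * g z)
      (l' := fun z => k * f' z + l * g' z) isClosed_sphere hcl
      ((continuousOn_const.mul hf).add (continuousOn_const.mul hg))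
      ((continuousOn_const.mul hf').add (continuousOn_const.mul hg')) ?_ ?_ ?_
    · intro z hz
      rw [Complex.exp_add, Complex.exp_int_mul, Complex.exp_int_mul, hfe z hz, hge z hz]
    · intro z hz
      rw [Complex.exp_add, Complex.exp_int_mul, Complex.exp_int_mul, hfe' z hz, hge' z hz]
    · rintro _ ⟨hz, t, ht, rfl⟩
      rcases (hsph t ht).1 hz with rfl | rfl
      · simp only [hfa, hga]
      · simp only [hfb, hgb]
        linear_combination (2 * Real.pi * Complex.I) * hkl''
  have hCsT : Disjoint C (sphere (0 : ℂ) 1 ∪ T) := disjoint_union_right.2 ⟨hCs, hCT⟩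
  have h2 : HasLogOn (sphere (0 : ℂ) 1 ∪ T)
      (fun z => ((z - p) / (z - q)) ^ k * ((z - p) / (z - r)) ^ l) :=
    ((hasLogOn_of_convex hC hCsT hp hq).zpow k).mul ((hasLogOn_of_convex hC hCsT hp hr).zpow l)
  have h3 := h1.union (isClosed_sphere.union hcl) (isClosed_sphere.union hT.isClosed) (by
    have : (sphere (0 : ℂ) 1 ∪ γ '' Icc a b) ∩ (sphere 0 1 ∪ T) = sphere 0 1 := by
      rw [← union_inter_distrib_left, union_eq_left, inter_comm]
      exact hTγ
    rw [this]
    exact isPreconnected_unit_sphere) h2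
  refine h3.mono ((frontier_ball_diff_subset hclA).trans ?_)
  rintro z (h | h | h)
  exacts [Or.inl (Or.inl h), Or.inl (Or.inr h), Or.inr (Or.inr h)]

end Disc

lemma mem_unit_sphere_eq_exp {c : ℂ} (hc : c ∈ sphere (0 : ℂ) 1) :
    ∃ θ : ℝ, c = Complex.exp (θ * Complex.I) := by
  refine ⟨c.arg, ?_⟩
  have := Complex.norm_mul_exp_arg_mul_I c
  rw [mem_sphere_zero_iff_norm] at hc
  rw [hc] at this
  simpa using this.symm

lemma hasLogOn_ball_of_sphere {c d : ℂ} (hc : c ∈ sphere (0 : ℂ) 1) (hd : d ∈ sphere (0 : ℂ) 1) :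
    HasLogOn (ball (0 : ℂ) 1) (fun z => (z - d) / (z - c)) := by
  obtain ⟨θ, rfl⟩ := mem_unit_sphere_eq_exp hc
  obtain ⟨η, rfl⟩ := mem_unit_sphere_eq_exp hd
  have := hasLogOn_path (X := ball (0 : ℂ) 1)
    (δ := fun t : ℝ => Complex.exp ((θ + t * (η - θ) : ℝ) * Complex.I)) (a := 0) (b := 1) zero_le_one
    (by fun_prop) (fun t _ h => ?_)
  · simpa using this
  · rw [mem_ball_zero_iff, Complex.norm_exp_ofReal_mul_I] at h
    exact lt_irrefl _ h

section Disc
variable {γ : ℝ → ℂ} {a b : ℝ}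

/-- A crosscut of the disc locally has two sides everywhere. -/
lemma exists_side_function_disc (hγ : ContinuousOn γ (Icc a b))
    (hinj : InjOn γ (Icc a b)) (hsph : ∀ t ∈ Icc a b, γ t ∈ sphere (0 : ℂ) 1 ↔ t = a ∨ t = b)
    (hγD : ∀ t ∈ Icc a b, γ t ∈ closedBall (0 : ℂ) 1) (hab : a < b) :
    ∃ n : ℂ → ℤ, (∀ S ⊆ ball (0 : ℂ) 1 \ γ '' Icc a b, IsPreconnected S →
        ∀ p ∈ S, ∀ q ∈ S, n p = n q) ∧
      ∀ t ∈ Ioo a b, ∀ V ∈ 𝓝 (γ t), ∃ p ∈ V \ γ '' Icc a b, ∃ q ∈ V \ γ '' Icc a b,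
        n p ≠ n q := by
  have ha : a ∈ Icc a b := ⟨le_rfl, hab.le⟩
  have hb : b ∈ Icc a b := ⟨hab.le, le_rfl⟩
  have hcl : IsClosed (γ '' Icc a b) := (isCompact_arc hγ).isClosed
  obtain ⟨f, hf, hfe⟩ := hasLogOn_path (X := (γ '' Icc a b)ᶜ) hab.le hγ
    (fun t ht h => h (mem_image_of_mem _ ht))
  obtain ⟨g, hg, hge⟩ := hasLogOn_ball_of_sphere ((hsph a ha).2 (Or.inl rfl))
    ((hsph b hb).2 (Or.inr rfl))
  have hn : ∀ z ∈ ball (0 : ℂ) 1 \ γ '' Icc a b, ∃ n : ℤ,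
      f z - g z = n * (2 * Real.pi * Complex.I) := fun z hz =>
    exists_int_of_exp_eq ((hfe z hz.2).symm.trans (hge z hz.1))
  choose! n hn using hn
  refine ⟨n, ?_, ?_⟩
  · intro S hS hSc p hp q hq
    obtain ⟨m, hm⟩ := hSc.log_sub_const (hf.mono fun z hz => (hS hz).2)
      (hg.mono fun z hz => (hS hz).1)
      (fun z hz => (hfe z (hS hz).2).symm.trans (hge z (hS hz).1))
    have : ∀ z ∈ S, n z = m := by
      intro z hz
      have h1 := hn z (hS hz)
      rw [hm z hz, add_sub_cancel_left] at h1
      exact_mod_cast (mul_right_cancel₀ Complex.two_pi_I_ne_zero h1).symm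
    rw [this p hp, this q hq]
  · intro t ht V hV
    by_contra hcon
    push Not at hcon
    have htI := Ioo_subset_Icc_self ht
    have hball : γ t ∈ ball (0 : ℂ) 1 := by
      have h1 := hγD t htI
      refine lt_of_le_of_ne (mem_closedBall.1 h1) fun h => ?_
      rcases (hsph t htI).1 h with h | h
      exacts [ht.1.ne' h, ht.2.ne h]
    obtain ⟨W, hW, hWo, hWt⟩ := _root_.mem_nhds_iff.1 (inter_mem hV (isOpen_ball.mem_nhds hball))
    obtain ⟨n₀, hn₀⟩ : ∃ n₀, ∀ z ∈ W \ γ '' Icc a b, n z = n₀ := by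
      rcases (W \ γ '' Icc a b).eq_empty_or_nonempty with h | ⟨z₀, hz₀⟩
      · exact ⟨0, by simp [h]⟩
      · exact ⟨n z₀, fun z hz => hcon z ⟨(hW hz.1).1, hz.2⟩ z₀ ⟨(hW hz₀.1).1, hz₀.2⟩⟩
    classical
    let F : ℂ → ℂ := W.piecewise (fun z => g z + n₀ * (2 * Real.pi * Complex.I)) f
    have hFW : ∀ z ∈ W, F z = g z + n₀ * (2 * Real.pi * Complex.I) := fun z hz =>
      piecewise_eq_of_mem _ _ _ hz
    have hFf : ∀ z ∈ (γ '' Icc a b)ᶜ, F z = f z := by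
      intro z hz
      by_cases hzW : z ∈ W
      · rw [hFW z hzW]
        have := hn z ⟨(hW hzW).2, hz⟩
        rw [hn₀ z ⟨hzW, hz⟩] at this
        linear_combination -this
      · exact piecewise_eq_of_notMem _ _ _ hzW
    have hFc : ContinuousOn F ((γ '' Icc a b)ᶜ ∪ W) := by
      refine ContinuousOn.union_of_isOpen (hf.congr hFf) ?_ hcl.isOpen_compl hWo
      exact ((hg.mono fun z hz => (hW hz).2).add continuousOn_const).congr hFW
    have hFe : ∀ z ∈ (γ '' Icc a b)ᶜ ∪ W, (z - γ b) / (z - γ a) = Complex.exp (F z) := by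
      rintro z (hz | hz)
      · rw [hFf z hz]; exact hfe z hz
      · rw [hFW z hz, exp_add_int_mul]; exact hge z (hW hz).2
    have hWs : ∀ z ∈ W, z ∉ sphere (0 : ℂ) 1 := fun z hz h => (mem_ball.1 (hW hz).2).ne h
    have hA : IsCompact (γ '' Icc a t \ W) :=
      (isCompact_arc (hγ.mono (Icc_subset_Icc_right ht.2.le))).diff hWo
    have hB : IsCompact (γ '' Icc t b \ W) :=
      (isCompact_arc (hγ.mono (Icc_subset_Icc_left ht.1.le))).diff hWo
    have hAB : γ '' Icc a t \ W ⊆ (γ '' Icc t b \ W)ᶜ := by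
      rintro _ ⟨⟨u, hu, rfl⟩, huW⟩ ⟨⟨v, hv, huv⟩, -⟩
      have := hinj ⟨hv.1.trans' ht.1.le, hv.2⟩ ⟨hu.1, hu.2.trans ht.2.le⟩ huv
      subst this
      have : v = t := le_antisymm hu.2 hv.1
      subst this
      exact huW hWt
    obtain ⟨ε, hε, hεs⟩ := hA.exists_cthickening_subset_open hB.isClosed.isOpen_compl hAB
    set U := thickening ε (γ '' Icc a t \ W)
    have hUc : closure U ⊆ (γ '' Icc t b \ W)ᶜ := (closure_thickening_subset_cthickening _ _).trans hεs
    have haU : γ a ∈ U := self_subset_thickening hε _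
      ⟨mem_image_of_mem _ ⟨le_rfl, ht.1.le⟩, fun h => hWs _ h ((hsph a ha).2 (Or.inl rfl))⟩
    have hbU : γ b ∉ closure U := fun h => hUc h
      ⟨mem_image_of_mem _ ⟨ht.2.le, le_rfl⟩, fun h => hWs _ h ((hsph b hb).2 (Or.inr rfl))⟩
    have hfr : frontier U ⊆ (γ '' Icc a b)ᶜ ∪ W := by
      intro z hz
      by_contra hzn
      simp only [mem_union, not_or, mem_compl_iff, not_not] at hzn
      obtain ⟨⟨u, hu, rfl⟩, huW⟩ := hzn
      rw [isOpen_thickening.frontier_eq] at hz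
      rcases le_total u t with h | h
      · exact hz.2 (self_subset_thickening hε _ ⟨mem_image_of_mem _ ⟨hu.1, h⟩, huW⟩)
      · exact hUc hz.1 ⟨mem_image_of_mem _ ⟨h, hu.2⟩, huW⟩
    have hne : ∀ z ∈ closure U, z - γ b ≠ 0 := fun z hz h => hbU (sub_eq_zero.1 h ▸ hz)
    have := eq_zero_of_log_on_frontier (U := U) isOpen_thickening hA.isBounded.thickening haU
      (H := fun z => z - γ b) (L := fun z => - F z) (k := 1) (by fun_prop) hne
      (hFc.mono hfr).neg ?_
    · simp at this
    · intro z hz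
      rw [Complex.exp_neg, ← hFe z (hfr hz)]
      have h1 := hne z (frontier_subset_closure hz)
      rw [inv_div, zpow_one, div_mul_cancel₀ _ h1]

end Disc

/-! ### Surfaces -/

/-- Every point has arbitrarily small open neighbourhoods homeomorphic to the plane. -/
class IsSurface (M : Type*) [TopologicalSpace M] : Prop where
  exists_chart : ∀ x : M, ∀ O ∈ 𝓝 x, ∃ φ : ℂ → M, IsOpenEmbedding φ ∧ φ 0 = x ∧ range φ ⊆ O

instance IsSurface.locallyConnectedSpace {M : Type*} [TopologicalSpace M]
    [IsSurface M] : LocallyConnectedSpace M := by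
  rw [locallyConnectedSpace_iff_subsets_isOpen_isConnected]
  intro x U hU
  obtain ⟨φ, hφ, hφ0, hφU⟩ := IsSurface.exists_chart x U hU
  exact ⟨range φ, hφU, hφ.isOpen_range, ⟨0, hφ0⟩, isConnected_range hφ.continuous⟩

lemma Topology.IsOpenEmbedding.exists_inverse {M : Type*} [TopologicalSpace M] {φ : ℂ → M}
    (hφ : IsOpenEmbedding φ) :
    ∃ ψ : M → ℂ, ContinuousOn ψ (range φ) ∧ ∀ z, ψ (φ z) = z := by
  refine ⟨Function.invFun φ, ?_, Function.leftInverse_invFun hφ.injective⟩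
  rw [continuousOn_open_iff hφ.isOpen_range]
  intro t ht
  have : range φ ∩ Function.invFun φ ⁻¹' t = φ '' t := by
    ext x
    constructor
    · rintro ⟨⟨z, rfl⟩, hz⟩
      rw [mem_preimage, Function.leftInverse_invFun hφ.injective] at hz
      exact ⟨z, hz, rfl⟩
    · rintro ⟨z, hz, rfl⟩
      refine ⟨⟨z, rfl⟩, ?_⟩
      rw [mem_preimage, Function.leftInverse_invFun hφ.injective]
      exact hz
  rw [this]
  exact hφ.isOpenMap _ ht

/-- `Θ` locally separates `M` into two sides near `y`. -/
def TwoSidedAt {M : Type*} [TopologicalSpace M] (Θ : Set M) (y : M) : Prop :=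
  ∀ O ∈ 𝓝 y, ∃ O' : Set M, IsOpen O' ∧ y ∈ O' ∧ O' ⊆ O ∧ ∃ s : M → Prop,
    (∀ p ∈ O' \ Θ, ∀ q ∈ O' \ Θ, (s p ↔ s q) → ConnIn (O \ Θ) p q) ∧
    (∀ w ∈ O' ∩ Θ, ∀ V ∈ 𝓝 w, (∃ p ∈ (V ∩ O') \ Θ, s p) ∧ ∃ p ∈ (V ∩ O') \ Θ, ¬ s p) ∧
    (∀ C ⊆ O' \ Θ, IsPreconnected C → ∀ p ∈ C, ∀ q ∈ C, (s p ↔ s q))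

section Exit
variable {M : Type*} [TopologicalSpace M] {γ : ℝ → M} {a b : ℝ} {D : Set M}

lemma exists_last_notMem (hγ : ContinuousOn γ (Icc a b)) (hD : IsOpen D) (hab : a ≤ b)
    (ha : γ a ∉ D) (hb : γ b ∈ D) :
    ∃ t ∈ Ico a b, γ t ∉ D ∧ γ t ∈ closure D ∧ ∀ u ∈ Ioc t b, γ u ∈ D := by
  have hcl : IsClosed (Icc a b ∩ γ ⁻¹' Dᶜ) :=
    hγ.preimage_isClosed_of_isClosed isClosed_Icc hD.isClosed_compl
  have hcp : IsCompact (Icc a b ∩ γ ⁻¹' Dᶜ) := isCompact_Icc.of_isClosed_subset hcl inter_subset_left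
  obtain ⟨t, ht, hmax⟩ := hcp.exists_isGreatest ⟨a, ⟨le_rfl, hab⟩, ha⟩
  have htb : t < b := lt_of_le_of_ne ht.1.2 fun h => ht.2 (h ▸ hb)
  have hlast : ∀ u ∈ Ioc t b, γ u ∈ D := by
    intro u hu
    by_contra h
    exact absurd (hmax ⟨⟨ht.1.1.trans hu.1.le, hu.2⟩, h⟩) (not_le.2 hu.1)
  refine ⟨t, ⟨ht.1.1, htb⟩, ht.2, ?_, hlast⟩
  have h1 : ContinuousWithinAt γ (Ioc t b) t :=
    (hγ t ht.1).mono fun u hu => ⟨ht.1.1.trans hu.1.le, hu.2⟩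
  refine h1.mem_closure ?_ hlast
  rw [closure_Ioc htb.ne]
  exact ⟨le_rfl, htb.le⟩

lemma exists_first_notMem (hγ : ContinuousOn γ (Icc a b)) (hD : IsOpen D) (hab : a ≤ b)
    (ha : γ a ∈ D) (hb : γ b ∉ D) :
    ∃ t ∈ Ioc a b, γ t ∉ D ∧ γ t ∈ closure D ∧ ∀ u ∈ Ico a t, γ u ∈ D := by
  obtain ⟨t, ht, h1, h2, h3⟩ := exists_last_notMem (γ := fun t => γ (-t)) (a := -b) (b := -a)
    (hγ.comp continuous_neg.continuousOn fun t ht => ⟨by linarith [ht.2], by linarith [ht.1]⟩)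
    hD (by linarith) (by simpa) (by simpa)
  refine ⟨-t, ⟨by linarith [ht.2], by linarith [ht.1]⟩, h1, h2, fun u hu => ?_⟩
  have := h3 (-u) ⟨by linarith [hu.2], by linarith [hu.1]⟩
  simpa using this

end Exit

section Local
variable {M : Type*} [TopologicalSpace M] [T2Space M]

lemma closure_chart_ball {φ : ℂ → M} (hφ : Continuous φ) :
    closure (φ '' ball 0 1) ⊆ φ '' closedBall 0 1 :=
  closure_minimal (image_mono ball_subset_closedBall)
    ((isCompact_closedBall _ _).image hφ).isClosed

lemma mem_sphere_of_mem_closure_chart {φ : ℂ → M} (hφ : Continuous φ) {x : M}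
    (h : x ∉ φ '' ball 0 1) (h' : x ∈ closure (φ '' ball 0 1)) : x ∈ φ '' sphere 0 1 := by
  obtain ⟨z, hz, rfl⟩ := closure_chart_ball hφ h'
  refine ⟨z, ?_, rfl⟩
  by_contra hs
  exact h ⟨z, mem_ball.2 (lt_of_le_of_ne (mem_closedBall.1 hz) hs), rfl⟩

lemma isCompact_chart_preimage {φ : ℂ → M} (hφ : Continuous φ) {K : Set M} (hK : IsCompact K) :
    IsCompact (φ ⁻¹' K ∩ closedBall 0 1) :=
  (isCompact_closedBall _ _).inter_left (hK.isClosed.preimage hφ)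

/-- An arc does not separate locally near its end point. -/
lemma exists_nhds_connIn_of_arc_end [IsSurface M] {γ : ℝ → M} {a b : ℝ} (hab : a ≤ b)
    (hγ : ContinuousOn γ (Icc a b)) (hinj : InjOn γ (Icc a b)) {O : Set M} (hO : O ∈ 𝓝 (γ b)) :
    ∃ O' ∈ 𝓝 (γ b), O' ⊆ O ∧
      ∀ p ∈ O' \ γ '' Icc a b, ∀ q ∈ O' \ γ '' Icc a b, ConnIn (O \ γ '' Icc a b) p q := by
  rcases hab.eq_or_lt with rfl | hlt
  · obtain ⟨φ, hφ, hφ0, hφO⟩ := IsSurface.exists_chart _ _ hO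
    refine ⟨range φ, hφ.isOpen_range.mem_nhds ⟨0, hφ0⟩, hφO, ?_⟩
    rw [Icc_self, image_singleton]
    rintro _ ⟨⟨z, rfl⟩, hz⟩ _ ⟨⟨w, rfl⟩, hw⟩
    have h0 : ∀ z : ℂ, φ z ∉ ({γ a} : Set M) ↔ z ∈ ({0}ᶜ : Set ℂ) := fun z => by
      rw [mem_singleton_iff, mem_compl_iff, mem_singleton_iff, ← hφ0, hφ.injective.eq_iff]
    have hc : IsPreconnected ({0}ᶜ : Set ℂ) :=
      (isConnected_compl_singleton_of_one_lt_rank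
        (by rw [Complex.rank_real_complex]; norm_num) 0).isPreconnected
    refine ((hc.connIn ((h0 z).1 hz) ((h0 w).1 hw)).image hφ.continuous.continuousOn).mono ?_
    rintro _ ⟨u, hu, rfl⟩
    exact ⟨hφO ⟨u, rfl⟩, (h0 u).2 hu⟩
  · have hne : γ a ≠ γ b := fun h => hlt.ne (hinj ⟨le_rfl, hab⟩ ⟨hab, le_rfl⟩ h)
    obtain ⟨φ, hφ, hφ0, hφO⟩ := IsSurface.exists_chart _ _
      (inter_mem hO (isOpen_compl_singleton.mem_nhds hne.symm))
    obtain ⟨ψ, hψ, hψφ⟩ := hφ.exists_inverse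
    have hφψ : ∀ x ∈ range φ, φ (ψ x) = x := by rintro _ ⟨z, rfl⟩; rw [hψφ]
    have hD : IsOpen (φ '' ball 0 1) := hφ.isOpenMap _ isOpen_ball
    obtain ⟨t₁, ht₁, hn, hcl, hlast⟩ := exists_last_notMem hγ hD hab
      (by rintro ⟨z, -, hz⟩; exact (hφO ⟨z, rfl⟩).2 hz) ⟨0, by simp, hφ0⟩
    have hsub : Icc t₁ b ⊆ Icc a b := Icc_subset_Icc_left ht₁.1
    have hsub' : Icc a t₁ ⊆ Icc a b := Icc_subset_Icc_right ht₁.2.le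
    have hrange : ∀ t ∈ Icc t₁ b, γ t ∈ range φ := by
      intro t ht
      rcases ht.1.eq_or_lt with rfl | h
      · exact image_subset_range _ _ (closure_chart_ball hφ.continuous hcl)
      · exact image_subset_range _ _ (hlast t ⟨h, ht.2⟩)
    have hηc : ContinuousOn (fun t => ψ (γ t)) (Icc t₁ b) := hψ.comp (hγ.mono hsub) hrange
    have hηi : InjOn (fun t => ψ (γ t)) (Icc t₁ b) := by
      intro s hs t ht h
      refine hinj (hsub hs) (hsub ht) ?_
      rw [← hφψ _ (hrange s hs), ← hφψ _ (hrange t ht)]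
      exact congrArg φ h
    have hηs : ψ (γ t₁) ∈ sphere (0 : ℂ) 1 := by
      obtain ⟨z, hz, hzt⟩ := mem_sphere_of_mem_closure_chart hφ.continuous hn hcl
      rw [← hzt, hψφ]; exact hz
    have hηsph : ∀ t ∈ Icc t₁ b, ψ (γ t) ∈ sphere (0 : ℂ) 1 ↔ t = t₁ := by
      refine fun t ht => ⟨fun h => ?_, fun h => h ▸ hηs⟩
      by_contra hne
      obtain ⟨z, hz, hzt⟩ := hlast t ⟨lt_of_le_of_ne ht.1 (Ne.symm hne), ht.2⟩
      rw [← hzt, hψφ] at h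
      exact (mem_ball.1 hz).ne h
    set T := φ ⁻¹' (γ '' Icc a t₁) ∩ closedBall 0 1 with hTdef
    have hT : IsCompact T := isCompact_chart_preimage hφ.continuous (isCompact_arc (hγ.mono hsub'))
    have hTη : T ∩ (fun t => ψ (γ t)) '' Icc t₁ b ⊆ sphere 0 1 := by
      rintro z ⟨⟨⟨u, hu, huz⟩, -⟩, t, ht, rfl⟩
      rw [hφψ _ (hrange t ht)] at huz
      have := hinj (hsub' hu) (hsub ht) huz
      have h2 : t = t₁ := le_antisymm (this ▸ hu.2) ht.1
      exact (hηsph t ht).2 h2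
    have h0T : (0 : ℂ) ∉ T := by
      rintro ⟨⟨u, hu, hu0⟩, -⟩
      rw [hφ0] at hu0
      have := hinj (hsub' hu) ⟨hab, le_rfl⟩ hu0
      linarith [hu.2, ht₁.2]
    obtain ⟨ρ, hρ, hρs⟩ := Metric.mem_nhds_iff.1
      (inter_mem (ball_mem_nhds (0 : ℂ) one_pos) (hT.isClosed.isOpen_compl.mem_nhds h0T))
    have hO' : φ '' ball 0 ρ ∈ 𝓝 (γ b) :=
      (hφ.isOpenMap _ isOpen_ball).mem_nhds ⟨0, mem_ball_self hρ, hφ0⟩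
    have hsubO : φ '' ball 0 ρ ⊆ O := by
      rintro _ ⟨z, -, rfl⟩; exact (hφO ⟨z, rfl⟩).1
    refine ⟨φ '' ball 0 ρ, hO', hsubO, ?_⟩
    have hη : ∀ z, φ z ∉ γ '' Icc a b → z ∉ (fun t => ψ (γ t)) '' Icc t₁ b := by
      rintro _ hz ⟨t, ht, rfl⟩
      apply hz
      refine ⟨t, hsub ht, ?_⟩
      simp only [hφψ _ (hrange t ht)]
    rintro _ ⟨⟨z, hz, rfl⟩, hzγ⟩ _ ⟨⟨w, hw, rfl⟩, hwγ⟩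
    have := connIn_disc_of_arc_end hηc hηi hηsph hT hTη (convex_ball 0 ρ)
      (fun z hz => (hρs hz).1) (disjoint_left.2 fun z hz => (hρs hz).2) hz hw (hη z hzγ) (hη w hwγ)
    refine (this.image hφ.continuous.continuousOn).mono ?_
    rintro _ ⟨z, ⟨hz1, hz2⟩, rfl⟩
    refine ⟨(hφO ⟨z, rfl⟩).1, ?_⟩
    rintro ⟨u, hu, huz⟩
    apply hz2
    rcases le_total u t₁ with h | h
    · exact Or.inr ⟨⟨u, ⟨hu.1, h⟩, huz⟩, ball_subset_closedBall hz1⟩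
    · exact Or.inl ⟨u, ⟨h, hu.2⟩, by simp only [huz, hψφ]⟩

/-- A closed set which is an arc near an interior point of the arc has two sides there. -/
lemma twoSidedAt_of_arc [IsSurface M] {γ : ℝ → M} {a b t₀ : ℝ}
    (hγ : ContinuousOn γ (Icc a b)) (hinj : InjOn γ (Icc a b)) (ht₀ : t₀ ∈ Ioo a b) {Θ N : Set M}
    (hN : N ∈ 𝓝 (γ t₀)) (hΘ : ∀ x ∈ N, x ∈ Θ ↔ x ∈ γ '' Icc a b) : TwoSidedAt Θ (γ t₀) := by
  intro O hO
  have hab : a < b := ht₀.1.trans ht₀.2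
  have hme : ∀ t ∈ Icc a b, t ≠ t₀ → γ t₀ ∈ ({γ t}ᶜ : Set M) := fun t ht h h' =>
    h (hinj ht (Ioo_subset_Icc_self ht₀) h'.symm)
  obtain ⟨φ, hφ, hφ0, hφO⟩ := IsSurface.exists_chart (γ t₀) (O ∩ N ∩ ({γ a}ᶜ ∩ {γ b}ᶜ))
    (inter_mem (inter_mem hO hN)
      (inter_mem (isOpen_compl_singleton.mem_nhds (hme a ⟨le_rfl, hab.le⟩ ht₀.1.ne))
      (isOpen_compl_singleton.mem_nhds (hme b ⟨hab.le, le_rfl⟩ ht₀.2.ne'))))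
  obtain ⟨ψ, hψ, hψφ⟩ := hφ.exists_inverse
  have hφψ : ∀ x ∈ range φ, φ (ψ x) = x := by rintro _ ⟨z, rfl⟩; rw [hψφ]
  have hD : IsOpen (φ '' ball 0 1) := hφ.isOpenMap _ isOpen_ball
  obtain ⟨t₁, ht₁, hn₁, hcl₁, hlast₁⟩ := exists_last_notMem
    (hγ.mono (Icc_subset_Icc_right ht₀.2.le)) hD ht₀.1.le
    (by rintro ⟨z, -, hz⟩; exact (hφO ⟨z, rfl⟩).2.1 hz) ⟨0, by simp, hφ0⟩
  obtain ⟨t₂, ht₂, hn₂, hcl₂, hlast₂⟩ := exists_first_notMem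
    (hγ.mono (Icc_subset_Icc_left ht₀.1.le)) hD ht₀.2.le
    ⟨0, by simp, hφ0⟩ (by rintro ⟨z, -, hz⟩; exact (hφO ⟨z, rfl⟩).2.2 hz)
  have ht₁₂ : t₁ < t₂ := ht₁.2.trans ht₂.1
  have hsub : Icc t₁ t₂ ⊆ Icc a b := Icc_subset_Icc ht₁.1 ht₂.2
  have hsub₁ : Icc a t₁ ⊆ Icc a b := Icc_subset_Icc_right (ht₁.2.le.trans ht₀.2.le)
  have hsub₂ : Icc t₂ b ⊆ Icc a b := Icc_subset_Icc_left (ht₀.1.le.trans ht₂.1.le)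
  have hin : ∀ t ∈ Ioo t₁ t₂, γ t ∈ φ '' ball 0 1 := by
    intro t ht
    rcases le_total t t₀ with h | h
    · exact hlast₁ t ⟨ht.1, h⟩
    · exact hlast₂ t ⟨h, ht.2⟩
  have hout : ∀ t ∈ Icc t₁ t₂, t = t₁ ∨ t = t₂ → γ t ∈ φ '' sphere 0 1 := by
    rintro t - (rfl | rfl)
    · exact mem_sphere_of_mem_closure_chart hφ.continuous hn₁ hcl₁
    · exact mem_sphere_of_mem_closure_chart hφ.continuous hn₂ hcl₂
  have hcases : ∀ t ∈ Icc t₁ t₂, t ∈ Ioo t₁ t₂ ∨ (t = t₁ ∨ t = t₂) := by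
    intro t ht
    rcases ht.1.eq_or_lt with h | h
    · exact Or.inr (Or.inl h.symm)
    rcases ht.2.eq_or_lt with h' | h'
    · exact Or.inr (Or.inr h')
    exact Or.inl ⟨h, h'⟩
  have hrange : ∀ t ∈ Icc t₁ t₂, γ t ∈ φ '' closedBall 0 1 := by
    intro t ht
    rcases hcases t ht with h | h
    · exact image_mono ball_subset_closedBall (hin t h)
    · exact image_mono sphere_subset_closedBall (hout t ht h)
  have hrange' : ∀ t ∈ Icc t₁ t₂, γ t ∈ range φ := fun t ht => image_subset_range _ _ (hrange t ht)
  set η : ℝ → ℂ := fun t => ψ (γ t) with hη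
  have hφη : ∀ t ∈ Icc t₁ t₂, φ (η t) = γ t := fun t ht => hφψ _ (hrange' t ht)
  have hηc : ContinuousOn η (Icc t₁ t₂) := hψ.comp (hγ.mono hsub) hrange'
  have hηi : InjOn η (Icc t₁ t₂) := by
    intro s hs t ht h
    refine hinj (hsub hs) (hsub ht) ?_
    rw [← hφη s hs, ← hφη t ht, h]
  have hηD : ∀ t ∈ Icc t₁ t₂, η t ∈ closedBall (0 : ℂ) 1 := by
    intro t ht
    obtain ⟨z, hz, hzt⟩ := hrange t ht
    simp only [hη, ← hzt, hψφ]; exact hz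
  have hηsph : ∀ t ∈ Icc t₁ t₂, η t ∈ sphere (0 : ℂ) 1 ↔ t = t₁ ∨ t = t₂ := by
    intro t ht
    constructor
    · intro h
      rcases hcases t ht with h' | h'
      · obtain ⟨z, hz, hzt⟩ := hin t h'
        simp only [hη, ← hzt, hψφ] at h
        exact absurd h (mem_ball.1 hz).ne
      · exact h'
    · intro h
      obtain ⟨z, hz, hzt⟩ := hout t ht h
      simp only [hη, ← hzt, hψφ]; exact hz
  set T := φ ⁻¹' (γ '' Icc a t₁ ∪ γ '' Icc t₂ b) ∩ closedBall 0 1 with hTdef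
  have hT : IsCompact T := isCompact_chart_preimage hφ.continuous
    ((isCompact_arc (hγ.mono hsub₁)).union (isCompact_arc (hγ.mono hsub₂)))
  have hTη : T ∩ η '' Icc t₁ t₂ ⊆ sphere 0 1 := by
    rintro _ ⟨⟨⟨u, hu, huz⟩ | ⟨u, hu, huz⟩, -⟩, t, ht, rfl⟩
    · rw [hφη t ht] at huz
      have := hinj (hsub₁ hu) (hsub ht) huz
      exact (hηsph t ht).2 (Or.inl (le_antisymm (this ▸ hu.2) ht.1))
    · rw [hφη t ht] at huz
      have := hinj (hsub₂ hu) (hsub ht) huz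
      exact (hηsph t ht).2 (Or.inr (le_antisymm ht.2 (this ▸ hu.1)))
  have h0T : (0 : ℂ) ∉ T := by
    rintro ⟨⟨u, hu, hu0⟩ | ⟨u, hu, hu0⟩, -⟩
    · rw [hφ0] at hu0
      have := hinj (hsub₁ hu) (Ioo_subset_Icc_self ht₀) hu0
      linarith [hu.2, ht₁.2]
    · rw [hφ0] at hu0
      have := hinj (hsub₂ hu) (Ioo_subset_Icc_self ht₀) hu0
      linarith [hu.1, ht₂.1]
  have hΘη : ∀ z ∈ ball (0 : ℂ) 1, φ z ∈ Θ ↔ z ∈ η '' Icc t₁ t₂ ∪ T := by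
    intro z hz
    rw [hΘ _ (hφO ⟨z, rfl⟩).1.2]
    constructor
    · rintro ⟨u, hu, huz⟩
      rcases le_total u t₁ with h | h
      · exact Or.inr ⟨Or.inl ⟨u, ⟨hu.1, h⟩, huz⟩, ball_subset_closedBall hz⟩
      rcases le_total t₂ u with h' | h'
      · exact Or.inr ⟨Or.inr ⟨u, ⟨h', hu.2⟩, huz⟩, ball_subset_closedBall hz⟩
      · exact Or.inl ⟨u, ⟨h, h'⟩, by simp only [hη, huz, hψφ]⟩
    · rintro (⟨t, ht, rfl⟩ | ⟨⟨t, ht, htz⟩ | ⟨t, ht, htz⟩, -⟩)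
      · rw [hφη t ht]; exact mem_image_of_mem _ (hsub ht)
      · rw [← htz]; exact mem_image_of_mem _ (hsub₁ ht)
      · rw [← htz]; exact mem_image_of_mem _ (hsub₂ ht)
  obtain ⟨ρ, hρ, hρs⟩ := Metric.mem_nhds_iff.1
    (inter_mem (ball_mem_nhds (0 : ℂ) one_pos) (hT.isClosed.isOpen_compl.mem_nhds h0T))
  have hρ1 : ball (0 : ℂ) ρ ⊆ ball 0 1 := fun z hz => (hρs hz).1
  have hρT : Disjoint (ball (0 : ℂ) ρ) T := disjoint_left.2 fun z hz => (hρs hz).2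
  have hΘρ : ∀ z ∈ ball (0 : ℂ) ρ, φ z ∈ Θ ↔ z ∈ η '' Icc t₁ t₂ := by
    intro z hz
    rw [hΘη z (hρ1 hz)]
    exact or_iff_left fun h => disjoint_left.1 hρT hz h
  obtain ⟨n, hn, hn'⟩ := exists_side_function_disc hηc hηi hηsph hηD ht₁₂
  have hconn : ∀ p q, ConnIn (ball (0 : ℂ) 1 \ (η '' Icc t₁ t₂ ∪ T)) p q → n p = n q := by
    rintro p q ⟨C, hC, hCc, hp, hq⟩
    exact hn C (hC.trans (sdiff_subset_sdiff_right subset_union_left)) hCc p hp q hq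
  have hη0 : η t₀ = 0 := by simp only [hη, ← hφ0, hψφ]
  obtain ⟨p₀, ⟨hp₀, hp₀η⟩, p₁, ⟨hp₁, hp₁η⟩, hp₀₁⟩ := hn' t₀ ⟨ht₁.2, ht₂.1⟩ (ball 0 ρ)
    (by rw [hη0]; exact ball_mem_nhds _ hρ)
  have hthree : ∀ p ∈ ball (0 : ℂ) ρ \ η '' Icc t₁ t₂, ∀ q ∈ ball (0 : ℂ) ρ \ η '' Icc t₁ t₂,
      ∀ r ∈ ball (0 : ℂ) ρ \ η '' Icc t₁ t₂, n p = n q → n r ≠ n p →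
      ConnIn (ball (0 : ℂ) 1 \ (η '' Icc t₁ t₂ ∪ T)) p q := by
    intro p hp q hq r hr hpq hrp
    rcases connIn_disc_of_crosscut hηc hηi hηsph ht₁₂.le hT hTη (convex_ball 0 ρ) hρ1 hρT
      hp.1 hq.1 hr.1 hp.2 hq.2 hr.2 with h | h | h
    · exact h
    · exact absurd (hconn _ _ h).symm hrp
    · exact absurd ((hconn _ _ h).symm.trans hpq.symm) hrp
  have htwo : ∀ p ∈ ball (0 : ℂ) ρ \ η '' Icc t₁ t₂, n p = n p₀ ∨ n p = n p₁ := by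
    intro p hp
    rcases connIn_disc_of_crosscut hηc hηi hηsph ht₁₂.le hT hTη (convex_ball 0 ρ) hρ1 hρT
      hp.1 hp₀ hp₁ hp.2 hp₀η hp₁η with h | h | h
    · exact Or.inl (hconn _ _ h)
    · exact Or.inr (hconn _ _ h)
    · exact absurd (hconn _ _ h) hp₀₁
  refine ⟨φ '' ball 0 ρ, hφ.isOpenMap _ isOpen_ball, ⟨0, mem_ball_self hρ, hφ0⟩, ?_,
    fun x => n (ψ x) = n p₀, ?_, ?_, ?_⟩
  · rintro _ ⟨z, -, rfl⟩; exact (hφO ⟨z, rfl⟩).1.1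
  · rintro _ ⟨⟨p, hp, rfl⟩, hpΘ⟩ _ ⟨⟨q, hq, rfl⟩, hqΘ⟩ hs
    simp only [hψφ] at hs
    have hp' : p ∈ ball (0 : ℂ) ρ \ η '' Icc t₁ t₂ := ⟨hp, fun h => hpΘ ((hΘρ p hp).2 h)⟩
    have hq' : q ∈ ball (0 : ℂ) ρ \ η '' Icc t₁ t₂ := ⟨hq, fun h => hqΘ ((hΘρ q hq).2 h)⟩
    have hc : ConnIn (ball (0 : ℂ) 1 \ (η '' Icc t₁ t₂ ∪ T)) p q := by
      by_cases h : n p = n p₀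
      · exact hthree p hp' q hq' p₁ ⟨hp₁, hp₁η⟩ (h.trans (hs.1 h).symm)
          (fun h' => hp₀₁ (h.symm.trans h'.symm))
      · have h1 := (htwo p hp').resolve_left h
        have h2 := (htwo q hq').resolve_left fun h' => h (hs.2 h')
        exact hthree p hp' q hq' p₀ ⟨hp₀, hp₀η⟩ (h1.trans h2.symm) (fun h' => h h'.symm)
    refine (hc.image hφ.continuous.continuousOn).mono ?_
    rintro _ ⟨z, ⟨hz1, hz2⟩, rfl⟩
    exact ⟨(hφO ⟨z, rfl⟩).1.1, fun h => hz2 ((hΘη z hz1).1 h)⟩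
  · rintro _ ⟨⟨w, hw, rfl⟩, hwΘ⟩ V hV
    obtain ⟨t, ht, rfl⟩ := (hΘρ w hw).1 hwΘ
    have htIoo : t ∈ Ioo t₁ t₂ := by
      rcases hcases t ht with h | h
      · exact h
      · exact absurd ((hηsph t ht).2 h) (mem_ball.1 (hρ1 hw)).ne
    obtain ⟨p, ⟨⟨hpV, hp⟩, hpη⟩, q, ⟨⟨hqV, hq⟩, hqη⟩, hpq⟩ := hn' t htIoo (φ ⁻¹' V ∩ ball 0 ρ)
      (inter_mem (hφ.continuous.continuousAt.preimage_mem_nhds hV) (isOpen_ball.mem_nhds hw))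
    have hmem : ∀ z ∈ ball (0 : ℂ) ρ, φ z ∈ V → z ∉ η '' Icc t₁ t₂ →
        φ z ∈ (V ∩ φ '' ball 0 ρ) \ Θ := fun z hz hzV hzη =>
      ⟨⟨hzV, z, hz, rfl⟩, fun h => hzη ((hΘρ z hz).1 h)⟩
    by_cases h : n p = n p₀
    · refine ⟨⟨φ p, hmem p hp hpV hpη, by simpa only [hψφ]⟩, φ q, hmem q hq hqV hqη, ?_⟩
      simp only [hψφ]
      exact fun h' => hpq (h.trans h'.symm)
    · refine ⟨⟨φ q, hmem q hq hqV hqη, ?_⟩, φ p, hmem p hp hpV hpη, by simpa only [hψφ]⟩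
      simp only [hψφ]
      refine (htwo q ⟨hq, hqη⟩).resolve_right fun h' => hpq ?_
      exact ((htwo p ⟨hp, hpη⟩).resolve_left h).trans h'.symm
  · intro C hC hCc p hp q hq
    have hCr : C ⊆ range φ := fun x hx => image_subset_range _ _ (hC hx).1
    have : n (ψ p) = n (ψ q) := by
      refine hn (ψ '' C) ?_ (hCc.image _ (hψ.mono hCr)) _ (mem_image_of_mem _ hp) _
        (mem_image_of_mem _ hq)
      rintro _ ⟨x, hx, rfl⟩
      obtain ⟨⟨z, hz, rfl⟩, hxΘ⟩ := hC hx
      rw [hψφ]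
      exact ⟨hρ1 hz, fun h => hxΘ ((hΘρ z hz).2 h)⟩
    simp only [this]

end Local

/-! ### Separation by locally two-sided sets in simply connected spaces -/

lemma FiberBundleCore.exists_section {ι B F : Type*} [TopologicalSpace B] [TopologicalSpace F]
    [DiscreteTopology F] [Nonempty F] (Z : FiberBundleCore ι B F) [SimplyConnectedSpace B]
    [LocallyPathConnectedSpace B] :
    ∃ c : ι → B → F, (∀ i, ContinuousOn (c i) (Z.baseSet i)) ∧
      ∀ i j, ∀ x ∈ Z.baseSet i ∩ Z.baseSet j, c j x = Z.coordChange i j x (c i x) := by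
  have hcov : IsCoveringMap Z.proj := FiberBundle.isCoveringMap (F := F) (E := Z.Fiber)
  obtain ⟨b₀⟩ := (inferInstance : Nonempty B)
  obtain ⟨v₀⟩ := (inferInstance : Nonempty F)
  obtain ⟨s, ⟨-, hs⟩, -⟩ := hcov.existsUnique_continuousMap_lifts (ContinuousMap.id B) b₀
    (⟨b₀, v₀⟩ : Z.TotalSpace) rfl
  have hs' : ∀ x, (s x).1 = x := fun x => congrFun hs x
  refine ⟨fun i x => ((Z.localTriv i) (s x)).2, fun i => ?_, fun i j x hx => ?_⟩
  · refine continuous_snd.comp_continuousOn ?_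
    refine (Z.localTriv i).continuousOn.comp s.continuous.continuousOn fun x hx => ?_
    rw [(Z.localTriv i).mem_source]
    change (s x).1 ∈ Z.baseSet i
    rwa [hs']
  · simp only [FiberBundleCore.localTriv_apply]
    rw [hs' x]
    exact (Z.coordChange_comp _ i j x ⟨⟨Z.mem_baseSet_at x, hx.1⟩, hx.2⟩ _).symm

/-- A set that is two-sided near each of its points separates a simply connected space. -/
lemma not_isPreconnected_compl_of_twoSided {M : Type*} [TopologicalSpace M]
    [SimplyConnectedSpace M] [LocallyPathConnectedSpace M] {J : Set M} (hJ : IsClosed J)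
    (hne : J.Nonempty) (h2 : ∀ y ∈ J, TwoSidedAt J y) : ¬ IsPreconnected Jᶜ := by
  classical
  intro hpre
  have : LocallyConnectedSpace M := inferInstance
  -- local side functions
  have hloc : ∀ y : M, ∃ O : Set M, IsOpen O ∧ y ∈ O ∧ (y ∉ J → Disjoint O J) ∧ ∃ s : M → Prop,
      (∀ w ∈ O ∩ J, ∀ V ∈ 𝓝 w, (∃ p ∈ (V ∩ O) \ J, s p) ∧ ∃ p ∈ (V ∩ O) \ J, ¬ s p) ∧
      (∀ C ⊆ O \ J, IsPreconnected C → ∀ p ∈ C, ∀ q ∈ C, (s p ↔ s q)) := by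
    intro y
    by_cases hy : y ∈ J
    · obtain ⟨O, hO, hyO, -, s, -, h⟩ := h2 y hy univ univ_mem
      exact ⟨O, hO, hyO, fun h => absurd hy h, s, h⟩
    · exact ⟨Jᶜ, hJ.isOpen_compl, hy, fun _ => disjoint_compl_left, fun _ => True,
        fun w hw => absurd hw.2 hw.1, fun _ _ _ _ _ _ _ => Iff.rfl⟩
  choose O hO hyO hOJ s hs hs' using hloc
  have hdense : ∀ w, (𝓝[Jᶜ] w).NeBot := by
    intro w
    rw [← mem_closure_iff_nhdsWithin_neBot]
    by_cases hw : w ∈ J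
    · rw [mem_closure_iff_nhds]
      intro V hV
      obtain ⟨⟨p, hp, -⟩, -⟩ := hs w w ⟨hyO w, hw⟩ V hV
      exact ⟨p, hp.1.1, hp.2⟩
    · exact subset_closure hw
  have hconst : ∀ y, ∀ w ∈ O y \ J, ∃ W ∈ 𝓝 w, W ⊆ O y \ J ∧ ∀ p ∈ W, s y p ↔ s y w := by
    intro y w hw
    have hopen : IsOpen (O y \ J) := (hO y).sdiff hJ
    refine ⟨connectedComponentIn (O y \ J) w, ?_, connectedComponentIn_subset _ _, fun p hp => ?_⟩
    · exact hopen.connectedComponentIn.mem_nhds (mem_connectedComponentIn hw)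
    · exact hs' y _ (connectedComponentIn_subset _ _) isPreconnected_connectedComponentIn _ hp _
        (mem_connectedComponentIn hw)
  have hdich : ∀ y z, ∀ w ∈ O y ∩ O z, (∀ᶠ p in 𝓝[Jᶜ] w, (s y p ↔ s z p)) ∨
      ∀ᶠ p in 𝓝[Jᶜ] w, ¬ (s y p ↔ s z p) := by
    rintro y z w ⟨hwy, hwz⟩
    by_cases hw : w ∈ J
    · obtain ⟨O', hO', hwO', hO'O, σ, hσ1, -, -⟩ := h2 w hw (O y ∩ O z)
        (((hO y).inter (hO z)).mem_nhds ⟨hwy, hwz⟩)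
      have key : ∀ x, x = y ∨ x = z → (∀ p ∈ O' \ J, (s x p ↔ σ p)) ∨
          ∀ p ∈ O' \ J, ¬ (s x p ↔ σ p) := by
        intro x hx
        have hwx : w ∈ O x := by rcases hx with rfl | rfl <;> assumption
        have hsub : O y ∩ O z ⊆ O x := by
          rcases hx with rfl | rfl
          exacts [inter_subset_left, inter_subset_right]
        have h1 : ∀ p ∈ O' \ J, ∀ q ∈ O' \ J, (σ p ↔ σ q) → (s x p ↔ s x q) := by
          intro p hp q hq hpq
          obtain ⟨C, hC, hCc, hpC, hqC⟩ := hσ1 p hp q hq hpq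
          exact hs' x C (hC.trans (sdiff_subset_sdiff_left hsub)) hCc p hpC q hqC
        obtain ⟨⟨a, ha, hsa⟩, b, hb, hsb⟩ := hs x w ⟨hwx, hw⟩ O' (hO'.mem_nhds hwO')
        have ha' : a ∈ O' \ J := ⟨ha.1.1, ha.2⟩
        have hb' : b ∈ O' \ J := ⟨hb.1.1, hb.2⟩
        have hσab : ¬ (σ a ↔ σ b) := fun h => hsb ((h1 a ha' b hb' h).1 hsa)
        by_cases hσa : σ a
        · left
          intro p hp
          have hσb : ¬ σ b := by tauto
          by_cases hσp : σ p
          · have := h1 p hp a ha' (by tauto); tauto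
          · have := h1 p hp b hb' (by tauto); tauto
        · right
          intro p hp
          have hσb : σ b := by tauto
          by_cases hσp : σ p
          · have := h1 p hp b hb' (by tauto); tauto
          · have := h1 p hp a ha' (by tauto); tauto
      have hev : ∀ᶠ p in 𝓝[Jᶜ] w, p ∈ O' \ J :=
        inter_mem (mem_nhdsWithin_of_mem_nhds (hO'.mem_nhds hwO')) self_mem_nhdsWithin
      rcases key y (Or.inl rfl) with h | h <;> rcases key z (Or.inr rfl) with h' | h'
      · left; filter_upwards [hev] with p hp
        have := h p hp; have := h' p hp; tauto
      · right; filter_upwards [hev] with p hp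
        have := h p hp; have := h' p hp; tauto
      · right; filter_upwards [hev] with p hp
        have := h p hp; have := h' p hp; tauto
      · left; filter_upwards [hev] with p hp
        have := h p hp; have := h' p hp; tauto
    · obtain ⟨W, hW, -, hWs⟩ := hconst y w ⟨hwy, hw⟩
      obtain ⟨W', hW', -, hWs'⟩ := hconst z w ⟨hwz, hw⟩
      by_cases h : s y w ↔ s z w
      · left
        filter_upwards [mem_nhdsWithin_of_mem_nhds hW, mem_nhdsWithin_of_mem_nhds hW'] with p hp hp'
        rw [hWs p hp, hWs' p hp']; exact h
      · right
        filter_upwards [mem_nhdsWithin_of_mem_nhds hW, mem_nhdsWithin_of_mem_nhds hW'] with p hp hp'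
        rw [hWs p hp, hWs' p hp']; exact h
  -- the associated double cover
  let A : M → M → M → Prop := fun y z w => ∀ᶠ p in 𝓝[Jᶜ] w, (s y p ↔ s z p)
  have hnotA : ∀ y z, ∀ w ∈ O y ∩ O z, ¬ A y z w → ∀ᶠ p in 𝓝[Jᶜ] w, ¬ (s y p ↔ s z p) :=
    fun y z w hw h => (hdich y z w hw).resolve_left h
  have hAnot : ∀ y z w, (∀ᶠ p in 𝓝[Jᶜ] w, ¬ (s y p ↔ s z p)) → ¬ A y z w := by
    intro y z w h h'
    have := hdense w
    obtain ⟨p, hp, hp'⟩ := (h.and h').exists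
    exact hp hp'
  let Z : FiberBundleCore M M Bool :=
    { baseSet := O
      isOpen_baseSet := hO
      indexAt := id
      mem_baseSet_at := hyO
      coordChange := fun y z w v => if A y z w then v else !v
      coordChange_self := fun y w _ v => if_pos (Eventually.of_forall fun _ => Iff.rfl)
      continuousOn_coordChange := by
        intro y z
        rintro ⟨w, v⟩ ⟨hw, -⟩
        refine ContinuousAt.continuousWithinAt ?_
        have hloc : ∀ᶠ x in 𝓝 w, (A y z x ↔ A y z w) := by
          have hmem : ∀ᶠ x in 𝓝 w, x ∈ O y ∩ O z := ((hO y).inter (hO z)).mem_nhds hw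
          by_cases h : A y z w
          · have h' := h
            simp only [A] at h'
            rw [← eventually_eventually_nhdsWithin, eventually_nhdsWithin_iff] at h'
            have h'' := eventually_nhdsWithin_iff.1 h
            filter_upwards [h''.eventually_nhds] with x hx
            simp only [h, iff_true]
            exact eventually_nhdsWithin_iff.2 hx
          · have h'' := eventually_nhdsWithin_iff.1 (hnotA y z w hw h)
            filter_upwards [h''.eventually_nhds] with x hx
            simp only [h, iff_false]
            exact hAnot y z x (eventually_nhdsWithin_iff.2 hx)
        have : (fun p : M × Bool => if A y z p.1 then p.2 else !p.2) =ᶠ[𝓝 (w, v)]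
            fun p => if A y z w then p.2 else !p.2 := by
          have := (continuous_fst.tendsto (w, v)).eventually hloc
          filter_upwards [this] with p hp
          simp only [hp]
        refine ContinuousAt.congr ?_ this.symm
        split_ifs
        · exact continuous_snd.continuousAt
        · exact ((continuous_of_discreteTopology (f := Bool.not)).comp continuous_snd).continuousAt
      coordChange_comp := by
        rintro x y z w ⟨⟨hwx, hwy⟩, hwz⟩ v
        have := hdense w
        by_cases h1 : A x y w <;> by_cases h2 : A y z w
        · have : A x z w := by filter_upwards [h1, h2] with p hp hp'; tauto
          simp [h1, h2, this]
        · have : ¬ A x z w := hAnot _ _ _ (by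
            filter_upwards [h1, hnotA _ _ _ ⟨hwy, hwz⟩ h2] with p hp hp'; tauto)
          simp [h1, h2, this]
        · have : ¬ A x z w := hAnot _ _ _ (by
            filter_upwards [h2, hnotA _ _ _ ⟨hwx, hwy⟩ h1] with p hp hp'; tauto)
          simp [h1, h2, this]
        · have : A x z w := by
            filter_upwards [hnotA _ _ _ ⟨hwx, hwy⟩ h1, hnotA _ _ _ ⟨hwy, hwz⟩ h2] with p hp hp'
            tauto
          simp [h1, h2, this] }
  obtain ⟨c, hc, hcc⟩ := Z.exists_section
  have hcloc : ∀ y, ∀ w ∈ O y, ∀ᶠ x in 𝓝 w, c y x = c y w := by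
    intro y w hw
    have := ((hc y).continuousAt ((hO y).mem_nhds hw)).eventually
      ((isOpen_discrete {c y w}).mem_nhds rfl)
    exact this
  let τ : M → Prop := fun p => (s p p ↔ c p p = true)
  have hτ : ∀ y, ∀ p ∈ O y \ J, (τ p ↔ (s y p ↔ c y p = true)) := by
    rintro y p ⟨hpy, hpJ⟩
    have hcp : c y p = if A p y p then c p p else !(c p p) := hcc p y p ⟨hyO p, hpy⟩
    have hp' : ∀ P : M → Prop, (∀ᶠ x in 𝓝[Jᶜ] p, P x) → P p := fun P hP =>
      hP.self_of_nhdsWithin hpJ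
    by_cases h : A p y p
    · have := hp' _ h
      rw [hcp]; simp only [h, if_true, τ]; tauto
    · have := hp' _ (hnotA p y p ⟨hyO p, hpy⟩ h)
      rw [hcp]; simp only [h, if_false, τ]
      cases c p p <;> simp <;> tauto
  have hτloc : ∀ p ∈ Jᶜ, ∀ᶠ x in 𝓝 p, (τ x ↔ τ p) := by
    intro p hp
    obtain ⟨W, hW, hWO, hWs⟩ := hconst p p ⟨hyO p, hp⟩
    filter_upwards [hW, hcloc p p (hyO p)] with x hx hcx
    rw [hτ p x (hWO hx), hWs x hx, hcx]
  have hτconst : ∀ p ∈ Jᶜ, ∀ q ∈ Jᶜ, (τ p ↔ τ q) := by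
    intro p hp q hq
    have hcont : ContinuousOn (fun x => decide (τ x)) Jᶜ := by
      intro x hx
      refine ContinuousAt.continuousWithinAt ?_
      have : (fun x => decide (τ x)) =ᶠ[𝓝 x] fun _ => decide (τ x) := by
        filter_upwards [hτloc x hx] with y hy
        simp only [hy]
      exact continuousAt_const.congr this.symm
    have := hpre.constant hcont hp hq
    simpa using this
  obtain ⟨y, hy⟩ := hne
  have hV : O y ∩ {x | c y x = c y y} ∈ 𝓝 y :=
    inter_mem ((hO y).mem_nhds (hyO y)) (hcloc y y (hyO y))
  obtain ⟨⟨p, hp, hsp⟩, q, hq, hsq⟩ := hs y y ⟨hyO y, hy⟩ _ hV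
  have h1 := hτ y p ⟨hp.1.2, hp.2⟩
  have h2 := hτ y q ⟨hq.1.2, hq.2⟩
  have h3 := hτconst p hp.2 q hq.2
  have h4 : c y p = c y y := hp.1.1.2
  have h5 : c y q = c y y := hq.1.1.2
  rw [h4] at h1
  rw [h5] at h2
  tauto

/-! ### Open sets bounded by two-sided sets -/

/-- `Z` is open, misses `Θ`, and its frontier lies in `Θ`. -/
structure IsFace {M : Type*} [TopologicalSpace M] (Θ Z : Set M) : Prop where
  isOpen : IsOpen Z
  frontier_subset : frontier Z ⊆ Θ
  disjoint : Disjoint Z Θ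

section Face
variable {M : Type*} [TopologicalSpace M] {Θ Z Z₁ Z₂ Z₃ C : Set M} {p q y : M}

lemma IsFace.subset_of_isPreconnected (hZ : IsFace Θ Z) (hC : IsPreconnected C)
    (hCΘ : Disjoint C Θ) (h : (C ∩ Z).Nonempty) : C ⊆ Z := by
  refine hC.subset_of_closure_inter_subset hZ.isOpen h fun x hx => ?_
  by_contra hxZ
  have : x ∈ frontier Z := by
    rw [hZ.isOpen.frontier_eq]
    exact ⟨hx.1, hxZ⟩
  exact disjoint_left.1 hCΘ hx.2 (hZ.frontier_subset this)

lemma IsFace.mem_of_connIn (hZ : IsFace Θ Z) (h : ConnIn Θᶜ p q) (hp : p ∈ Z) : q ∈ Z := by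
  obtain ⟨C, hC, hc, hpC, hqC⟩ := h
  exact hZ.subset_of_isPreconnected hc (disjoint_left.2 fun x hx => hC hx) ⟨p, hpC, hp⟩ hqC

lemma IsFace.mem_of_mem_closure (hZ : IsFace Θ Z) (hp : p ∈ closure Z) (hpΘ : p ∉ Θ) : p ∈ Z := by
  by_contra h
  exact hpΘ (hZ.frontier_subset (hZ.isOpen.frontier_eq ▸ ⟨hp, h⟩))

lemma isFace_component [LocallyConnectedSpace M] (hΘ : IsClosed Θ) (p : M) :
    IsFace Θ (connectedComponentIn Θᶜ p) := by
  refine ⟨hΘ.isOpen_compl.connectedComponentIn, ?_, ?_⟩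
  · refine (frontier_component_subset hΘ.isOpen_compl).trans ?_
    rw [frontier_compl]
    exact hΘ.frontier_subset
  · exact disjoint_left.2 fun x hx => connectedComponentIn_subset _ _ hx

/-- A two-sided preconnected part of `Θ` meeting the closure of a face lies in this closure. -/
lemma IsFace.subset_closure (hZ : IsFace Θ Z) {A : Set M} (hA : IsPreconnected A) (hAΘ : A ⊆ Θ)
    (h2 : ∀ y ∈ A, TwoSidedAt Θ y) (h : (A ∩ closure Z).Nonempty) : A ⊆ closure Z := by
  set U : Set M := ⋃₀ {V | IsOpen V ∧ V ∩ Θ ⊆ closure Z} with hU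
  have hUo : IsOpen U := isOpen_sUnion fun V hV => hV.1
  have hUΘ : U ∩ Θ ⊆ closure Z := by
    rintro x ⟨⟨V, hV, hx⟩, hxΘ⟩
    exact hV.2 ⟨hx, hxΘ⟩
  have key : ∀ y ∈ A, y ∈ closure Z → y ∈ U := by
    intro y hy hyZ
    obtain ⟨O', hO', hyO', -, s, h1, h3, -⟩ := h2 y hy univ univ_mem
    refine ⟨O', ⟨hO', ?_⟩, hyO'⟩
    obtain ⟨p, hpO', hpZ⟩ := mem_closure_iff.1 hyZ O' hO' hyO'
    have hpΘ : p ∉ Θ := disjoint_left.1 hZ.disjoint hpZ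
    rintro w hw
    rw [mem_closure_iff_nhds]
    intro V hV
    have : ∃ q ∈ (V ∩ O') \ Θ, (s p ↔ s q) := by
      obtain ⟨⟨q, hq, hsq⟩, ⟨q', hq', hsq'⟩⟩ := h3 w hw V hV
      by_cases hs : s p
      · exact ⟨q, hq, by tauto⟩
      · exact ⟨q', hq', by tauto⟩
    obtain ⟨q, hq, hs⟩ := this
    exact ⟨q, hq.1.1, hZ.mem_of_connIn
      ((h1 p ⟨hpO', hpΘ⟩ q ⟨hq.1.2, hq.2⟩ hs).mono fun x hx => hx.2) hpZ⟩
  by_contra hne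
  obtain ⟨z, hzA, hz⟩ := not_subset.1 hne
  obtain ⟨y, hyA, hy⟩ := h
  obtain ⟨x, hxA, hxU, hx⟩ := hA U (closure Z)ᶜ hUo isClosed_closure.isOpen_compl
    (fun x hx => by
      by_cases hxZ : x ∈ closure Z
      · exact Or.inl (key x hx hxZ)
      · exact Or.inr hxZ) ⟨y, hyA, key y hyA hy⟩ ⟨z, hzA, hz⟩
  exact hx (hUΘ ⟨hxU, hAΘ hxA⟩)

lemma IsFace.exists_side {O' : Set M} (hZ : IsFace Θ Z) (hO' : IsOpen O') (hy : y ∈ O')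
    (hyZ : y ∈ closure Z) : ∃ p ∈ O' \ Θ, p ∈ Z := by
  obtain ⟨p, hp, hpZ⟩ := mem_closure_iff.1 hyZ O' hO' hy
  exact ⟨p, ⟨hp, disjoint_left.1 hZ.disjoint hpZ⟩, hpZ⟩

/-- At most two faces meet at a two-sided point. -/
lemma not_three_faces (h2 : TwoSidedAt Θ y) (h₁ : IsFace Θ Z₁) (h₂ : IsFace Θ Z₂)
    (h₃ : IsFace Θ Z₃) (h₁₂ : Disjoint Z₁ Z₂) (h₁₃ : Disjoint Z₁ Z₃) (h₂₃ : Disjoint Z₂ Z₃)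
    (hy₁ : y ∈ closure Z₁) (hy₂ : y ∈ closure Z₂) (hy₃ : y ∈ closure Z₃) : False := by
  obtain ⟨O', hO', hyO', -, s, h1, -, -⟩ := h2 univ univ_mem
  have key : ∀ {X Y : Set M}, IsFace Θ X → Disjoint X Y → ∀ p ∈ O' \ Θ, p ∈ X →
      ∀ q ∈ O' \ Θ, q ∈ Y → ¬ (s p ↔ s q) := by
    intro X Y hX hXY p hp hpX q hq hqY hs
    exact disjoint_left.1 hXY (hX.mem_of_connIn ((h1 p hp q hq hs).mono fun x hx => hx.2) hpX) hqY
  obtain ⟨p₁, hp₁, hp₁'⟩ := h₁.exists_side hO' hyO' hy₁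
  obtain ⟨p₂, hp₂, hp₂'⟩ := h₂.exists_side hO' hyO' hy₂
  obtain ⟨p₃, hp₃, hp₃'⟩ := h₃.exists_side hO' hyO' hy₃
  have a := key h₁ h₁₂ _ hp₁ hp₁' _ hp₂ hp₂'
  have b := key h₁ h₁₃ _ hp₁ hp₁' _ hp₃ hp₃'
  have c := key h₂ h₂₃ _ hp₂ hp₂' _ hp₃ hp₃'
  tauto

/-- `Z` is connected near the point `y` of its closure. -/
def LocallyJoinedAt (Z : Set M) (y : M) : Prop :=
  ∀ O ∈ 𝓝 y, ∃ O' ∈ 𝓝 y, ∀ p ∈ Z ∩ O', ∀ q ∈ Z ∩ O', ConnIn (O ∩ Z) p q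

/-- If two faces meet at a two-sided point then each is connected near this point. -/
lemma IsFace.locallyJoinedAt (h2 : TwoSidedAt Θ y) (h₁ : IsFace Θ Z₁) (h₂ : IsFace Θ Z₂)
    (h₁₂ : Disjoint Z₁ Z₂) (hy₂ : y ∈ closure Z₂) :
    LocallyJoinedAt Z₁ y := by
  intro O hO
  obtain ⟨O', hO', hyO', hO'O, s, h1, -, -⟩ := h2 O hO
  obtain ⟨r, hr, hrZ⟩ := h₂.exists_side hO' hyO' hy₂
  have hn : ∀ p ∈ Z₁ ∩ O', p ∈ O' \ Θ ∧ ¬ (s p ↔ s r) := by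
    intro p hp
    have hp' : p ∈ O' \ Θ := ⟨hp.2, disjoint_left.1 h₁.disjoint hp.1⟩
    refine ⟨hp', fun hs => disjoint_left.1 h₁₂ ?_ hrZ⟩
    exact h₁.mem_of_connIn ((h1 p hp' r hr hs).mono fun x hx => hx.2) hp.1
  refine ⟨O', hO'.mem_nhds hyO', fun p hp q hq => ?_⟩
  obtain ⟨C, hC, hc, hpC, hqC⟩ := h1 p (hn p hp).1 q (hn q hq).1 (by
    have := (hn p hp).2; have := (hn q hq).2; tauto)
  refine ⟨C, fun x hx => ⟨(hC hx).1, ?_⟩, hc, hpC, hqC⟩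
  exact h₁.subset_of_isPreconnected hc (disjoint_left.2 fun x hx => (hC hx).2) ⟨p, hpC, hp.1⟩ hx

/-- Removing from an open connected set an arc that starts anywhere and stays inside afterwards
keeps it connected. -/
lemma isPreconnected_diff_arc [T2Space M] [IsSurface M] {U : Set M} (hU : IsOpen U)
    (hUc : IsPreconnected U) {γ : ℝ → M} {a b : ℝ} (hab : a ≤ b) (hγ : ContinuousOn γ (Icc a b))
    (hinj : InjOn γ (Icc a b)) (hin : ∀ t ∈ Ioc a b, γ t ∈ U) (hb : γ b ∈ U) :
    IsPreconnected (U \ γ '' Icc a b) := by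
  set A := γ '' Icc a b with hA
  have hAc : IsClosed A := (isCompact_arc hγ).isClosed
  set Ω := U \ A with hΩ
  have hΩo : IsOpen Ω := hU.sdiff hAc
  have hbI : b ∈ Icc a b := right_mem_Icc.2 hab
  have key : ∀ p ∈ Ω, γ b ∈ closure (connectedComponentIn Ω p) := by
    intro p hp
    set Z := connectedComponentIn Ω p with hZ
    have hpZ : p ∈ Z := mem_connectedComponentIn hp
    have hZo : IsOpen Z := hΩo.connectedComponentIn
    have hZΩ : Z ⊆ Ω := connectedComponentIn_subset _ _
    by_contra hbZ
    have hZcl : closure Z ∩ Ω ⊆ Z := closure_component_inter hΩo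
    -- the arc meets the closure of `Z` inside `U`
    have hex : ∃ t ∈ Icc a b, γ t ∈ closure Z ∧ γ t ∈ U := by
      by_contra hno
      push Not at hno
      have := hUc.subset_of_closure_inter_subset hZo ⟨p, hp.1, hpZ⟩ (by
        rintro x ⟨hx, hxU⟩
        by_cases hxA : x ∈ A
        · obtain ⟨t, ht, rfl⟩ := hxA
          exact absurd hxU (hno t ht hx)
        · exact hZcl ⟨hx, hxU, hxA⟩)
      exact hbZ (subset_closure (this hb))
    obtain ⟨t₀, ht₀, ht₀Z, ht₀U⟩ := hex
    have hKc : IsCompact (Icc a b ∩ γ ⁻¹' closure Z) := isCompact_Icc.of_isClosed_subset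
      (hγ.preimage_isClosed_of_isClosed isClosed_Icc isClosed_closure) inter_subset_left
    obtain ⟨τ, ⟨hτ, hτZ⟩, hmax⟩ := hKc.exists_isGreatest ⟨t₀, ht₀, ht₀Z⟩
    have hτU : γ τ ∈ U := by
      rcases eq_or_lt_of_le (hmax ⟨ht₀, ht₀Z⟩ : t₀ ≤ τ) with h | h
      · exact h ▸ ht₀U
      · exact hin τ ⟨ht₀.1.trans_lt h, hτ.2⟩
    have hτb : τ < b := lt_of_le_of_ne hτ.2 fun h => hbZ (by rw [← h]; exact hτZ)
    have hsub : Icc a τ ⊆ Icc a b := Icc_subset_Icc_right hτ.2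
    obtain ⟨O', hO', -, hconn⟩ := exists_nhds_connIn_of_arc_end hτ.1 (hγ.mono hsub)
      (hinj.mono hsub) (hU.mem_nhds hτU)
    obtain ⟨z, hzO', hzZ⟩ := mem_closure_iff_nhds.1 hτZ O' hO'
    have hcw : ContinuousWithinAt γ (Icc a b) τ := hγ τ hτ
    have : ∃ t ∈ Ioc τ b, γ t ∈ O' := by
      have h1 : Tendsto γ (𝓝[>] τ) (𝓝 (γ τ)) := hcw.mono_left
        (by
          rw [← nhdsWithin_Ioc_eq_nhdsGT hτb]
          exact nhdsWithin_mono _ fun x hx => ⟨hτ.1.trans hx.1.le, hx.2⟩)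
      obtain ⟨t, ht1, ht2⟩ := ((show ∀ᶠ t in 𝓝[>] τ, γ t ∈ O' from h1 hO').and (Ioc_mem_nhdsGT hτb)).exists
      exact ⟨t, ht2, ht1⟩
    obtain ⟨t, ht, htO'⟩ := this
    have htI : t ∈ Icc a b := ⟨hτ.1.trans ht.1.le, ht.2⟩
    have hnot : γ t ∉ γ '' Icc a τ := by
      rintro ⟨s, hs, hst⟩
      exact absurd (hinj (hsub hs) htI hst ▸ hs.2) (not_le.2 ht.1)
    obtain ⟨C, hC, hCc, hzC, htC⟩ := hconn z ⟨hzO', fun h => (hZΩ hzZ).2 (image_mono hsub h)⟩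
      (γ t) ⟨htO', hnot⟩
    have hCZ : C ⊆ Z := by
      refine hCc.subset_of_closure_inter_subset hZo ⟨z, hzC, hzZ⟩ ?_
      rintro x ⟨hx, hxC⟩
      by_cases hxA : x ∈ A
      · obtain ⟨s, hs, rfl⟩ := hxA
        exact absurd ⟨s, ⟨hs.1, hmax ⟨hs, hx⟩⟩, rfl⟩ (hC hxC).2
      · exact hZcl ⟨hx, (hC hxC).1, hxA⟩
    exact absurd (hmax ⟨htI, subset_closure (hCZ htC)⟩) (not_le.2 ht.1)
  refine isPreconnected_of_connIn fun p hp q hq => ?_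
  obtain ⟨O', hO', -, hconn⟩ := exists_nhds_connIn_of_arc_end hab hγ hinj (hU.mem_nhds hb)
  obtain ⟨p', hp'O, hp'⟩ := mem_closure_iff_nhds.1 (key p hp) O' hO'
  obtain ⟨q', hq'O, hq'⟩ := mem_closure_iff_nhds.1 (key q hq) O' hO'
  have := hconn p' ⟨hp'O, (connectedComponentIn_subset _ _ hp').2⟩
    q' ⟨hq'O, (connectedComponentIn_subset _ _ hq').2⟩
  exact ((connIn_of_mem_component hp').trans this).trans (connIn_of_mem_component hq').symm

end Face

/-! ### Arcs -/

/-- `A` is an arc with end points `a` and `b`. -/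
def IsArc {M : Type*} [TopologicalSpace M] (A : Set M) (a b : M) : Prop :=
  ∃ γ : ℝ → M, ContinuousOn γ (Icc 0 1) ∧ InjOn γ (Icc 0 1) ∧ γ 0 = a ∧ γ 1 = b ∧ γ '' Icc 0 1 = A

section Arc
variable {M : Type*} [TopologicalSpace M] {A B : Set M} {a b c u : M}

lemma isArc_of_Icc {γ : ℝ → M} {s t : ℝ} (h : s < t) (hγ : ContinuousOn γ (Icc s t))
    (hinj : InjOn γ (Icc s t)) : IsArc (γ '' Icc s t) (γ s) (γ t) := by
  have hm : MapsTo (fun x : ℝ => s + (t - s) * x) (Icc 0 1) (Icc s t) := by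
    intro x hx
    constructor <;> nlinarith [hx.1, hx.2]
  refine ⟨fun x => γ (s + (t - s) * x), hγ.comp (by fun_prop) hm, ?_, by simp, by simp, ?_⟩
  · intro x hx y hy hxy
    have := hinj (hm hx) (hm hy) hxy
    have h' : t - s ≠ 0 := (sub_pos.2 h).ne'
    exact mul_left_cancel₀ h' (add_left_cancel this)
  · ext z
    constructor
    · rintro ⟨x, hx, rfl⟩
      exact ⟨_, hm hx, rfl⟩
    · rintro ⟨x, hx, rfl⟩
      have h' : 0 < t - s := sub_pos.2 h
      refine ⟨(x - s) / (t - s), ⟨div_nonneg (by linarith [hx.1]) h'.le,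
        (div_le_one h').2 (by linarith [hx.2])⟩, ?_⟩
      simp only []
      congr 1
      field_simp
      ring

lemma IsArc.symm (h : IsArc A a b) : IsArc A b a := by
  obtain ⟨γ, hγ, hinj, h0, h1, hA⟩ := h
  have hm : MapsTo (fun x : ℝ => 1 - x) (Icc 0 1) (Icc 0 1) := fun x hx =>
    ⟨by linarith [hx.2], by linarith [hx.1]⟩
  refine ⟨fun x => γ (1 - x), hγ.comp (by fun_prop) hm, ?_, by simpa, by simpa, ?_⟩
  · intro x hx y hy hxy
    have := hinj (hm hx) (hm hy) hxy
    simp only [] at this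
    linarith
  · rw [← hA]
    ext z
    constructor
    · rintro ⟨x, hx, rfl⟩
      exact ⟨_, hm hx, rfl⟩
    · rintro ⟨x, hx, rfl⟩
      exact ⟨1 - x, hm hx, by simp⟩

lemma IsArc.left_mem (h : IsArc A a b) : a ∈ A := by
  obtain ⟨γ, hγ, hinj, h0, h1, hA⟩ := h
  exact hA ▸ ⟨0, by simp, h0⟩

lemma IsArc.right_mem (h : IsArc A a b) : b ∈ A := h.symm.left_mem

lemma IsArc.ne (h : IsArc A a b) : a ≠ b := by
  obtain ⟨γ, hγ, hinj, h0, h1, hA⟩ := h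
  rintro hab
  have := hinj (by simp : (0 : ℝ) ∈ Icc (0 : ℝ) 1) (by simp : (1 : ℝ) ∈ Icc (0 : ℝ) 1) (by simp [*])
  norm_num at this

lemma IsArc.isCompact (h : IsArc A a b) : IsCompact A := by
  obtain ⟨γ, hγ, hinj, h0, h1, hA⟩ := h
  exact hA ▸ isCompact_Icc.image_of_continuousOn hγ

lemma IsArc.isClosed [T2Space M] (h : IsArc A a b) : IsClosed A := h.isCompact.isClosed

lemma IsArc.isPreconnected (h : IsArc A a b) : IsPreconnected A := by
  obtain ⟨γ, hγ, hinj, h0, h1, hA⟩ := h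
  exact hA ▸ isPreconnected_Icc.image _ hγ

lemma IsArc.image {N : Type*} [TopologicalSpace N] {f : M → N} (h : IsArc A a b)
    (hf : ContinuousOn f A) (hinj : InjOn f A) : IsArc (f '' A) (f a) (f b) := by
  obtain ⟨γ, hγ, hγi, h0, h1, rfl⟩ := h
  refine ⟨f ∘ γ, hf.comp hγ (mapsTo_image _ _), hinj.comp hγi (mapsTo_image _ _), by simp [h0],
    by simp [h1], image_comp _ _ _⟩

lemma image_Icc_diff_ends {X : Type*} {γ : ℝ → X} (hinj : InjOn γ (Icc 0 1)) :
    γ '' Icc 0 1 \ {γ 0, γ 1} = γ '' Ioo 0 1 := by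
  ext x
  constructor
  · rintro ⟨⟨t, ht, rfl⟩, hne⟩
    simp only [mem_insert_iff, mem_singleton_iff, not_or] at hne
    exact ⟨t, ⟨lt_of_le_of_ne ht.1 fun h => hne.1 (by rw [h]),
      lt_of_le_of_ne ht.2 fun h => hne.2 (by rw [h])⟩, rfl⟩
  · rintro ⟨t, ht, rfl⟩
    refine ⟨⟨t, Ioo_subset_Icc_self ht, rfl⟩, ?_⟩
    rintro (h | h)
    · exact ht.1.ne' (hinj (Ioo_subset_Icc_self ht) (by simp) h)
    · exact ht.2.ne (hinj (Ioo_subset_Icc_self ht) (by simp) h)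

lemma IsArc.isPreconnected_interior (h : IsArc A a b) : IsPreconnected (A \ {a, b}) := by
  obtain ⟨γ, hγ, hinj, rfl, rfl, rfl⟩ := h
  rw [image_Icc_diff_ends hinj]
  exact isPreconnected_Ioo.image _ (hγ.mono Ioo_subset_Icc_self)

lemma IsArc.interior_nonempty (h : IsArc A a b) : (A \ {a, b}).Nonempty := by
  obtain ⟨γ, hγ, hinj, rfl, rfl, rfl⟩ := h
  rw [image_Icc_diff_ends hinj]
  exact ⟨γ (1 / 2), 1 / 2, by norm_num, rfl⟩

lemma IsArc.subset_closure_interior (h : IsArc A a b) : A ⊆ closure (A \ {a, b}) := by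
  obtain ⟨γ, hγ, hinj, rfl, rfl, rfl⟩ := h
  rw [image_Icc_diff_ends hinj]
  rw [← closure_Ioo (zero_ne_one' ℝ)] at hγ ⊢
  exact hγ.image_closure

/-- Two injective paths can be run one after the other. -/
lemma exists_arc_concat {α β : ℝ → M} {r s t : ℝ} (hrs : r ≤ s) (hst : s ≤ t)
    (hα : ContinuousOn α (Icc r s)) (hβ : ContinuousOn β (Icc s t)) (hαi : InjOn α (Icc r s))
    (hβi : InjOn β (Icc s t)) (h : α s = β s)
    (hαβ : ∀ x ∈ Icc r s, ∀ y ∈ Icc s t, α x = β y → x = y) :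
    ∃ γ : ℝ → M, ContinuousOn γ (Icc r t) ∧ InjOn γ (Icc r t) ∧ EqOn γ α (Icc r s) ∧
      EqOn γ β (Icc s t) := by
  have h1 : EqOn (fun x => if x ≤ s then α x else β x) α (Icc r s) := fun x hx => if_pos hx.2
  have h2 : EqOn (fun x => if x ≤ s then α x else β x) β (Icc s t) := by
    intro x hx
    simp only []
    split_ifs with h'
    · rw [le_antisymm h' hx.1, h]
    · rfl
  refine ⟨_, ?_, ?_, h1, h2⟩
  · rw [← Icc_union_Icc_eq_Icc hrs hst]
    exact (hα.congr h1).union_of_isClosed (hβ.congr h2) isClosed_Icc isClosed_Icc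
  · intro x hx y hy hxy
    rcases le_total x s with hx1 | hx1 <;> rcases le_total y s with hy1 | hy1
    · rw [h1 ⟨hx.1, hx1⟩, h1 ⟨hy.1, hy1⟩] at hxy
      exact hαi ⟨hx.1, hx1⟩ ⟨hy.1, hy1⟩ hxy
    · rw [h1 ⟨hx.1, hx1⟩, h2 ⟨hy1, hy.2⟩] at hxy
      exact hαβ x ⟨hx.1, hx1⟩ y ⟨hy1, hy.2⟩ hxy
    · rw [h2 ⟨hx1, hx.2⟩, h1 ⟨hy.1, hy1⟩] at hxy
      exact (hαβ y ⟨hy.1, hy1⟩ x ⟨hx1, hx.2⟩ hxy.symm).symm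
    · rw [h2 ⟨hx1, hx.2⟩, h2 ⟨hy1, hy.2⟩] at hxy
      exact hβi ⟨hx1, hx.2⟩ ⟨hy1, hy.2⟩ hxy

lemma IsArc.concat (hA : IsArc A a b) (hB : IsArc B b c) (h : A ∩ B ⊆ {b}) :
    IsArc (A ∪ B) a c := by
  obtain ⟨α, hα, hαi, rfl, rfl, rfl⟩ := hA
  obtain ⟨β, hβ, hβi, h0, rfl, rfl⟩ := hB
  have hm : MapsTo (fun t : ℝ => t - 1) (Icc 1 2) (Icc 0 1) := fun t ht =>
    ⟨by linarith [ht.1], by linarith [ht.2]⟩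
  obtain ⟨γ, hγ, hinj, h1, h2⟩ := exists_arc_concat (β := fun t => β (t - 1)) zero_le_one
    one_le_two hα (hβ.comp (by fun_prop) hm) hαi
    (fun x hx y hy hxy => by simpa using hβi (hm hx) (hm hy) hxy) (by simp [h0]) (by
      intro s hs t ht hst
      have hs1 : α s = α 1 := h ⟨⟨s, hs, rfl⟩, ⟨t - 1, hm ht, hst.symm⟩⟩
      have e1 : s = 1 := hαi hs (by simp) hs1
      have e2 : t - 1 = 0 := hβi (hm ht) (by simp) (by rw [← hst, hs1, h0])
      linarith)
  have := isArc_of_Icc (zero_lt_two' ℝ) hγ hinj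
  rw [h1 (by simp), h2 (by norm_num), ← Icc_union_Icc_eq_Icc zero_le_one
    (one_le_two : (1 : ℝ) ≤ 2), image_union, image_congr h1, image_congr h2] at this
  have e : (fun t => β (t - 1)) '' Icc 1 2 = β '' Icc 0 1 := by
    have : (fun t : ℝ => t - 1) '' Icc 1 2 = Icc 0 1 := by
      rw [image_sub_const_Icc]; norm_num
    rw [← this, image_image]
  rw [e] at this
  norm_num at this
  exact this

lemma IsArc.split (h : IsArc A a b) (hu : u ∈ A) (ha : u ≠ a) (hb : u ≠ b) :
    ∃ A₁ A₂, IsArc A₁ a u ∧ IsArc A₂ u b ∧ A₁ ∪ A₂ = A ∧ A₁ ∩ A₂ = {u} := by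
  obtain ⟨γ, hγ, hinj, rfl, rfl, rfl⟩ := h
  obtain ⟨t, ht, rfl⟩ := hu
  have h0 : 0 < t := lt_of_le_of_ne ht.1 fun h => ha (by rw [h])
  have h1 : t < 1 := lt_of_le_of_ne ht.2 fun h => hb (by rw [h])
  have s1 : Icc 0 t ⊆ Icc 0 1 := Icc_subset_Icc_right ht.2
  have s2 : Icc t 1 ⊆ Icc 0 1 := Icc_subset_Icc_left ht.1
  refine ⟨γ '' Icc 0 t, γ '' Icc t 1, isArc_of_Icc h0 (hγ.mono s1) (hinj.mono s1),
    isArc_of_Icc h1 (hγ.mono s2) (hinj.mono s2), ?_, ?_⟩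
  · rw [← image_union, Icc_union_Icc_eq_Icc ht.1 ht.2]
  · rw [← hinj.image_inter s1 s2, Icc_inter_Icc_eq_singleton ht.1 ht.2, image_singleton]

/-- The union of two arcs with a common end point contains an arc joining the other end points. -/
lemma IsArc.exists_trans [T2Space M] (hA : IsArc A a b) (hB : IsArc B b c) (hac : a ≠ c) :
    ∃ C ⊆ A ∪ B, IsArc C a c := by
  have hBc := hB.isClosed
  have hbB := hB.left_mem
  obtain ⟨α, hα, hαi, rfl, rfl, rfl⟩ := hA
  obtain ⟨β, hβ, hβi, h0, rfl, rfl⟩ := hB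
  have hK : IsCompact (Icc 0 1 ∩ α ⁻¹' (β '' Icc 0 1)) := isCompact_Icc.of_isClosed_subset
    (hα.preimage_isClosed_of_isClosed isClosed_Icc hBc) inter_subset_left
  obtain ⟨t, ⟨ht, s, hs, hst⟩, hmin⟩ := hK.exists_isLeast ⟨1, by simp, hbB⟩
  have i1 : Icc 0 t ⊆ Icc 0 1 := Icc_subset_Icc_right ht.2
  have i2 : Icc s 1 ⊆ Icc 0 1 := Icc_subset_Icc_left hs.1
  rcases eq_or_lt_of_le ht.1 with ht0 | ht0
  · have hs1 : s < 1 := lt_of_le_of_ne hs.2 fun h => hac (by rw [← h, hst, ht0])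
    refine ⟨β '' Icc s 1, (image_mono i2).trans subset_union_right, ?_⟩
    have := isArc_of_Icc hs1 (hβ.mono i2) (hβi.mono i2)
    rwa [hst, ← ht0] at this
  · have a1 := isArc_of_Icc ht0 (hα.mono i1) (hαi.mono i1)
    rcases eq_or_lt_of_le hs.2 with hs1 | hs1
    · refine ⟨α '' Icc 0 t, (image_mono i1).trans subset_union_left, ?_⟩
      rwa [← hst, hs1] at a1
    · have a2 := isArc_of_Icc hs1 (hβ.mono i2) (hβi.mono i2)
      rw [hst] at a2
      refine ⟨α '' Icc 0 t ∪ β '' Icc s 1, union_subset_union (image_mono i1) (image_mono i2),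
        a1.concat a2 ?_⟩
      rintro x ⟨⟨r, hr, rfl⟩, hx⟩
      have : t ≤ r := hmin ⟨i1 hr, image_mono i2 hx⟩
      rw [le_antisymm hr.2 this]
      rfl

/-- In a connected open subset of a surface, any two points are joined by an arc. -/
lemma IsPreconnected.exists_arc [T2Space M] [IsSurface M] {U : Set M} (hU : IsPreconnected U)
    (hUo : IsOpen U) (ha : a ∈ U) (hb : b ∈ U) (hab : a ≠ b) : ∃ A ⊆ U, IsArc A a b := by
  have := hU.induction₂ (fun x y => x = y ∨ ∃ A ⊆ U, IsArc A x y) ?_ ?_ ?_ ha hb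
  · exact this.resolve_left hab
  · intro x hx
    obtain ⟨φ, hφ, hφ0, hφU⟩ := IsSurface.exists_chart x U (hUo.mem_nhds hx)
    refine mem_nhdsWithin_of_mem_nhds
      (Filter.mem_of_superset (hφ.isOpen_range.mem_nhds ⟨0, hφ0⟩) ?_)
    rintro _ ⟨z, rfl⟩
    rcases eq_or_ne z 0 with rfl | hz
    · exact Or.inl hφ0.symm
    · refine Or.inr ⟨(fun t : ℝ => φ (t * z)) '' Icc 0 1, ?_, ?_⟩
      · rintro _ ⟨t, -, rfl⟩
        exact hφU ⟨_, rfl⟩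
      · refine ⟨_, ?_, ?_, ?_, ?_, rfl⟩
        · exact (hφ.continuous.comp (by fun_prop)).continuousOn
        · intro s _ t _ hst
          have := mul_right_cancel₀ hz (hφ.injective hst)
          exact_mod_cast this
        · simpa using hφ0
        · simp
  · rintro x y z hx hy hz (rfl | ⟨A, hA, hA'⟩) (rfl | ⟨B, hB, hB'⟩)
    · exact Or.inl rfl
    · exact Or.inr ⟨B, hB, hB'⟩
    · exact Or.inr ⟨A, hA, hA'⟩
    · by_cases h : x = z
      · exact Or.inl h
      · obtain ⟨C, hC, hC'⟩ := hA'.exists_trans hB' h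
        exact Or.inr ⟨C, hC.trans (union_subset hA hB), hC'⟩
  · rintro x y hx hy (rfl | ⟨A, hA, hA'⟩)
    · exact Or.inl rfl
    · exact Or.inr ⟨A, hA, hA'.symm⟩

lemma IsArc.isPreconnected_diff [T2Space M] [IsSurface M] {U : Set M} (h : IsArc A a b)
    (hU : IsOpen U) (hUc : IsPreconnected U) (hA : A \ {a} ⊆ U) : IsPreconnected (U \ A) := by
  have hne := h.ne
  obtain ⟨γ, hγ, hinj, rfl, rfl, rfl⟩ := h
  refine isPreconnected_diff_arc hU hUc zero_le_one hγ hinj (fun t ht => hA ⟨⟨t, ⟨ht.1.le, ht.2⟩, rfl⟩,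
    fun h => ht.1.ne' (hinj ⟨ht.1.le, ht.2⟩ (by simp) h)⟩) (hA ⟨⟨1, by simp, rfl⟩, hne.symm⟩)

lemma IsPreconnected.diff_singleton_of_surface [T2Space M] [IsSurface M] {U : Set M} (hU : IsOpen U)
    (hUc : IsPreconnected U) (ha : a ∈ U) : IsPreconnected (U \ {a}) := by
  have := isPreconnected_diff_arc hU hUc (le_refl (0 : ℝ)) (γ := fun _ => a) continuousOn_const
    (by simp) (by simp) ha
  simpa using this

lemma IsArc.twoSidedAt [T2Space M] [IsSurface M] {Θ N : Set M} {y : M} (h : IsArc A a b)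
    (hy : y ∈ A) (ha : y ≠ a) (hb : y ≠ b) (hN : N ∈ 𝓝 y) (hΘ : ∀ x ∈ N, x ∈ Θ ↔ x ∈ A) :
    TwoSidedAt Θ y := by
  obtain ⟨γ, hγ, hinj, rfl, rfl, rfl⟩ := h
  obtain ⟨t, ht, rfl⟩ := hy
  exact twoSidedAt_of_arc hγ hinj ⟨lt_of_le_of_ne ht.1 fun h => ha (by rw [h]),
    lt_of_le_of_ne ht.2 fun h => hb (by rw [h])⟩ hN hΘ

end Arc

/-! ### Jordan curves and Jordan domains -/

/-- Two arcs with the same end points that meet nowhere else. -/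
structure IsArcPair {M : Type*} [TopologicalSpace M] (A B : Set M) (a b : M) : Prop where
  left : IsArc A a b
  right : IsArc B a b
  inter : A ∩ B ⊆ {a, b}

/-- A Jordan curve, seen as the union of two arcs with common end points. -/
def IsJordanCurve {M : Type*} [TopologicalSpace M] (J : Set M) : Prop :=
  ∃ A B a b, IsArcPair A B a b ∧ A ∪ B = J

/-- A surface that is separated by each of its Jordan curves. -/
class JordanSurface (M : Type*) [TopologicalSpace M] : Prop extends IsSurface M where
  not_isPreconnected_compl : ∀ J : Set M, IsJordanCurve J → ¬ IsPreconnected Jᶜ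

/-- A connected open set bounded by a Jordan curve. -/
structure IsJordanDomain {M : Type*} [TopologicalSpace M] (F : Set M) : Prop where
  isOpen : IsOpen F
  isConnected : IsConnected F
  isJordan : IsJordanCurve (frontier F)

section Jordan
variable {M : Type*} [TopologicalSpace M] {A B J F : Set M} {a b u v y : M}

lemma IsArcPair.swap (h : IsArcPair A B a b) : IsArcPair B A a b :=
  ⟨h.right, h.left, inter_comm A B ▸ h.inter⟩

lemma IsArcPair.symm (h : IsArcPair A B a b) : IsArcPair A B b a :=
  ⟨h.left.symm, h.right.symm, pair_comm a b ▸ h.inter⟩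

lemma IsArcPair.isJordan (h : IsArcPair A B a b) : IsJordanCurve (A ∪ B) := ⟨A, B, a, b, h, rfl⟩

lemma IsArcPair.image {N : Type*} [TopologicalSpace N] {f : M → N} (h : IsArcPair A B a b)
    (hf : ContinuousOn f (A ∪ B)) (hinj : InjOn f (A ∪ B)) :
    IsArcPair (f '' A) (f '' B) (f a) (f b) := by
  refine ⟨h.left.image (hf.mono subset_union_left) (hinj.mono subset_union_left),
    h.right.image (hf.mono subset_union_right) (hinj.mono subset_union_right), ?_⟩
  rw [← hinj.image_inter subset_union_left subset_union_right]
  exact (image_mono h.inter).trans (by rw [image_pair])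

lemma IsArcPair.resplit (h : IsArcPair A B a b) (hu : u ∈ A ∪ B) (hua : u ≠ a) :
    ∃ A' B', IsArcPair A' B' a u ∧ A' ∪ B' = A ∪ B := by
  wlog huA : u ∈ A generalizing A B
  · obtain ⟨A', B', h1, h2⟩ := this h.swap (union_comm A B ▸ hu) (hu.resolve_left huA)
    exact ⟨A', B', h1, h2.trans (union_comm B A)⟩
  by_cases hub : u = b
  · exact ⟨A, B, hub ▸ h, rfl⟩
  obtain ⟨A₁, A₂, h1, h2, h3, h4⟩ := h.left.split huA hua hub
  have hA₁ : A₁ ⊆ A := h3 ▸ subset_union_left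
  have hA₂ : A₂ ⊆ A := h3 ▸ subset_union_right
  have haA₂ : a ∉ A₂ := fun ha => hua (h4.subset ⟨h1.left_mem, ha⟩).symm
  have hbA₁ : b ∉ A₁ := fun hb => hub (h4.subset ⟨hb, h2.right_mem⟩).symm
  refine ⟨A₁, B ∪ A₂, ⟨h1, h.right.concat h2.symm ?_, ?_⟩, ?_⟩
  · rintro x ⟨hxB, hxA⟩
    rcases h.inter ⟨hA₂ hxA, hxB⟩ with rfl | h
    · exact absurd hxA haA₂
    · exact h
  · rintro x ⟨hx, hxB | hxA⟩
    · rcases h.inter ⟨hA₁ hx, hxB⟩ with h | rfl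
      · exact Or.inl h
      · exact absurd hx hbA₁
    · exact Or.inr (h4.subset ⟨hx, hxA⟩)
  · rw [← h3, union_comm B, union_assoc]

lemma IsJordanCurve.exists_pair (h : IsJordanCurve J) (hu : u ∈ J) (hv : v ∈ J) (huv : u ≠ v) :
    ∃ A B, IsArcPair A B u v ∧ A ∪ B = J := by
  obtain ⟨A, B, a, b, h, rfl⟩ := h
  by_cases hua : u = a
  · subst hua
    exact h.resplit hv huv.symm
  · obtain ⟨A', B', h', e⟩ := h.resplit hu hua
    obtain ⟨A'', B'', h'', e'⟩ := h'.symm.resplit (e ▸ hv) huv.symm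
    exact ⟨A'', B'', h'', e'.trans e⟩

lemma IsJordanCurve.isCompact (h : IsJordanCurve J) : IsCompact J := by
  obtain ⟨A, B, a, b, h, rfl⟩ := h
  exact h.left.isCompact.union h.right.isCompact

lemma IsJordanCurve.isClosed [T2Space M] (h : IsJordanCurve J) : IsClosed J := h.isCompact.isClosed

lemma IsJordanCurve.isPreconnected (h : IsJordanCurve J) : IsPreconnected J := by
  obtain ⟨A, B, a, b, h, rfl⟩ := h
  exact h.left.isPreconnected.union _ h.left.left_mem h.right.left_mem h.right.isPreconnected

lemma IsJordanCurve.nontrivial (h : IsJordanCurve J) : J.Nontrivial := by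
  obtain ⟨A, B, a, b, h, rfl⟩ := h
  exact ⟨a, Or.inl h.left.left_mem, b, Or.inl h.left.right_mem, h.left.ne⟩

lemma IsJordanCurve.nonempty (h : IsJordanCurve J) : J.Nonempty := h.nontrivial.nonempty

/-- Every point of a Jordan curve is interior to one of two arcs making up the curve. -/
lemma IsJordanCurve.exists_pair_interior (h : IsJordanCurve J) (hy : y ∈ J) :
    ∃ A B a b, IsArcPair A B a b ∧ A ∪ B = J ∧ y ∈ A ∧ y ∉ B := by
  obtain ⟨z, hz, hzy⟩ := h.nontrivial.exists_ne y
  obtain ⟨A, B, hAB, rfl⟩ := h.exists_pair hy hz hzy.symm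
  obtain ⟨p, hp, hp'⟩ := hAB.left.interior_nonempty
  obtain ⟨q, hq, hq'⟩ := hAB.right.interior_nonempty
  have hpq : p ≠ q := by
    rintro rfl
    exact hp' (hAB.inter ⟨hp, hq⟩)
  obtain ⟨A', B', h', e⟩ := h.exists_pair (Or.inl hp) (Or.inr hq) hpq
  have hyn : y ∉ ({p, q} : Set M) := by
    rintro (rfl | h)
    · exact hp' (Or.inl rfl)
    · exact hq' (Or.inl h.symm)
  by_cases hyA : y ∈ A'
  · exact ⟨A', B', p, q, h', e, hyA, fun hyB => hyn (h'.inter ⟨hyA, hyB⟩)⟩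
  · exact ⟨B', A', p, q, h'.swap, (union_comm _ _).trans e,
      (e.symm ▸ hy : y ∈ A' ∪ B').resolve_left hyA, hyA⟩

lemma IsJordanCurve.twoSidedAt [T2Space M] [IsSurface M] (h : IsJordanCurve J) (hy : y ∈ J) :
    TwoSidedAt J y := by
  obtain ⟨A, B, a, b, hAB, rfl, hyA, hyB⟩ := h.exists_pair_interior hy
  exact hAB.left.twoSidedAt hyA (fun h => hyB (h ▸ hAB.right.left_mem))
    (fun h => hyB (h ▸ hAB.right.right_mem)) (hAB.right.isClosed.isOpen_compl.mem_nhds hyB)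
    fun x hx => or_iff_left hx

lemma IsJordanCurve.frontier_component [T2Space M] [IsSurface M] [PreconnectedSpace M] (h : IsJordanCurve J)
    {p : M} (hp : p ∉ J) : frontier (connectedComponentIn Jᶜ p) = J := by
  have hZ := isFace_component h.isClosed p
  set Z := connectedComponentIn Jᶜ p
  have hpZ : p ∈ Z := mem_connectedComponentIn hp
  refine hZ.frontier_subset.antisymm ?_
  have hne : (frontier Z).Nonempty := by
    rw [nonempty_frontier_iff]
    obtain ⟨j, hj⟩ := h.nonempty
    exact ⟨⟨p, hpZ⟩, fun e => disjoint_left.1 hZ.disjoint (e ▸ mem_univ j) hj⟩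
  obtain ⟨y, hy⟩ := hne
  have := hZ.subset_closure h.isPreconnected Subset.rfl (fun y hy => h.twoSidedAt hy)
    ⟨y, hZ.frontier_subset hy, frontier_subset_closure hy⟩
  rw [hZ.isOpen.frontier_eq]
  exact fun x hx => ⟨this hx, fun hxZ => disjoint_left.1 hZ.disjoint hxZ hx⟩

lemma IsJordanCurve.isJordanDomain_component [T2Space M] [IsSurface M] [PreconnectedSpace M]
    (h : IsJordanCurve J) {p : M} (hp : p ∉ J) : IsJordanDomain (connectedComponentIn Jᶜ p) := by
  refine ⟨h.isClosed.isOpen_compl.connectedComponentIn,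
    ⟨⟨p, mem_connectedComponentIn hp⟩, isPreconnected_connectedComponentIn⟩, ?_⟩
  rwa [h.frontier_component hp]

lemma IsOpen.disjoint_frontier' (h : IsOpen F) : Disjoint F (frontier F) := by
  rw [h.frontier_eq]
  exact disjoint_sdiff_right

lemma IsJordanDomain.isFace (h : IsJordanDomain F) : IsFace (frontier F) F :=
  ⟨h.isOpen, Subset.rfl, h.isOpen.disjoint_frontier'⟩

lemma IsJordanDomain.exterior [T2Space M] [JordanSurface M] [PreconnectedSpace M]
    (h : IsJordanDomain F) :
    IsJordanDomain (closure F)ᶜ ∧ frontier (closure F)ᶜ = frontier F := by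
  have hJ := h.isJordan
  have hex : ∃ p, p ∉ closure F := by
    by_contra hno
    push Not at hno
    refine JordanSurface.not_isPreconnected_compl _ hJ ?_
    have : (frontier F)ᶜ = F := by
      rw [h.isOpen.frontier_eq]
      ext x
      simp [hno x]
    rw [this]
    exact h.isConnected.isPreconnected
  have hcl : closure F = F ∪ frontier F := by
    rw [closure_eq_self_union_frontier]
  obtain ⟨p, hp⟩ := hex
  have hpJ : p ∉ frontier F := fun h => hp (frontier_subset_closure h)
  have hdisj : ∀ q, q ∉ closure F → Disjoint F (connectedComponentIn (frontier F)ᶜ q) := by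
    intro q hq
    have hqJ : q ∉ frontier F := fun h => hq (frontier_subset_closure h)
    refine disjoint_left.2 fun x hx hx' => hq (subset_closure ?_)
    exact h.isFace.mem_of_connIn (connIn_of_mem_component hx').symm hx
  have key : (closure F)ᶜ = connectedComponentIn (frontier F)ᶜ p := by
    ext q
    constructor
    · intro hq
      have hqJ : q ∉ frontier F := fun h => hq (frontier_subset_closure h)
      by_contra hqp
      obtain ⟨y, hy⟩ := hJ.nonempty
      have hcy : ∀ q, q ∉ frontier F → y ∈ closure (connectedComponentIn (frontier F)ᶜ q) :=
        fun q hq => frontier_subset_closure ((hJ.frontier_component hq).symm ▸ hy)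
      refine not_three_faces (hJ.twoSidedAt hy) h.isFace (isFace_component hJ.isClosed p)
        (isFace_component hJ.isClosed q) (hdisj p hp) (hdisj q hq) ?_
        (frontier_subset_closure hy) (hcy p hpJ) (hcy q hqJ)
      refine disjoint_left.2 fun x hx hx' => hqp ?_
      exact ((connIn_of_mem_component hx).trans (connIn_of_mem_component hx').symm).mem_component
    · intro hq hqF
      rcases hcl ▸ hqF with h' | h'
      · exact disjoint_left.1 (hdisj p hp) h' hq
      · exact connectedComponentIn_subset _ _ hq h'
  rw [key]
  exact ⟨hJ.isJordanDomain_component hpJ, hJ.frontier_component hpJ⟩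

lemma IsJordanDomain.locallyJoinedAt [T2Space M] [JordanSurface M] [PreconnectedSpace M]
    (h : IsJordanDomain F) (hy : y ∈ frontier F) : LocallyJoinedAt F y := by
  obtain ⟨h1, h2⟩ := h.exterior
  refine h.isFace.locallyJoinedAt (h.isJordan.twoSidedAt hy) (h2 ▸ h1.isFace) ?_
    (frontier_subset_closure (h2.symm ▸ hy))
  exact disjoint_left.2 fun x hx hx' => hx' (subset_closure hx)

/-- The theta curve lemma: the two parts of `F \ c`. -/
structure IsTheta (F c A B F₁ F₂ : Set M) : Prop where
  left : IsJordanDomain F₁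
  right : IsJordanDomain F₂
  disjoint : Disjoint F₁ F₂
  union : F₁ ∪ F₂ = F \ c
  frontier_left : frontier F₁ = A ∪ c
  frontier_right : frontier F₂ = B ∪ c

lemma IsJordanDomain.exists_half [T2Space M] [JordanSurface M] [PreconnectedSpace M] {c : Set M}
    (hF : IsJordanDomain F) (hAB : IsArcPair A B a b) (hJ : A ∪ B = frontier F) (hc : IsArc c a b)
    (hcF : c \ {a, b} ⊆ F) :
    ∃ F₁, IsJordanDomain F₁ ∧ frontier F₁ = A ∪ c ∧ F₁ ⊆ F \ c := by
  have hFd : ∀ x ∈ F, x ∉ A ∪ B := fun x hx => by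
    rw [hJ]
    exact disjoint_left.1 hF.isOpen.disjoint_frontier' hx
  have hAc : IsArcPair A c a b := ⟨hAB.left, hc, fun x hx => by
    by_contra hne
    exact hFd x (hcF ⟨hx.2, hne⟩) (Or.inl hx.1)⟩
  obtain ⟨hG, hGf⟩ := hF.exterior
  have hS : IsPreconnected ((closure F)ᶜ ∪ (B \ {a, b})) := by
    refine hG.isConnected.isPreconnected.subset_closure subset_union_left ?_
    refine union_subset subset_closure fun x hx => frontier_subset_closure ?_
    rw [hGf, ← hJ]
    exact Or.inr hx.1
  have hSd : Disjoint ((closure F)ᶜ ∪ (B \ {a, b})) (A ∪ c) := by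
    refine disjoint_left.2 ?_
    rintro x (hx | hx) (hxA | hxc)
    · exact hx (frontier_subset_closure (hJ ▸ Or.inl hxA))
    · by_cases hxab : x ∈ ({a, b} : Set M)
      · refine hx (frontier_subset_closure (hJ ▸ Or.inl ?_))
        rcases hxab with rfl | rfl
        · exact hAB.left.left_mem
        · exact hAB.left.right_mem
      · exact hx (subset_closure (hcF ⟨hxc, hxab⟩))
    · exact hx.2 (hAB.inter ⟨hxA, hx.1⟩)
    · exact hFd x (hcF ⟨hxc, hx.2⟩) (Or.inr hx.1)
  obtain ⟨g, hg⟩ := hG.isConnected.nonempty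
  have hgC : g ∉ A ∪ c := disjoint_left.1 hSd (Or.inl hg)
  have hE := hAc.isJordan.isJordanDomain_component hgC
  have hEf := hAc.isJordan.frontier_component hgC
  have hSE := hS.subset_connectedComponentIn (Or.inl hg) (disjoint_left.1 hSd : _ ⊆ (A ∪ c)ᶜ)
  obtain ⟨h1, h2⟩ := hE.exterior
  refine ⟨_, h1, h2.trans hEf, fun x hx => ?_⟩
  have hxE : x ∉ connectedComponentIn (A ∪ c)ᶜ g := fun h => hx (subset_closure h)
  have hxc : x ∉ A ∪ c := fun h => hx (frontier_subset_closure (hEf.symm ▸ h))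
  refine ⟨?_, fun h => hxc (Or.inr h)⟩
  by_contra hxF
  by_cases hxcl : x ∈ closure F
  · have hxJ : x ∈ A ∪ B := by
      rw [hJ, hF.isOpen.frontier_eq]
      exact ⟨hxcl, hxF⟩
    refine hxE (hSE (Or.inr ⟨hxJ.resolve_left fun h => hxc (Or.inl h), ?_⟩))
    rintro (rfl | rfl)
    · exact hxc (Or.inl hAB.left.left_mem)
    · exact hxc (Or.inl hAB.left.right_mem)
  · exact hxE (hSE (Or.inl hxcl))

lemma IsJordanDomain.exists_theta [T2Space M] [JordanSurface M] [PreconnectedSpace M] {c : Set M}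
    (hF : IsJordanDomain F) (hAB : IsArcPair A B a b) (hJ : A ∪ B = frontier F) (hc : IsArc c a b)
    (hcF : c \ {a, b} ⊆ F) : ∃ F₁ F₂, IsTheta F c A B F₁ F₂ := by
  obtain ⟨F₁, h1, hf1, hs1⟩ := hF.exists_half hAB hJ hc hcF
  obtain ⟨F₂, h2, hf2, hs2⟩ := hF.exists_half hAB.swap ((union_comm _ _).trans hJ) hc hcF
  set Θ := frontier F ∪ c with hΘ
  have hΘcl : IsClosed Θ := isClosed_frontier.union hc.isClosed
  have hFd := disjoint_left.1 hF.isOpen.disjoint_frontier'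
  have hface : ∀ {X D : Set M}, IsJordanDomain X → X ⊆ F \ c → frontier X = D ∪ c → D ⊆ A ∪ B →
      IsFace Θ X := by
    intro X D hX hXF hXD hD
    refine ⟨hX.isOpen, ?_, ?_⟩
    · rw [hXD, hΘ, ← hJ]
      exact union_subset_union_left _ hD
    · refine disjoint_left.2 fun x hx => ?_
      rintro (h | h)
      · exact hFd (hXF hx).1 h
      · exact (hXF hx).2 h
  have hz1 := hface h1 hs1 hf1 subset_union_left
  have hz2 := hface h2 hs2 hf2 subset_union_right
  have hdis : Disjoint F₁ F₂ := by
    by_contra hmeet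
    rw [not_disjoint_iff_nonempty_inter] at hmeet
    have e : F₁ = F₂ := (hz2.subset_of_isPreconnected h1.isConnected.isPreconnected hz1.disjoint
      hmeet).antisymm (hz1.subset_of_isPreconnected h2.isConnected.isPreconnected hz2.disjoint
      (inter_comm F₁ F₂ ▸ hmeet))
    obtain ⟨p, hp, hp'⟩ := hAB.left.interior_nonempty
    have : p ∈ B ∪ c := by
      rw [← hf2, ← e, hf1]
      exact Or.inl hp
    rcases this with h | h
    · exact hp' (hAB.inter ⟨hp, h⟩)
    · exact hFd (hcF ⟨h, hp'⟩) (hJ ▸ Or.inl hp)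
  refine ⟨F₁, F₂, h1, h2, hdis, (union_subset hs1 hs2).antisymm fun x hx => ?_, hf1, hf2⟩
  by_contra hxn
  have hxΘ : x ∈ Θᶜ := by
    rintro (h | h)
    · exact hFd hx.1 h
    · exact hx.2 h
  have hZ := isFace_component hΘcl x
  set Z := connectedComponentIn Θᶜ x
  have hxZ : x ∈ Z := mem_connectedComponentIn hxΘ
  have hZd : ∀ {X}, IsFace Θ X → x ∉ X → Disjoint X Z := fun hX hxX => disjoint_left.2
    fun z hz hz' => hxX (hX.mem_of_connIn (connIn_of_mem_component hz').symm hz)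
  by_cases hy : ∃ y ∈ c \ {a, b}, y ∈ closure Z
  · obtain ⟨y, ⟨hyc, hyab⟩, hyZ⟩ := hy
    have h2s : TwoSidedAt Θ y := hc.twoSidedAt hyc (fun h => hyab (Or.inl h))
      (fun h => hyab (Or.inr h)) (hF.isOpen.mem_nhds (hcF ⟨hyc, hyab⟩))
      fun z hz => or_iff_right (hFd hz)
    refine not_three_faces h2s hz1 hz2 hZ hdis (hZd hz1 fun h => hxn (Or.inl h))
      (hZd hz2 fun h => hxn (Or.inr h)) (frontier_subset_closure ?_) (frontier_subset_closure ?_)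
      hyZ
    · exact hf1 ▸ Or.inr hyc
    · exact hf2 ▸ Or.inr hyc
  · push Not at hy
    have hsub : F ⊆ Z := by
      refine hF.isConnected.isPreconnected.subset_of_closure_inter_subset hZ.isOpen ⟨x, hx.1, hxZ⟩ ?_
      rintro z ⟨hzZ, hzF⟩
      refine hZ.mem_of_mem_closure hzZ ?_
      rintro (h | h)
      · exact hFd hzF h
      · refine hy z ⟨h, ?_⟩ hzZ
        rintro (rfl | rfl)
        · exact hFd hzF (hJ ▸ Or.inl hAB.left.left_mem)
        · exact hFd hzF (hJ ▸ Or.inl hAB.left.right_mem)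
    obtain ⟨p, hp⟩ := hc.interior_nonempty
    exact disjoint_left.1 hZ.disjoint (hsub (hcF hp)) (Or.inr hp.1)

end Jordan

/-! ### Accessibility -/

section Access
variable {M : Type*} [MetricSpace M]

/-- An arc in `F` on `[0, n + 1]` whose final point can be joined, close to `x` and off the
arc on `[0, n]`, to all points of `F` near `x`. -/
structure IsApproach (F : Set M) (x : M) (n : ℕ) (α : ℝ → M) : Prop where
  cont : ContinuousOn α (Icc 0 (n + 1))
  inj : InjOn α (Icc 0 (n + 1))
  mem : ∀ t ∈ Icc (0 : ℝ) (n + 1), α t ∈ F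
  join : ∃ O V : Set M, IsOpen O ∧ O ⊆ ball x (1 / (n + 1)) ∧ (∀ t ∈ Icc (0 : ℝ) n, α t ∉ O) ∧
    V ∈ 𝓝 x ∧ α (n + 1) ∈ V ∧ ∀ p ∈ F ∩ V, ∀ q ∈ F ∩ V, ConnIn (O ∩ F) p q

/-- The next term `α'` of an approach. -/
structure IsNextApproach (x : M) (n : ℕ) (α α' : ℝ → M) : Prop where
  eqOn : EqOn α' α (Icc 0 n)
  near : ∀ t ∈ Icc (n + 1 : ℝ) (n + 2), α' t ∈ ball x (1 / (n + 1))
  sub : Set.image α' (Icc n (n + 1)) ⊆ α '' Icc n (n + 1)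

variable {F : Set M} {x : M}

lemma exists_nhds_join (hj : LocallyJoinedAt F x) (hxF : x ∉ F) (n : ℕ) {K : Set M}
    (hK : IsCompact K) (hKF : K ⊆ F) :
    ∃ O V : Set M, IsOpen O ∧ O ⊆ ball x (1 / (n + 1)) ∧ (∀ p ∈ K, p ∉ O) ∧
      V ∈ 𝓝 x ∧ ∀ p ∈ F ∩ V, ∀ q ∈ F ∩ V, ConnIn (O ∩ F) p q := by
  have hO : IsOpen (ball x (1 / ((n : ℝ) + 1)) ∩ Kᶜ) :=
    isOpen_ball.inter hK.isClosed.isOpen_compl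
  obtain ⟨V, hV, h⟩ := hj _ (hO.mem_nhds ⟨mem_ball_self (by positivity), fun h => hxF (hKF h)⟩)
  exact ⟨_, V, hO, inter_subset_left, fun p hp h => h.2 hp, hV, h⟩

lemma IsApproach.exists_next [IsSurface M] (hF : IsOpen F)
    (hxF : x ∉ F) (hx : x ∈ closure F) (hj : LocallyJoinedAt F x) {n : ℕ} {α : ℝ → M}
    (h : IsApproach F x n α) : ∃ α', IsApproach F x (n + 1) α' ∧ IsNextApproach x n α α' := by
  obtain ⟨hα, hαi, hαF, O, V, hO, hOb, hαO, hV, hαV, hjoin⟩ := h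
  have hn0 : (0 : ℝ) ≤ n := n.cast_nonneg
  have hn1 : (0 : ℝ) ≤ n + 1 := by linarith
  have hKF : α '' Icc 0 (n + 1 : ℝ) ⊆ F := by
    rintro _ ⟨t, ht, rfl⟩
    exact hαF t ht
  have hK : IsCompact (α '' Icc 0 (n + 1 : ℝ)) := isCompact_Icc.image_of_continuousOn hα
  obtain ⟨O', V', hO', hOb', hαO', hV', hjoin'⟩ := exists_nhds_join hj hxF (n + 1) hK hKF
  obtain ⟨q, ⟨⟨hqV, hqV'⟩, hqK⟩, hqF⟩ := mem_closure_iff_nhds.1 hx _ (inter_mem (inter_mem hV hV')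
    (hK.isClosed.isOpen_compl.mem_nhds fun h => hxF (hKF h)))
  have hlast : (n + 1 : ℝ) ∈ Icc (0 : ℝ) (n + 1) := right_mem_Icc.2 hn1
  have hc := hjoin _ ⟨hαF _ hlast, hαV⟩ q ⟨hqF, hqV⟩
  have hcs := connectedComponentIn_subset (O ∩ F) (α (n + 1))
  obtain ⟨B, hB, hBarc⟩ := isPreconnected_connectedComponentIn.exists_arc
    (hO.inter hF).connectedComponentIn (mem_connectedComponentIn hc.left_mem) hc.mem_component
    (fun e => hqK ⟨_, hlast, e⟩)
  have hBcl := hBarc.isClosed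
  have hBO : B ⊆ O ∩ F := hB.trans hcs
  have hBl := hBarc.left_mem
  obtain ⟨β, hβ, hβi, hβ0, hβ1, rfl⟩ := hBarc
  have hcp : IsCompact (Icc 0 (n + 1 : ℝ) ∩ α ⁻¹' (β '' Icc 0 1)) :=
    isCompact_Icc.of_isClosed_subset
      (hα.preimage_isClosed_of_isClosed isClosed_Icc hBcl) inter_subset_left
  obtain ⟨s, ⟨hs, hsB⟩, hsmin⟩ := hcp.exists_isLeast ⟨_, hlast, hBl⟩
  obtain ⟨r, hr, hrs⟩ := hsB
  have hns : (n : ℝ) < s := by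
    by_contra hle
    push Not at hle
    exact hαO s ⟨hs.1, hle⟩ (hrs ▸ (hBO ⟨r, hr, rfl⟩).1)
  have hr1 : r < 1 := lt_of_le_of_ne hr.2 fun e => hqK ⟨s, hs, by rw [← hrs, e, hβ1]⟩
  -- reparametrisations
  set f : ℝ → ℝ := fun t => min t (n + (t - n) * (s - n)) with hf
  have hfm : StrictMono f := by
    intro t t' htt'
    have : (t - n) * (s - n) < (t' - n) * (s - n) :=
      mul_lt_mul_of_pos_right (by linarith) (by linarith)
    exact min_lt_min htt' (by linarith)
  have hfc : Continuous f := by fun_prop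
  have hs1 : s - n ≤ 1 := by linarith [hs.2]
  have hfn : ∀ t ≤ (n : ℝ), f t = t := fun t ht => min_eq_left (by nlinarith)
  have hfn' : ∀ t, (n : ℝ) ≤ t → f t = n + (t - n) * (s - n) := fun t ht =>
    min_eq_right (by nlinarith)
  have hfs : f (n + 1) = s := by rw [hfn' _ (by linarith)]; ring
  have hfmap : MapsTo f (Icc 0 (n + 1)) (Icc 0 s) := fun t ht =>
    ⟨by rw [← hfn 0 hn0]; exact hfm.monotone ht.1, by rw [← hfs]; exact hfm.monotone ht.2⟩
  have hfmap' : MapsTo f (Icc n (n + 1)) (Icc n s) := fun t ht =>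
    ⟨by rw [← hfn n le_rfl]; exact hfm.monotone ht.1, by rw [← hfs]; exact hfm.monotone ht.2⟩
  have hsub : Icc 0 s ⊆ Icc 0 (n + 1 : ℝ) := Icc_subset_Icc_right hs.2
  set g : ℝ → ℝ := fun t => r + (t - (n + 1)) * (1 - r) with hg
  have hgm : StrictMono g := by
    intro t t' htt'
    have : (t - (n + 1)) * (1 - r) < (t' - (n + 1)) * (1 - r) :=
      mul_lt_mul_of_pos_right (by linarith) (by linarith)
    exact add_lt_add_right this r
  have hg0 : g (n + 1) = r := by simp [hg]
  have hg1 : g (n + 2) = 1 := by simp only [hg]; ring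
  have hgmap : MapsTo g (Icc (n + 1) (n + 2)) (Icc r 1) := fun t ht =>
    ⟨by rw [← hg0]; exact hgm.monotone ht.1, by rw [← hg1]; exact hgm.monotone ht.2⟩
  have hgsub : Icc r 1 ⊆ Icc 0 1 := Icc_subset_Icc_left hr.1
  obtain ⟨γ, hγ, hγi, e1, e2⟩ := exists_arc_concat (α := α ∘ f) (β := β ∘ g) hn1
    (by linarith : (n + 1 : ℝ) ≤ n + 2) (hα.comp hfc.continuousOn fun t ht => hsub (hfmap ht))
    (hβ.comp (by fun_prop) fun t ht => hgsub (hgmap ht))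
    (hαi.comp hfm.injective.injOn fun t ht => hsub (hfmap ht))
    (hβi.comp hgm.injective.injOn fun t ht => hgsub (hgmap ht))
    (by simp [hfs, hg0, hrs]) (by
      intro t ht t' ht' htt'
      have h1 : s ≤ f t := hsmin ⟨hsub (hfmap ht), ⟨g t', hgsub (hgmap ht'), htt'.symm⟩⟩
      have h2 : f t = s := le_antisymm (hfmap ht).2 h1
      have h3 : β (g t') = β r := by
        rw [hrs, ← h2]
        exact htt'.symm
      have h4 : g t' = r := hβi (hgsub (hgmap ht')) hr h3
      rw [hfm.injective (h2.trans hfs.symm), hgm.injective (h4.trans hg0.symm)])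
  have hcast : ((n + 1 : ℕ) : ℝ) + 1 = n + 2 := by push_cast; ring
  have hγα : ∀ t ∈ Icc (0 : ℝ) (n + 1), ∃ t' ∈ Icc (0 : ℝ) (n + 1), γ t = α t' := fun t ht =>
    ⟨f t, hsub (hfmap ht), e1 ht⟩
  have hγβ : ∀ t ∈ Icc (n + 1 : ℝ) (n + 2), γ t ∈ O ∩ F := fun t ht => by
    rw [e2 ht]
    exact hBO ⟨g t, hgsub (hgmap ht), rfl⟩
  refine ⟨γ, ⟨?_, ?_, ?_, O', V', hO', ?_, ?_, hV', ?_, hjoin'⟩, ?_, ?_, ?_⟩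
  · rwa [hcast]
  · rwa [hcast]
  · intro t ht
    rw [hcast] at ht
    rcases le_total t (n + 1) with h | h
    · obtain ⟨t', ht', e⟩ := hγα t ⟨ht.1, h⟩
      exact e ▸ hαF t' ht'
    · exact (hγβ t ⟨h, ht.2⟩).2
  · exact hOb'
  · intro t ht
    push_cast at ht
    obtain ⟨t', ht', e⟩ := hγα t ht
    exact e ▸ hαO' _ ⟨t', ht', rfl⟩
  · rw [hcast, e2 (right_mem_Icc.2 (by linarith)), Function.comp_apply, hg1, hβ1]
    exact hqV'
  · intro t ht
    rw [e1 ⟨ht.1, by linarith [ht.2]⟩, Function.comp_apply, hfn t ht.2]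
  · exact fun t ht => hOb (hγβ t ht).1
  · rintro _ ⟨t, ht, rfl⟩
    rw [e1 ⟨hn0.trans ht.1, ht.2⟩]
    exact ⟨f t, Icc_subset_Icc_right hs.2 (hfmap' ht), rfl⟩

lemma exists_isApproach [IsSurface M] (hF : IsOpen F) (hFc : IsPreconnected F)
    (hxF : x ∉ F) (hx : x ∈ closure F) (hj : LocallyJoinedAt F x) {p : M} (hp : p ∈ F) :
    ∃ α, IsApproach F x 0 α := by
  obtain ⟨O, V, hO, hOb, hpO, hV, hjoin⟩ := exists_nhds_join hj hxF 0 (isCompact_singleton (x := p))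
    (by simpa)
  obtain ⟨q, ⟨hqV, hqp⟩, hqF⟩ := mem_closure_iff_nhds.1 hx _ (inter_mem hV
    (isOpen_compl_singleton.mem_nhds (show x ∈ ({p}ᶜ : Set M) from fun h => hxF (h ▸ hp))))
  obtain ⟨A, hA, γ, hγ, hi, h0, h1, rfl⟩ := hFc.exists_arc hF hp hqF fun e => hqp e.symm
  refine ⟨γ, by simpa, by simpa, fun t ht => hA ⟨t, by simpa using ht, rfl⟩, O, V, hO, hOb, ?_, hV,
    by simpa [h1], hjoin⟩
  intro t ht
  have : t = 0 := by simpa using ht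
  rw [this, h0]
  exact hpO p rfl

lemma exists_arc_to_boundary_point [IsSurface M] (hF : IsOpen F) (hFc : IsPreconnected F)
    (hxF : x ∉ F) (hx : x ∈ closure F) (hj : LocallyJoinedAt F x) {p : M} (hp : p ∈ F) :
    ∃ A, IsArc A x p ∧ A \ {x} ⊆ F := by
  suffices h : ∃ A p', p' ∈ F ∧ IsArc A p' x ∧ A \ {x} ⊆ F by
    obtain ⟨A, p', hp', hA, hAF⟩ := h
    by_cases e : p' = p
    · exact ⟨A, (e ▸ hA).symm, hAF⟩
    · obtain ⟨B, hB, hB'⟩ := hFc.exists_arc hF hp' hp e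
      obtain ⟨C, hC, hC'⟩ := hA.symm.exists_trans hB' (fun e => hxF (e ▸ hp))
      refine ⟨C, hC', fun y hy => ?_⟩
      rcases hC hy.1 with h | h
      · exact hAF ⟨h, hy.2⟩
      · exact hB h
  obtain ⟨α₀, hα₀⟩ := exists_isApproach hF hFc hxF hx hj hp
  have hstep : ∀ (n : ℕ) (α : ℝ → M), ∃ α', IsApproach F x n α →
      IsApproach F x (n + 1) α' ∧ IsNextApproach x n α α' := fun n α => by
    by_cases h : IsApproach F x n α
    · obtain ⟨α', h'⟩ := h.exists_next hF hxF hx hj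
      exact ⟨α', fun _ => h'⟩
    · exact ⟨α, fun h' => absurd h' h⟩
  choose next hnext using hstep
  set σ : ℕ → ℝ → M := fun n => Nat.rec α₀ next n with hσ
  have hσs : ∀ n, σ (n + 1) = next n (σ n) := fun n => rfl
  have hσa : ∀ n, IsApproach F x n (σ n) := by
    intro n
    induction n with
    | zero => exact hα₀
    | succ n ih => exact (hnext n _ ih).1
  have hσn : ∀ n, IsNextApproach x n (σ n) (σ (n + 1)) := fun n => (hnext n _ (hσa n)).2
  have hstab : ∀ k m, k ≤ m → EqOn (σ m) (σ k) (Icc 0 k) := by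
    intro k m hkm
    induction m, hkm using Nat.le_induction with
    | base => exact fun _ _ => rfl
    | succ m hkm ih =>
      intro t ht
      rw [(hσn m).eqOn ⟨ht.1, ht.2.trans (by exact_mod_cast hkm)⟩, ih ht]
  set τ : ℝ → M := fun t => σ (⌊t⌋₊ + 1) t with hτ
  have hτσ : ∀ k : ℕ, EqOn τ (σ k) (Icc 0 k) := by
    intro k t ht
    have hfl : t ≤ ((⌊t⌋₊ + 1 : ℕ) : ℝ) := by
      push_cast
      exact (Nat.lt_floor_add_one t).le
    rcases le_total k (⌊t⌋₊ + 1) with h | h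
    · exact hstab k _ h ht
    · exact (hstab _ k h ⟨ht.1, hfl⟩).symm
  have hτF : ∀ t, 0 ≤ t → τ t ∈ F := fun t ht => (hσa (⌊t⌋₊ + 1)).mem t ⟨ht, by
    push_cast
    linarith [(Nat.lt_floor_add_one t).le]⟩
  have hτc : ContinuousOn τ (Ici 0) := by
    intro t ht
    obtain ⟨k, hk⟩ := exists_nat_gt t
    have h1 : ContinuousOn τ (Icc 0 k) :=
      ((hσa k).cont.mono (Icc_subset_Icc_right (by linarith))).congr (hτσ k)
    refine (h1 t ⟨ht, hk.le⟩).mono_of_mem_nhdsWithin ?_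
    rw [mem_nhdsWithin]
    exact ⟨Iio k, isOpen_Iio, hk, fun y hy => ⟨hy.2, (hy.1 : y < k).le⟩⟩
  have hτi : InjOn τ (Ici 0) := by
    intro t ht t' ht' e
    obtain ⟨k, hk⟩ := exists_nat_gt (max t t')
    have ht2 : t ∈ Icc (0 : ℝ) k := ⟨ht, (le_max_left _ _).trans hk.le⟩
    have ht2' : t' ∈ Icc (0 : ℝ) k := ⟨ht', (le_max_right _ _).trans hk.le⟩
    rw [hτσ k ht2, hτσ k ht2'] at e
    have hs : Icc (0 : ℝ) k ⊆ Icc 0 (k + 1) := Icc_subset_Icc_right (by linarith)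
    exact (hσa k).inj (hs ht2) (hs ht2') e
  have hnear : ∀ n : ℕ, ∀ t, (n + 1 : ℝ) ≤ t → dist (τ t) x < 1 / (n + 1) := by
    intro n t ht
    have ht0 : 0 ≤ t := le_trans (by positivity) ht
    set m := ⌊t⌋₊ with hm
    have hm1 : (m : ℝ) ≤ t := Nat.floor_le ht0
    have hm2 : t < m + 1 := Nat.lt_floor_add_one t
    have hnm : n + 1 ≤ m := Nat.le_floor (by exact_mod_cast ht)
    obtain ⟨l, hl⟩ : ∃ l, m = l + 1 := ⟨m - 1, by omega⟩
    have : τ t ∈ σ m '' Icc m (m + 1) := (hσn m).sub ⟨t, ⟨hm1, hm2.le⟩, rfl⟩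
    rw [hl] at this
    obtain ⟨t', ht', e⟩ := this
    have h2 := (hσn l).near t' (by
      push_cast at ht'
      exact ⟨ht'.1, by linarith [ht'.2]⟩)
    rw [e] at h2
    refine (mem_ball.1 h2).trans_le (one_div_le_one_div_of_le (by positivity) ?_)
    have : n ≤ l := by omega
    have : (n : ℝ) ≤ l := by exact_mod_cast this
    linarith
  have hτx : Tendsto τ atTop (𝓝 x) := by
    rw [Metric.tendsto_atTop]
    intro ε hε
    obtain ⟨n, hn⟩ := exists_nat_one_div_lt hε
    exact ⟨n + 1, fun t ht => (hnear n t ht).trans hn⟩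
  -- compactify the parameter interval
  set h : ℝ → ℝ := fun t => (1 - t)⁻¹ - 1 with hh
  have hh0 : ∀ t ∈ Ico (0 : ℝ) 1, 0 ≤ h t := by
    intro t ht
    have : 1 ≤ (1 - t)⁻¹ := (one_le_inv₀ (by linarith [ht.2])).2 (by linarith [ht.1])
    simp only [hh]
    linarith
  set γ : ℝ → M := fun t => if t < 1 then τ (h t) else x with hγ
  have hγ1 : ∀ t < (1 : ℝ), γ t = τ (h t) := fun t ht => if_pos ht
  have hγx : γ 1 = x := if_neg (lt_irrefl 1)
  have hγF : ∀ t ∈ Ico (0 : ℝ) 1, γ t ∈ F := fun t ht => by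
    rw [hγ1 t ht.2]
    exact hτF _ (hh0 t ht)
  refine ⟨γ '' Icc 0 1, γ 0, hγF 0 (by simp), ⟨γ, ?_, ?_, rfl, hγx, rfl⟩, ?_⟩
  · have hIco : ContinuousOn γ (Ico 0 1) := by
      refine (hτc.comp (f := h) (s := Ico 0 1) ?_ hh0).congr fun t ht => hγ1 t ht.2
      refine ContinuousOn.sub (ContinuousOn.inv₀ (by fun_prop) ?_) continuousOn_const
      intro t ht
      linarith [ht.2]
    intro t ht
    rcases eq_or_lt_of_le ht.2 with rfl | ht1
    · have : Tendsto γ (𝓝[<] 1) (𝓝 x) := by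
        have h1 : Tendsto h (𝓝[<] 1) atTop := by
          refine tendsto_atTop_add_const_right _ (-1) ?_
          refine tendsto_inv_nhdsGT_zero.comp ?_
          refine tendsto_nhdsWithin_iff.2 ⟨?_, ?_⟩
          · have : Tendsto (fun t : ℝ => 1 - t) (𝓝 1) (𝓝 (1 - 1)) :=
              (continuous_const.sub continuous_id).tendsto 1
            rw [sub_self] at this
            exact this.mono_left nhdsWithin_le_nhds
          · filter_upwards [self_mem_nhdsWithin] with t ht
            exact sub_pos.2 (show t < 1 from ht)
        refine (hτx.comp h1).congr' ?_
        filter_upwards [self_mem_nhdsWithin] with t ht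
        exact (hγ1 t ht).symm
      have h2 : ContinuousWithinAt γ (Iio 1) 1 := by
        rw [ContinuousWithinAt, hγx]
        exact this
      exact (continuousWithinAt_insert_self.2 h2).mono fun t ht => by
        rcases eq_or_lt_of_le ht.2 with h | h
        · exact Or.inl h
        · exact Or.inr h
    · refine (hIco t ⟨ht.1, ht1⟩).mono_of_mem_nhdsWithin ?_
      rw [mem_nhdsWithin]
      exact ⟨Iio 1, isOpen_Iio, ht1, fun y hy => ⟨hy.2.1, hy.1⟩⟩
  · have key : ∀ t ∈ Icc (0 : ℝ) 1, γ t = x → t = 1 := by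
      intro t ht e
      by_contra hne
      exact hxF (e ▸ hγF t ⟨ht.1, lt_of_le_of_ne ht.2 hne⟩)
    intro t ht t' ht' e
    rcases eq_or_lt_of_le ht.2 with rfl | h1
    · exact (key t' ht' (e ▸ hγx)).symm
    rcases eq_or_lt_of_le ht'.2 with rfl | h1'
    · exact key t ht (e.trans hγx)
    rw [hγ1 t h1, hγ1 t' h1'] at e
    have := hτi (hh0 t ⟨ht.1, h1⟩) (hh0 t' ⟨ht'.1, h1'⟩) e
    have := inv_injective (sub_left_injective this)
    linarith
  · rintro _ ⟨⟨t, ht, rfl⟩, hne⟩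
    exact hγF t ⟨ht.1, lt_of_le_of_ne ht.2 fun e => hne (by rw [e, hγx]; rfl)⟩

end Access

/-! ### Crosscuts -/

/-- An arc through `F` joining two boundary points. -/
structure IsCrosscut {M : Type*} [TopologicalSpace M] (F c : Set M) (a b : M) : Prop where
  isArc : IsArc c a b
  left_mem : a ∈ frontier F
  right_mem : b ∈ frontier F
  sub : c \ {a, b} ⊆ F

section Crosscut
variable {M : Type*} [MetricSpace M] {F c : Set M} {a b : M}

lemma IsJordanDomain.notMem_of_mem_frontier (hF : IsJordanDomain F) (ha : a ∈ frontier F) : a ∉ F :=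
  fun h => disjoint_left.1 hF.isOpen.disjoint_frontier' h ha

lemma IsCrosscut.exists_theta [JordanSurface M] [PreconnectedSpace M]
    (hF : IsJordanDomain F) (hc : IsCrosscut F c a b) :
    ∃ A B F₁ F₂, IsArcPair A B a b ∧ A ∪ B = frontier F ∧ IsTheta F c A B F₁ F₂ := by
  obtain ⟨A, B, hAB, e⟩ := hF.isJordan.exists_pair hc.left_mem hc.right_mem hc.isArc.ne
  obtain ⟨F₁, F₂, h⟩ := hF.exists_theta hAB e hc.isArc hc.sub
  exact ⟨A, B, F₁, F₂, hAB, e, h⟩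

/-- Any two boundary points of a Jordan domain are the end points of a crosscut. -/
lemma IsJordanDomain.exists_crosscut [JordanSurface M] [PreconnectedSpace M]
    (hF : IsJordanDomain F) (ha : a ∈ frontier F) (hb : b ∈ frontier F) (hab : a ≠ b) :
    ∃ c, IsCrosscut F c a b := by
  obtain ⟨p, hp⟩ := hF.isConnected.nonempty
  obtain ⟨A, hA, hAF⟩ := exists_arc_to_boundary_point hF.isOpen hF.isConnected.isPreconnected
    (hF.notMem_of_mem_frontier ha) (frontier_subset_closure ha) (hF.locallyJoinedAt ha) hp
  obtain ⟨B, hB, hBF⟩ := exists_arc_to_boundary_point hF.isOpen hF.isConnected.isPreconnected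
    (hF.notMem_of_mem_frontier hb) (frontier_subset_closure hb) (hF.locallyJoinedAt hb) hp
  obtain ⟨c, hc, hcA⟩ := hA.exists_trans hB.symm hab
  refine ⟨c, hcA, ha, hb, fun x hx => ?_⟩
  rcases hc hx.1 with h | h
  · exact hAF ⟨h, fun e => hx.2 (Or.inl e)⟩
  · exact hBF ⟨h, fun e => hx.2 (Or.inr e)⟩

lemma IsArc.exists_notMem_open [IsSurface M] (hc : IsArc c a b) {D : Set M} (hD : IsOpen D)
    (hne : D.Nonempty) : (D \ c).Nonempty := by
  obtain ⟨x, hx⟩ := hne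
  by_cases hxc : x ∈ c
  · obtain ⟨w, hwD, hwc⟩ := mem_closure_iff.1 (hc.subset_closure_interior hxc) D hD hx
    have h2 : TwoSidedAt c w := hc.twoSidedAt hwc.1 (fun e => hwc.2 (Or.inl e))
      (fun e => hwc.2 (Or.inr e)) univ_mem fun _ _ => Iff.rfl
    obtain ⟨O', hO', hw, hO'D, s, -, h3, -⟩ := h2 D (hD.mem_nhds hwD)
    obtain ⟨⟨p, hp, -⟩, -⟩ := h3 w ⟨hw, hwc.1⟩ univ univ_mem
    exact ⟨p, hO'D hp.1.2, hp.2⟩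
  · exact ⟨x, hx, hxc⟩

/-- A crosscut with given end points can be chosen to meet a given open set. -/
lemma IsJordanDomain.exists_crosscut_meeting [JordanSurface M] [PreconnectedSpace M]
    (hF : IsJordanDomain F) (ha : a ∈ frontier F) (hb : b ∈ frontier F) (hab : a ≠ b) {I : Set M}
    (hI : IsOpen I) (hIF : (F ∩ I).Nonempty) : ∃ c, IsCrosscut F c a b ∧ (c ∩ I).Nonempty := by
  obtain ⟨x, hxF, hxI⟩ := hIF
  have haF := hF.notMem_of_mem_frontier ha
  have hbF := hF.notMem_of_mem_frontier hb
  obtain ⟨φ, hφ, hφ0, hφI⟩ := IsSurface.exists_chart x (F ∩ I)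
    ((hF.isOpen.inter hI).mem_nhds ⟨hxF, hxI⟩)
  have hDo := hφ.isOpen_range
  have hDc : IsPreconnected (range φ) := isPreconnected_range hφ.continuous
  obtain ⟨A, hA, hAF⟩ := exists_arc_to_boundary_point hF.isOpen hF.isConnected.isPreconnected
    haF (frontier_subset_closure ha) (hF.locallyJoinedAt ha) hxF
  have hbA : b ∉ A := fun h => hbF (hAF ⟨h, hab.symm⟩)
  have hU := hA.isPreconnected_diff hF.isOpen hF.isConnected.isPreconnected hAF
  have hUo : IsOpen (F \ A) := hF.isOpen.sdiff hA.isClosed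
  have hAn : Aᶜ ∈ 𝓝 b := hA.isClosed.isOpen_compl.mem_nhds hbA
  have hj : LocallyJoinedAt (F \ A) b := by
    intro O hO
    obtain ⟨O', hO', h⟩ := hF.locallyJoinedAt hb (O ∩ Aᶜ) (inter_mem hO hAn)
    exact ⟨O', hO', fun p hp q hq => (h p ⟨hp.1.1, hp.2⟩ q ⟨hq.1.1, hq.2⟩).mono
      fun z hz => ⟨hz.1.1, hz.2, hz.1.2⟩⟩
  have hbcl : b ∈ closure (F \ A) := by
    rw [mem_closure_iff_nhds]
    intro V hV
    obtain ⟨z, hz, hzF⟩ := mem_closure_iff_nhds.1 (frontier_subset_closure hb) _ (inter_mem hV hAn)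
    exact ⟨z, hz.1, hzF, hz.2⟩
  obtain ⟨y, hyD, hyA⟩ := hA.exists_notMem_open hDo ⟨x, 0, hφ0⟩
  obtain ⟨B, hB, hBF⟩ := exists_arc_to_boundary_point hUo hU (fun h => hbF h.1) hbcl hj
    (p := y) ⟨(hφI hyD).1, hyA⟩
  obtain ⟨D, hD, hDarc⟩ := hDc.exists_arc hDo ⟨0, hφ0⟩ hyD (fun e => hyA (e ▸ hA.right_mem))
  obtain ⟨C₁, hC₁, hC₁arc⟩ := hA.exists_trans hDarc fun e => haF (e ▸ (hφI hyD).1)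
  obtain ⟨C, hC, hCarc⟩ := hC₁arc.exists_trans hB.symm hab
  have hCsub : C ⊆ A ∪ B ∪ D := fun z hz => by
    rcases hC hz with h | h
    · rcases hC₁ h with h | h
      · exact Or.inl (Or.inl h)
      · exact Or.inr h
    · exact Or.inl (Or.inr h)
  refine ⟨C, ⟨hCarc, ha, hb, fun z hz => ?_⟩, ?_⟩
  · rcases hCsub hz.1 with (h | h) | h
    · exact hAF ⟨h, fun e => hz.2 (Or.inl e)⟩
    · exact (hBF ⟨h, fun e => hz.2 (Or.inr e)⟩).1
    · exact (hφI (hD h)).1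
  · by_contra hno
    have hCAB : C ⊆ A ∪ B := fun z hz => (hCsub hz).resolve_right
      fun h => hno ⟨z, hz, (hφI (hD h)).2⟩
    have hd : A ∩ B = ∅ := by
      rw [eq_empty_iff_forall_notMem]
      rintro z ⟨hzA, hzB⟩
      by_cases e : z = b
      · exact hbA (e ▸ hzA)
      · exact (hBF ⟨hzB, e⟩).2 hzA
    have := isPreconnected_closed_iff.1 hCarc.isPreconnected A B hA.isClosed hB.isClosed hCAB
      ⟨a, hCarc.left_mem, hA.left_mem⟩ ⟨b, hCarc.right_mem, hB.left_mem⟩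
    rw [hd, inter_empty] at this
    exact not_nonempty_empty this

/-- Removing a chart disc from a connected surface leaves a connected set. -/
lemma isPreconnected_compl_chart_ball [IsSurface M] [PreconnectedSpace M] {φ : ℂ → M}
    (hφ : IsOpenEmbedding φ) : IsPreconnected (φ '' ball 0 1)ᶜ := by
  set B := φ '' ball (0 : ℂ) 1 with hB
  set K := φ '' closedBall (0 : ℂ) 1 with hK
  set S := φ '' sphere (0 : ℂ) 1 with hS
  have hKc : IsClosed K := ((isCompact_closedBall _ _).image hφ.continuous).isClosed
  have hBo : IsOpen B := hφ.isOpenMap _ isOpen_ball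
  have hKBS : K ⊆ B ∪ S := by
    rw [hK, ← ball_union_sphere, image_union]
  have hSp : IsPreconnected S := isPreconnected_unit_sphere.image _ hφ.continuous.continuousOn
  have hSB : S ⊆ Bᶜ := by
    rintro _ ⟨z, hz, rfl⟩ ⟨w, hw, e⟩
    rw [hφ.injective e] at hw
    exact absurd (mem_ball.1 hw) (mem_sphere.1 hz).not_lt
  have key : ∀ q ∈ Bᶜ, ∃ s ∈ S, ConnIn Bᶜ q s := by
    intro q hq
    by_cases hqK : q ∈ K
    · have hqS := (hKBS hqK).resolve_left hq
      exact ⟨q, hqS, ConnIn.refl hq⟩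
    set Z := connectedComponentIn Kᶜ q with hZ
    have hqZ : q ∈ Z := mem_connectedComponentIn hqK
    have hf := isFace_component hKc q
    have hne : (frontier Z).Nonempty := by
      rw [nonempty_frontier_iff]
      refine ⟨⟨q, hqZ⟩, fun e => disjoint_left.1 hf.disjoint (e ▸ mem_univ (φ 0)) ?_⟩
      exact ⟨0, by simp, rfl⟩
    obtain ⟨s, hs⟩ := hne
    have hZB : closure Z ⊆ Bᶜ := by
      refine closure_minimal (fun z hz hzB => disjoint_left.1 hf.disjoint hz ?_) hBo.isClosed_compl
      exact image_mono ball_subset_closedBall hzB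
    refine ⟨s, (hKBS (hf.frontier_subset hs)).resolve_left (hZB (frontier_subset_closure hs)),
      closure Z, hZB, isPreconnected_connectedComponentIn.closure, subset_closure hqZ,
      frontier_subset_closure hs⟩
  refine isPreconnected_of_connIn fun p hp q hq => ?_
  obtain ⟨s, hs, h1⟩ := key p hp
  obtain ⟨t, ht, h2⟩ := key q hq
  exact (h1.trans ((hSp.connIn hs ht).mono hSB)).trans h2.symm

/-- Small sets lie in small open sets with connected complement. -/
lemma exists_small_disc [IsSurface M] [PreconnectedSpace M] [CompactSpace M] {ε : ℝ} (hε : 0 < ε) :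
    ∃ η > 0, ∀ x : M, ∃ B, ball x η ⊆ B ∧ (∀ p ∈ B, ∀ q ∈ B, dist p q < ε) ∧
      IsPreconnected Bᶜ := by
  have h : ∀ x : M, ∃ φ : ℂ → M, IsOpenEmbedding φ ∧ φ 0 = x ∧ range φ ⊆ ball x (ε / 2) :=
    fun x => IsSurface.exists_chart x _ (ball_mem_nhds x (half_pos hε))
  choose φ hφ hφ0 hφr using h
  obtain ⟨η, hη, hL⟩ := lebesgue_number_lemma_of_metric (isCompact_univ (X := M))
    (c := fun x => φ x '' ball 0 1) (fun x => (hφ x).isOpenMap _ isOpen_ball)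
    (fun x _ => mem_iUnion.2 ⟨x, 0, by simp, hφ0 x⟩)
  refine ⟨η, hη, fun x => ?_⟩
  obtain ⟨y, hy⟩ := hL x (mem_univ x)
  refine ⟨_, hy, ?_, isPreconnected_compl_chart_ball (hφ y)⟩
  rintro _ ⟨z, -, rfl⟩ _ ⟨w, -, rfl⟩
  have h1 := mem_ball.1 (hφr y ⟨z, rfl⟩)
  have h2 := mem_ball.1 (hφr y ⟨w, rfl⟩)
  linarith [dist_triangle_right (φ y z) (φ y w) y]

/-- Nearby points of a Jordan curve cut off a small arc. -/
lemma IsJordanCurve.exists_small_arc {J : Set M} (hJ : IsJordanCurve J) {ε : ℝ} (hε : 0 < ε) :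
    ∃ δ > 0, ∀ a ∈ J, ∀ b ∈ J, a ≠ b → dist a b < δ →
      ∃ A B, IsArcPair A B a b ∧ A ∪ B = J ∧ ∀ p ∈ A, dist p a < ε := by
  have hloc : ∀ y : J, ∃ O : Set M, IsOpen O ∧ ↑y ∈ O ∧ ∀ a ∈ J ∩ O, ∀ b ∈ J ∩ O, a ≠ b →
      ∃ A B, IsArcPair A B a b ∧ A ∪ B = J ∧ ∀ p ∈ A, dist p a < ε := by
    rintro ⟨y, hy⟩
    obtain ⟨A, B, p, q, hAB, rfl, hyA, hyB⟩ := hJ.exists_pair_interior hy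
    have hBcl := hAB.right.isClosed
    have hB := hAB.right
    have hin := hAB.inter
    obtain ⟨γ, hγ, hγi, rfl, rfl, rfl⟩ := hAB.left
    obtain ⟨t, ht, rfl⟩ := hyA
    -- parameters for which the curve is close to `γ t`
    obtain ⟨η, hη, hηε⟩ := Metric.continuousOn_iff.1 hγ t ht (ε / 2) (half_pos hε)
    have hK : IsCompact (γ '' (Icc 0 1 ∩ {s | η ≤ |s - t|})) := by
      refine (isCompact_Icc.inter_right ?_).image_of_continuousOn (hγ.mono inter_subset_left)
      exact isClosed_le continuous_const (by fun_prop)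
    refine ⟨(γ '' (Icc 0 1 ∩ {s | η ≤ |s - t|}))ᶜ ∩ Bᶜ,
      hK.isClosed.isOpen_compl.inter hBcl.isOpen_compl, ⟨?_, hyB⟩, ?_⟩
    · rintro ⟨s, ⟨hs, hst⟩, e⟩
      rw [hγi hs ht e] at hst
      simp only [mem_ofPred_eq, sub_self, abs_zero] at hst
      linarith
    have hpar : ∀ a ∈ (γ '' Icc 0 1 ∪ B) ∩ ((γ '' (Icc 0 1 ∩ {s | η ≤ |s - t|}))ᶜ ∩ Bᶜ),
        ∃ s ∈ Ioo (0 : ℝ) 1, |s - t| < η ∧ γ s = a := by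
      rintro a ⟨ha | ha, ha1, ha2⟩
      · obtain ⟨s, hs, rfl⟩ := ha
        refine ⟨s, ⟨lt_of_le_of_ne hs.1 ?_, lt_of_le_of_ne hs.2 ?_⟩, ?_, rfl⟩
        · rintro rfl
          exact ha2 hB.left_mem
        · rintro rfl
          exact ha2 hB.right_mem
        · by_contra hle
          exact ha1 ⟨s, ⟨hs, not_lt.1 hle⟩, rfl⟩
      · exact absurd ha ha2
    have main : ∀ s ∈ Ioo (0 : ℝ) 1, ∀ s' ∈ Ioo (0 : ℝ) 1, s < s' →
        ∃ B', IsArcPair (γ '' Icc s s') B' (γ s) (γ s') ∧ γ '' Icc s s' ∪ B' = γ '' Icc 0 1 ∪ B := by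
      intro s hs s' hs' hss'
      have i0 : Icc 0 s ⊆ Icc (0 : ℝ) 1 := Icc_subset_Icc_right hs.2.le
      have i1 : Icc s s' ⊆ Icc (0 : ℝ) 1 := Icc_subset_Icc hs.1.le hs'.2.le
      have i2 : Icc s' 1 ⊆ Icc (0 : ℝ) 1 := Icc_subset_Icc_left hs'.1.le
      have a0 := isArc_of_Icc hs.1 (hγ.mono i0) (hγi.mono i0)
      have a1 := isArc_of_Icc hss' (hγ.mono i1) (hγi.mono i1)
      have a2 := isArc_of_Icc hs'.2 (hγ.mono i2) (hγi.mono i2)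
      have hBγ : ∀ r ∈ Icc (0 : ℝ) 1, γ r ∈ B → r = 0 ∨ r = 1 := by
        intro r hr hrB
        rcases hin ⟨⟨r, hr, rfl⟩, hrB⟩ with e | e
        · exact Or.inl (hγi hr (by simp) e)
        · exact Or.inr (hγi hr (by simp) e)
      have c1 : IsArc (γ '' Icc 0 s ∪ B) (γ s) (γ 1) := by
        refine a0.symm.concat hB ?_
        rintro _ ⟨⟨r, hr, rfl⟩, hrB⟩
        rcases hBγ r (i0 hr) hrB with rfl | rfl
        · rfl
        · exact absurd hr.2 (not_le.2 hs.2)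
      have c2 : IsArc ((γ '' Icc 0 s ∪ B) ∪ γ '' Icc s' 1) (γ s) (γ s') := by
        refine c1.concat a2.symm ?_
        rintro _ ⟨hx, r, hr, rfl⟩
        rcases hx with ⟨r', hr', e⟩ | hx
        · rw [hγi (i0 hr') (i2 hr) e] at hr'
          exact absurd (hr.1.trans hr'.2) (not_le.2 hss')
        · rcases hBγ r (i2 hr) hx with rfl | rfl
          · exact absurd hr.1 (not_le.2 hs'.1)
          · rfl
      refine ⟨_, ⟨a1, c2, ?_⟩, ?_⟩
      · rintro _ ⟨⟨r, hr, rfl⟩, (⟨r', hr', e⟩ | hx) | ⟨r', hr', e⟩⟩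
        · rw [hγi (i0 hr') (i1 hr) e] at hr'
          exact Or.inl (by rw [le_antisymm hr'.2 hr.1])
        · rcases hBγ r (i1 hr) hx with rfl | rfl
          · exact absurd hr.1 (not_le.2 hs.1)
          · exact absurd hr.2 (not_le.2 hs'.2)
        · rw [hγi (i2 hr') (i1 hr) e] at hr'
          exact Or.inr (by rw [le_antisymm hr.2 hr'.1]; rfl)
      · have : Icc (0 : ℝ) 1 = Icc 0 s ∪ Icc s s' ∪ Icc s' 1 := by
          rw [Icc_union_Icc_eq_Icc hs.1.le hss'.le, Icc_union_Icc_eq_Icc hs'.1.le hs'.2.le]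
        rw [this, image_union, image_union]
        ext x
        simp only [mem_union]
        tauto
    have hdist : ∀ s ∈ Ioo (0 : ℝ) 1, |s - t| < η → ∀ s' ∈ Ioo (0 : ℝ) 1, |s' - t| < η →
        ∀ r ∈ Icc s s', ∀ s₀ ∈ Ioo (0 : ℝ) 1, |s₀ - t| < η → dist (γ r) (γ s₀) < ε := by
      intro s hs hst s' hs' hst' r hr s₀ hs₀ hst₀
      have h1 := hηε r ⟨hs.1.le.trans hr.1, hr.2.trans hs'.2.le⟩ (by
        rw [Real.dist_eq, abs_lt]
        rw [abs_lt] at hst hst'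
        constructor <;> linarith [hr.1, hr.2])
      have h2 := hηε s₀ ⟨hs₀.1.le, hs₀.2.le⟩ (by rwa [Real.dist_eq])
      linarith [dist_triangle_right (γ r) (γ s₀) (γ t)]
    intro a ha b hb hab
    obtain ⟨s, hs, hst, rfl⟩ := hpar a ha
    obtain ⟨s', hs', hst', rfl⟩ := hpar b hb
    rcases lt_trichotomy s s' with h | h | h
    · obtain ⟨B', h1, h2⟩ := main s hs s' hs' h
      refine ⟨_, B', h1, h2, ?_⟩
      rintro _ ⟨r, hr, rfl⟩
      exact hdist s hs hst s' hs' hst' r hr s hs hst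
    · exact absurd (by rw [h]) hab
    · obtain ⟨B', h1, h2⟩ := main s' hs' s hs h
      refine ⟨_, B', h1.symm, h2, ?_⟩
      rintro _ ⟨r, hr, rfl⟩
      exact hdist s' hs' hst' s hs hst r hr s hs hst
  choose O hO hyO hOp using hloc
  obtain ⟨δ, hδ, hL⟩ := lebesgue_number_lemma_of_metric hJ.isCompact hO
    (fun y hy => mem_iUnion.2 ⟨⟨y, hy⟩, hyO ⟨y, hy⟩⟩)
  refine ⟨δ, hδ, fun a ha b hb hab hd => ?_⟩
  obtain ⟨y, hy⟩ := hL a ha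
  exact hOp y a ⟨ha, hy (mem_ball_self hδ)⟩ b ⟨hb, hy (by rwa [mem_ball, dist_comm])⟩ hab

/-- A small crosscut cuts off a small domain. -/
lemma IsJordanDomain.exists_small_theta [JordanSurface M] [PreconnectedSpace M] [CompactSpace M]
    (hF : IsJordanDomain F) {ε : ℝ} (hε : 0 < ε) :
    ∃ δ > 0, ∀ c a b, IsCrosscut F c a b → (∀ p ∈ c, ∀ q ∈ c, dist p q < δ) →
      ∃ A B E L, IsArcPair A B a b ∧ A ∪ B = frontier F ∧ IsTheta F c A B E L ∧
        ∀ p ∈ E, ∀ q ∈ E, dist p q < ε := by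
  obtain ⟨u, hu, v, hv, huv⟩ := hF.isJordan.nontrivial
  obtain ⟨η, hη, hsm⟩ := exists_small_disc (M := M) (lt_min hε (dist_pos.2 huv))
  obtain ⟨δ, hδ, harc⟩ := hF.isJordan.exists_small_arc hη
  refine ⟨min δ η, lt_min hδ hη, fun c a b hc hcd => ?_⟩
  have hac := hc.isArc.left_mem
  have hbc := hc.isArc.right_mem
  obtain ⟨A, B, hAB, hJ, hA⟩ := harc a hc.left_mem b hc.right_mem hc.isArc.ne
    ((hcd a hac b hbc).trans_le (min_le_left _ _))
  obtain ⟨E, L, hth⟩ := hF.exists_theta hAB hJ hc.isArc hc.sub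
  refine ⟨A, B, E, L, hAB, hJ, hth, ?_⟩
  obtain ⟨D, hD, hDd, hDc⟩ := hsm a
  have hfr : frontier E ⊆ D := by
    rw [hth.frontier_left]
    refine union_subset (fun p hp => hD (hA p hp)) fun p hp => hD ?_
    exact (hcd p hp a hac).trans_le (min_le_right _ _)
  have hED : E ⊆ D := by
    by_contra hne
    obtain ⟨z, hzE, hzD⟩ := not_subset.1 hne
    have hsub : Dᶜ ⊆ E := hth.left.isFace.subset_of_isPreconnected hDc
      (disjoint_left.2 fun x hx hx' => hx (hfr hx')) ⟨z, hzD, hzE⟩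
    have hfD : frontier F ⊆ D := fun x hx => by
      by_contra hxD
      have : x ∈ F \ c := hth.union ▸ Or.inl (hsub hxD)
      exact hF.notMem_of_mem_frontier hx this.1
    exact absurd (hDd u (hfD hu) v (hfD hv)) (not_lt.2 (min_le_right _ _))
  exact fun p hp q hq => (hDd p (hED hp) q (hED hq)).trans_le (min_le_left _ _)

end Crosscut

/-! ### Matched cell decompositions -/

/-- The part of a matching of cell decompositions that concerns the first space: the cells
`F p`, `p ∈ P`, are disjoint Jordan domains whose closures cover the space, and `g` carries the
complement of the cells into the complement of the cells `F' p`, boundary to boundary. -/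
structure IsHalfMatching {M M' ι : Type*} [TopologicalSpace M] [TopologicalSpace M']
    (P : Set ι) (F : ι → Set M) (F' : ι → Set M') (g : M → M') (g' : M' → M) : Prop where
  jordan : ∀ p ∈ P, IsJordanDomain (F p)
  disjoint : ∀ p ∈ P, ∀ q ∈ P, p ≠ q → Disjoint (F p) (F q)
  cover : ∀ x, ∃ p ∈ P, x ∈ closure (F p)
  maps : ∀ x, (∀ p ∈ P, x ∉ F p) → ∀ p ∈ P, g x ∉ F' p
  left_inv : ∀ x, (∀ p ∈ P, x ∉ F p) → g' (g x) = x
  cont : ContinuousOn g {x | ∀ p ∈ P, x ∉ F p}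
  frontier : ∀ p ∈ P, g '' frontier (F p) = frontier (F' p)

/-- Two finite cell decompositions with matching cells and graphs. -/
structure CellMatching (M M' : Type*) [TopologicalSpace M] [TopologicalSpace M'] where
  cells : Set (Set M × Set M')
  toFun : M → M'
  invFun : M' → M
  finite : cells.Finite
  left : IsHalfMatching cells Prod.fst Prod.snd toFun invFun
  right : IsHalfMatching cells Prod.snd Prod.fst invFun toFun

section Half
variable {M M' ι : Type*} [TopologicalSpace M] [TopologicalSpace M']

lemma IsArc.exists_inverse_maps [T2Space M] [T2Space M'] {c : Set M} {c' : Set M'} {a b : M}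
    {a' b' : M'} (hc : IsArc c a b) (hc' : IsArc c' a' b') :
    ∃ (h : M → M') (h' : M' → M), ContinuousOn h c ∧ ContinuousOn h' c' ∧ MapsTo h c c' ∧
      MapsTo h' c' c ∧ (∀ x ∈ c, h' (h x) = x) ∧ (∀ y ∈ c', h (h' y) = y) ∧ h a = a' ∧ h b = b' ∧
      h' a' = a ∧ h' b' = b := by
  obtain ⟨γ, hγ, hi, h0, h1, e⟩ := hc
  obtain ⟨γ', hγ', hi', h0', h1', e'⟩ := hc'
  obtain ⟨u, hu, hu'⟩ := exists_arc_inverse hγ hi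
  obtain ⟨v, hv, hv'⟩ := exists_arc_inverse hγ' hi'
  have mu : MapsTo u (γ '' Icc 0 1) (Icc 0 1) := by
    rintro _ ⟨t, ht, rfl⟩; rw [hu' t ht]; exact ht
  have mv : MapsTo v (Set.image γ' (Icc 0 1)) (Icc 0 1) := by
    rintro _ ⟨t, ht, rfl⟩; rw [hv' t ht]; exact ht
  have i0 : (0 : ℝ) ∈ Icc (0 : ℝ) 1 := by simp
  have i1 : (1 : ℝ) ∈ Icc (0 : ℝ) 1 := by simp
  subst e e' h0 h1 h0' h1'
  refine ⟨γ' ∘ u, γ ∘ v, hγ'.comp hu mu, hγ.comp hv mv, fun x hx => mem_image_of_mem _ (mu hx),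
    fun x hx => mem_image_of_mem _ (mv hx), ?_, ?_, ?_, ?_, ?_, ?_⟩
  · rintro _ ⟨t, ht, rfl⟩; simp [hu' t ht, hv' t ht]
  · rintro _ ⟨t, ht, rfl⟩; simp [hu' t ht, hv' t ht]
  all_goals simp [hu' 0 i0, hu' 1 i1, hv' 0 i0, hv' 1 i1]

variable {P : Set ι} {F : ι → Set M} {F' : ι → Set M'} {g G : M → M'} {g' G' : M' → M}
  {p q₁ q₂ : ι} {c A B : Set M} {c' A' B' : Set M'} {a b : M}

lemma IsHalfMatching.image {κ : Type*} {f : κ → ι} {Q : Set κ}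
    (h : IsHalfMatching Q (F ∘ f) (F' ∘ f) g g') : IsHalfMatching (f '' Q) F F' g g' := by
  refine ⟨?_, ?_, ?_, ?_, ?_, ?_, ?_⟩
  · rintro _ ⟨p, hp, rfl⟩; exact h.jordan p hp
  · rintro _ ⟨p, hp, rfl⟩ _ ⟨q, hq, rfl⟩ hpq; exact h.disjoint p hp q hq fun e => hpq (e ▸ rfl)
  · intro x; obtain ⟨p, hp, hx⟩ := h.cover x; exact ⟨f p, ⟨p, hp, rfl⟩, hx⟩
  · rintro x hx _ ⟨p, hp, rfl⟩; exact h.maps x (fun q hq => hx _ ⟨q, hq, rfl⟩) p hp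
  · exact fun x hx => h.left_inv x fun q hq => hx _ ⟨q, hq, rfl⟩
  · exact h.cont.mono fun x hx q hq => hx _ ⟨q, hq, rfl⟩
  · rintro _ ⟨p, hp, rfl⟩; exact h.frontier p hp

lemma IsHalfMatching.frontier_subset (h : IsHalfMatching P F F' g g') (hp : p ∈ P) {x : M}
    (hx : x ∈ _root_.frontier (F p)) : ∀ q ∈ P, x ∉ F q := by
  intro q hq hxq
  rcases eq_or_ne p q with rfl | hpq
  · exact disjoint_left.1 (h.jordan p hp).isOpen.disjoint_frontier' hxq hx
  · exact disjoint_left.1 ((h.disjoint p hp q hq hpq).closure_left (h.jordan q hq).isOpen)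
      (frontier_subset_closure hx) hxq

lemma IsHalfMatching.split_graph (h : IsHalfMatching P F F' g g') (hp : p ∈ P)
    (hu : F q₁ ∪ F q₂ = F p \ c) (hc : c ⊆ closure (F p)) (x : M) :
    (∀ q ∈ insert q₁ (insert q₂ (P \ {p})), x ∉ F q) ↔ (∀ q ∈ P, x ∉ F q) ∨ x ∈ c := by
  have hu' : x ∈ F q₁ ∨ x ∈ F q₂ ↔ x ∈ F p ∧ x ∉ c := by
    rw [← mem_union, hu]; rfl
  constructor
  · intro hx
    by_cases hxc : x ∈ c
    · exact Or.inr hxc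
    refine Or.inl fun q hq hxq => ?_
    rcases eq_or_ne q p with rfl | hqp
    · rcases hu'.2 ⟨hxq, hxc⟩ with h1 | h1
      · exact hx q₁ (by simp) h1
      · exact hx q₂ (by simp) h1
    · exact hx q (by simp [hq, hqp]) hxq
  · intro hx q hq hxq
    have key : x ∈ F p → x ∉ c → False := fun h1 h2 => by
      rcases hx with hx | hx
      · exact hx p hp h1
      · exact h2 hx
    rcases hq with rfl | rfl | ⟨hq, hqp⟩
    · exact key (hu'.1 (Or.inl hxq)).1 (hu'.1 (Or.inl hxq)).2
    · exact key (hu'.1 (Or.inr hxq)).1 (hu'.1 (Or.inr hxq)).2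
    · rcases hx with hx | hx
      · exact hx q hq hxq
      · exact disjoint_left.1 ((h.disjoint q hq p hp hqp).closure_right (h.jordan q hq).isOpen)
          hxq (hc hx)

lemma IsHalfMatching.split [T2Space M] (h : IsHalfMatching P F F' g g')
    (h' : IsHalfMatching P F' F g' g) (hp : p ∈ P)
    (hθ : IsTheta (F p) c A B (F q₁) (F q₂)) (hθ' : IsTheta (F' p) c' A' B' (F' q₁) (F' q₂))
    (hc : IsClosed c) (hcF : c ⊆ closure (F p)) (hcF' : c' ⊆ closure (F' p))
    (hG : ∀ x, (∀ p ∈ P, x ∉ F p) → G x = g x) (hG' : ∀ x, (∀ p ∈ P, x ∉ F' p) → G' x = g' x)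
    (hGc : ContinuousOn G c) (hGm : MapsTo G c c') (hGi : ∀ x ∈ c, G' (G x) = x)
    (hGA : G '' A = A') (hGB : G '' B = B') (hGC : G '' c = c') :
    IsHalfMatching (insert q₁ (insert q₂ (P \ {p}))) F F' G G' := by
  have s1 : F q₁ ⊆ F p := fun x hx => (hθ.union.subset (Or.inl hx)).1
  have s2 : F q₂ ⊆ F p := fun x hx => (hθ.union.subset (Or.inr hx)).1
  have hgr := h.split_graph hp hθ.union hcF
  have hgr' := h'.split_graph hp hθ'.union hcF'
  refine ⟨?_, ?_, ?_, ?_, ?_, ?_, ?_⟩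
  · rintro q (rfl | rfl | hq)
    · exact hθ.left
    · exact hθ.right
    · exact h.jordan q hq.1
  · have d : ∀ q ∈ P \ {p}, Disjoint (F q) (F p) := fun q hq => h.disjoint q hq.1 p hp hq.2
    rintro q (rfl | rfl | hq) r (rfl | rfl | hr) hqr
    · exact absurd rfl hqr
    · exact hθ.disjoint
    · exact (d r hr).symm.mono_left s1
    · exact hθ.disjoint.symm
    · exact absurd rfl hqr
    · exact (d r hr).symm.mono_left s2
    · exact (d q hq).mono_right s1
    · exact (d q hq).mono_right s2
    · exact h.disjoint q hq.1 r hr.1 hqr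
  · intro x
    obtain ⟨q, hq, hx⟩ := h.cover x
    rcases eq_or_ne q p with rfl | hqp
    · have : F q ⊆ closure (F q₁) ∪ closure (F q₂) := by
        intro y hy
        by_cases hyc : y ∈ c
        · exact Or.inl (frontier_subset_closure (hθ.frontier_left.symm.subset (Or.inr hyc)))
        · rcases hθ.union.symm.subset ⟨hy, hyc⟩ with h1 | h1
          · exact Or.inl (subset_closure h1)
          · exact Or.inr (subset_closure h1)
      rcases closure_minimal this (isClosed_closure.union isClosed_closure) hx with h1 | h1
      · exact ⟨q₁, by simp, h1⟩
      · exact ⟨q₂, by simp, h1⟩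
    · exact ⟨q, by simp [hq, hqp], hx⟩
  · intro x hx
    refine (hgr' _).2 ?_
    rcases (hgr x).1 hx with h1 | h1
    · rw [hG x h1]; exact Or.inl (h.maps x h1)
    · exact Or.inr (hGm h1)
  · intro x hx
    rcases (hgr x).1 hx with h1 | h1
    · rw [hG x h1, hG' _ (h.maps x h1), h.left_inv x h1]
    · exact hGi x h1
  · have e : {x | ∀ q ∈ insert q₁ (insert q₂ (P \ {p})), x ∉ F q} = {x | ∀ q ∈ P, x ∉ F q} ∪ c := by
      ext x; exact hgr x
    have hcl : IsClosed {x | ∀ q ∈ P, x ∉ F q} := by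
      have : {x | ∀ q ∈ P, x ∉ F q} = (⋃ q ∈ P, F q)ᶜ := by ext; simp
      rw [this]
      exact (isOpen_biUnion fun q hq => (h.jordan q hq).isOpen).isClosed_compl
    rw [e]
    exact (h.cont.congr fun x hx => hG x hx).union_of_isClosed hGc hcl hc
  · rintro q (rfl | rfl | hq)
    · rw [hθ.frontier_left, hθ'.frontier_left, image_union, hGA, hGC]
    · rw [hθ.frontier_right, hθ'.frontier_right, image_union, hGB, hGC]
    · rw [← h.frontier q hq.1]
      exact image_congr fun x hx => hG x (h.frontier_subset hq.1 hx)

end Half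

namespace CellMatching

section Defs
variable {M M' : Type*} [TopologicalSpace M] [TopologicalSpace M']

/-- The complement of the cells in the first space. -/
def graph (S : CellMatching M M') : Set M := {x | ∀ p ∈ S.cells, x ∉ p.1}

/-- Each cell of `T` lies in a cell of `S`. -/
def Refines (T S : CellMatching M M') : Prop :=
  ∀ q ∈ T.cells, ∃ p ∈ S.cells, q.1 ⊆ p.1 ∧ q.2 ⊆ p.2

lemma Refines.refl (S : CellMatching M M') : S.Refines S :=
  fun q hq => ⟨q, hq, subset_rfl, subset_rfl⟩

lemma Refines.trans {S T U : CellMatching M M'} (h : U.Refines T) (h' : T.Refines S) :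
    U.Refines S := fun q hq => by
  obtain ⟨p, hp, h1, h2⟩ := h q hq
  obtain ⟨r, hr, h3, h4⟩ := h' p hp
  exact ⟨r, hr, h1.trans h3, h2.trans h4⟩

lemma Refines.graph_subset {S T : CellMatching M M'} (h : T.Refines S) : S.graph ⊆ T.graph :=
  fun x hx q hq hxq => by
    obtain ⟨p, hp, h1, -⟩ := h q hq
    exact hx p hp (h1 hxq)

/-- The matching with the two spaces exchanged. -/
def swap (S : CellMatching M M') : CellMatching M' M where
  cells := Prod.swap '' S.cells
  toFun := S.invFun
  invFun := S.toFun
  finite := S.finite.image _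
  left := S.right.image (f := Prod.swap)
  right := S.left.image (f := Prod.swap)

lemma swap_cells (S : CellMatching M M') {p : Set M × Set M'} (hp : p ∈ S.cells) :
    p.swap ∈ S.swap.cells := ⟨p, hp, rfl⟩

lemma mem_of_swap (S : CellMatching M M') {p : Set M' × Set M} (hp : p ∈ S.swap.cells) :
    p.swap ∈ S.cells := by
  obtain ⟨q, hq, rfl⟩ := hp; exact hq

lemma isClosed_graph (S : CellMatching M M') : IsClosed S.graph := by
  have : S.graph = (⋃ q ∈ S.cells, q.1)ᶜ := by ext; simp [graph]
  rw [this]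
  exact (isOpen_biUnion fun q hq => (S.left.jordan q hq).isOpen).isClosed_compl

lemma frontier_subset_graph (S : CellMatching M M') {p : Set M × Set M'} (hp : p ∈ S.cells) :
    frontier p.1 ⊆ S.graph := fun _ hx => S.left.frontier_subset hp hx

lemma isFace (S : CellMatching M M') {p : Set M × Set M'} (hp : p ∈ S.cells) :
    IsFace S.graph p.1 :=
  ⟨(S.left.jordan p hp).isOpen, S.frontier_subset_graph hp,
    disjoint_left.2 fun _ hx hx' => hx' p hp hx⟩

lemma exists_cell (S : CellMatching M M') {x : M} (hx : x ∉ S.graph) :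
    ∃ p ∈ S.cells, x ∈ p.1 := by
  by_contra! h
  exact hx fun p hp => h p hp

end Defs

section Split
variable {M M' : Type*} [MetricSpace M] [MetricSpace M'] [JordanSurface M] [JordanSurface M']
  [PreconnectedSpace M] [PreconnectedSpace M']

/-- A crosscut of a cell subdivides the cell and its counterpart. -/
lemma exists_split (S : CellMatching M M') {p : Set M × Set M'} (hp : p ∈ S.cells) {c : Set M}
    {a b : M} (hc : IsCrosscut p.1 c a b) :
    ∃ T : CellMatching M M', T.Refines S ∧ T.graph = S.graph ∪ c := by
  classical
  have hF := S.left.jordan p hp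
  have hF' := S.right.jordan p hp
  obtain ⟨A, B, F₁, F₂, hAB, eAB, hθ⟩ := hc.exists_theta hF
  have gr : ∀ x ∈ frontier p.1, ∀ q ∈ S.cells, x ∉ q.1 := fun x hx => S.left.frontier_subset hp hx
  have hinj : InjOn S.toFun (frontier p.1) := fun x hx y hy e => by
    rw [← S.left.left_inv x (gr x hx), e, S.left.left_inv y (gr y hy)]
  have hAB' : IsArcPair (S.toFun '' A) (S.toFun '' B) (S.toFun a) (S.toFun b) :=
    hAB.image (S.left.cont.mono (eAB.subset.trans gr)) (hinj.mono eAB.subset)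
  have eAB' : S.toFun '' A ∪ S.toFun '' B = frontier p.2 := by
    rw [← image_union, eAB]; exact S.left.frontier p hp
  obtain ⟨c', hc'⟩ := hF'.exists_crosscut (eAB'.subset (Or.inl hAB'.left.left_mem))
    (eAB'.subset (Or.inl hAB'.left.right_mem)) hAB'.left.ne
  obtain ⟨F₁', F₂', hθ'⟩ := hF'.exists_theta hAB' eAB' hc'.isArc hc'.sub
  obtain ⟨h, h', hh, hh', hm, hm', hi, hi', ha, hb, ha', hb'⟩ := hc.isArc.exists_inverse_maps hc'.isArc
  have hcF : c ⊆ closure p.1 := fun x hx => by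
    by_cases hx' : x ∈ ({a, b} : Set M)
    · rcases hx' with rfl | rfl
      · exact frontier_subset_closure hc.left_mem
      · exact frontier_subset_closure hc.right_mem
    · exact subset_closure (hc.sub ⟨hx, hx'⟩)
  have hcF' : c' ⊆ closure p.2 := fun x hx => by
    by_cases hx' : x ∈ ({S.toFun a, S.toFun b} : Set M')
    · rcases hx' with rfl | rfl
      · exact frontier_subset_closure hc'.left_mem
      · exact frontier_subset_closure hc'.right_mem
    · exact subset_closure (hc'.sub ⟨hx, hx'⟩)
  set G : M → M' := fun x => if x ∈ c then h x else S.toFun x with hG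
  set G' : M' → M := fun y => if y ∈ c' then h' y else S.invFun y with hG'
  have Gc : ∀ x ∈ c, G x = h x := fun x hx => if_pos hx
  have Gc' : ∀ x ∈ c', G' x = h' x := fun x hx => if_pos hx
  have Gg : ∀ x, (∀ q ∈ S.cells, x ∉ q.1) → G x = S.toFun x := fun x hx => by
    by_cases hxc : x ∈ c
    · rw [Gc x hxc]
      by_cases hx' : x ∈ ({a, b} : Set M)
      · rcases hx' with rfl | rfl
        · exact ha
        · exact hb
      · exact absurd (hc.sub ⟨hxc, hx'⟩) (hx p hp)
    · exact if_neg hxc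
  have Gg' : ∀ x, (∀ q ∈ S.cells, x ∉ q.2) → G' x = S.invFun x := fun x hx => by
    by_cases hxc : x ∈ c'
    · rw [Gc' x hxc]
      by_cases hx' : x ∈ ({S.toFun a, S.toFun b} : Set M')
      · rcases hx' with rfl | rfl
        · rw [ha', S.left.left_inv _ (gr _ hc.left_mem)]
        · rw [hb', S.left.left_inv _ (gr _ hc.right_mem)]
      · exact absurd (hc'.sub ⟨hxc, hx'⟩) (hx p hp)
    · exact if_neg hxc
  have hGm : MapsTo G c c' := fun x hx => by rw [Gc x hx]; exact hm hx
  have hGm' : MapsTo G' c' c := fun x hx => by rw [Gc' x hx]; exact hm' hx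
  have hGi : ∀ x ∈ c, G' (G x) = x := fun x hx => by
    rw [Gc x hx, Gc' _ (hm hx), hi x hx]
  have hGi' : ∀ x ∈ c', G (G' x) = x := fun x hx => by
    rw [Gc' x hx, Gc _ (hm' hx), hi' x hx]
  have inv : ∀ X ⊆ frontier p.1, G '' X = S.toFun '' X ∧ G' '' (S.toFun '' X) = X := fun X hX => by
    refine ⟨image_congr fun x hx => Gg x (gr x (hX hx)), ?_⟩
    rw [image_image]
    conv_rhs => rw [← image_id X]
    refine image_congr fun x hx => ?_
    rw [Gg' _ (S.left.maps x (gr x (hX hx))), S.left.left_inv x (gr x (hX hx))]; rfl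
  have hAf : A ⊆ frontier p.1 := eAB ▸ subset_union_left
  have hBf : B ⊆ frontier p.1 := eAB ▸ subset_union_right
  refine ⟨⟨insert (F₁, F₁') (insert (F₂, F₂') (S.cells \ {p})), G, G',
    ((S.finite.subset sdiff_subset).insert _).insert _, ?_, ?_⟩, ?_, ?_⟩
  · exact S.left.split S.right hp hθ hθ' hc.isArc.isClosed hcF hcF' Gg Gg' (hh.congr Gc) hGm hGi
      (inv A hAf).1 (inv B hBf).1
      (hGm.image_subset.antisymm fun y hy => ⟨G' y, hGm' hy, hGi' y hy⟩)
  · exact S.right.split S.left hp hθ' hθ hc'.isArc.isClosed hcF' hcF Gg' Gg (hh'.congr Gc') hGm' hGi'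
      (inv A hAf).2 (inv B hBf).2
      (hGm'.image_subset.antisymm fun y hy => ⟨G y, hGm hy, hGi y hy⟩)
  · rintro q (rfl | rfl | hq)
    · exact ⟨p, hp, fun x hx => (hθ.union.subset (Or.inl hx)).1,
        fun x hx => (hθ'.union.subset (Or.inl hx)).1⟩
    · exact ⟨p, hp, fun x hx => (hθ.union.subset (Or.inr hx)).1,
        fun x hx => (hθ'.union.subset (Or.inr hx)).1⟩
    · exact ⟨q, hq.1, subset_rfl, subset_rfl⟩
  · ext x
    exact S.left.split_graph (q₁ := (F₁, F₁')) (q₂ := (F₂, F₂')) hp hθ.union hcF x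

end Split

end CellMatching

/-! ### The unit circle and the initial matching -/

/-- The standard parametrization of the unit circle, of period `1`. -/
noncomputable def circ (t : ℝ) : ℂ := Complex.exp ((2 * Real.pi * t : ℝ) * Complex.I)

lemma continuous_circ : Continuous circ := by unfold circ; fun_prop

lemma circ_eq_iff {s t : ℝ} : circ s = circ t ↔ ∃ n : ℤ, s = t + n := by
  unfold circ
  rw [Complex.exp_eq_exp_iff_exists_int]
  refine exists_congr fun n => ?_
  have hpi : (Real.pi : ℂ) ≠ 0 := by exact_mod_cast Real.pi_ne_zero
  constructor
  · intro h
    have h2 : ((s : ℂ) - (t + n)) * (2 * Real.pi * Complex.I) = 0 := by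
      push_cast at h; linear_combination h
    rcases mul_eq_zero.1 h2 with h3 | h3
    · exact_mod_cast sub_eq_zero.1 h3
    · simp [hpi, Complex.I_ne_zero] at h3
  · rintro rfl
    push_cast; ring

lemma norm_circ (t : ℝ) : ‖circ t‖ = 1 := Complex.norm_exp_ofReal_mul_I _

lemma circ_add_int (t : ℝ) (n : ℤ) : circ (t + n) = circ t := circ_eq_iff.2 ⟨n, rfl⟩

lemma exists_circ_eq {z : ℂ} (hz : z ∈ sphere (0 : ℂ) 1) (t₀ : ℝ) :
    ∃ t ∈ Ico t₀ (t₀ + 1), circ t = z := by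
  have h1 : ‖z‖ = 1 := by simpa using hz
  have h2 : circ (Complex.arg z / (2 * Real.pi)) = z := by
    unfold circ
    have : (2 * Real.pi * (Complex.arg z / (2 * Real.pi)) : ℝ) = Complex.arg z := by
      field_simp
    rw [this]
    have := Complex.norm_mul_exp_arg_mul_I z
    rwa [h1, Complex.ofReal_one, one_mul] at this
  set s := Complex.arg z / (2 * Real.pi)
  refine ⟨t₀ + Int.fract (s - t₀), ⟨by linarith [Int.fract_nonneg (s - t₀)],
    by linarith [Int.fract_lt_one (s - t₀)]⟩, ?_⟩
  rw [← h2, circ_eq_iff]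
  exact ⟨-⌊s - t₀⌋, by rw [Int.fract]; push_cast; ring⟩

lemma injOn_circ {u v : ℝ} (h : v - u < 1) : InjOn circ (Icc u v) := by
  intro s hs t ht e
  obtain ⟨n, hn⟩ := circ_eq_iff.1 e
  have h1 : (n : ℝ) < 1 := by linarith [hs.2, ht.1]
  have h2 : (-1 : ℝ) < n := by linarith [hs.1, ht.2]
  have h3 : n < 1 := by exact_mod_cast h1
  have h4 : -1 < n := by exact_mod_cast h2
  have : n = 0 := by omega
  simpa [this] using hn

lemma IsOpen.forall_notMem_iff_mem_frontier {X : Type*} [TopologicalSpace X] {D : Set X}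
    (hD : IsOpen D) (x : X) :
    (∀ p ∈ (univ : Set Bool), x ∉ (if p then D else (closure D)ᶜ)) ↔ x ∈ frontier D := by
  rw [hD.frontier_eq]
  simp [and_comm]

section Init
variable {M M' : Type*}

lemma isJordanCurve_circle [TopologicalSpace M] {φ : ℂ → M} (hφ : Continuous φ)
    (hi : Function.Injective φ) : IsJordanCurve (φ '' sphere 0 1) := by
  have hc : Continuous fun t => φ (circ t) := hφ.comp continuous_circ
  have arc : ∀ u v : ℝ, u < v → v - u < 1 →
      IsArc ((fun t => φ (circ t)) '' Icc u v) (φ (circ u)) (φ (circ v)) := fun u v h h' =>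
    isArc_of_Icc (γ := fun t => φ (circ t)) h hc.continuousOn
      fun s hs t ht e => injOn_circ h' hs ht (hi e)
  refine ⟨_, (fun t => φ (circ t)) '' Icc (1 / 2) 1, _, _,
    ⟨arc 0 (1 / 2) (by norm_num) (by norm_num), ?_, ?_⟩, ?_⟩
  · have := (arc (1 / 2) 1 (by norm_num) (by norm_num)).symm
    have e : circ 1 = circ 0 := by simpa using circ_add_int 0 1
    rwa [e] at this
  · rintro _ ⟨⟨t, ht, rfl⟩, ⟨s, hs, e⟩⟩
    rcases eq_or_lt_of_le hs.2 with h1 | h1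
    · left
      have : circ s = circ 0 := by rw [h1]; simpa using circ_add_int 0 1
      change φ (circ t) = φ (circ 0)
      rw [← this]; exact e.symm
    · right
      have : s = t := injOn_circ (u := min s t) (v := max s t)
        (by rcases max_cases s t with h | h <;> rcases min_cases s t with h' | h' <;>
              linarith [hs.1, ht.1, ht.2]) ⟨min_le_left _ _, le_max_left _ _⟩
        ⟨min_le_right _ _, le_max_right _ _⟩ (hi e)
      have : t = 1 / 2 := le_antisymm ht.2 (this ▸ hs.1)
      simp [this]
  · refine Subset.antisymm ?_ ?_
    · rintro _ (⟨t, -, rfl⟩ | ⟨t, -, rfl⟩) <;> exact ⟨_, by simp [norm_circ], rfl⟩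
    · rintro _ ⟨z, hz, rfl⟩
      obtain ⟨t, ht, rfl⟩ := exists_circ_eq hz 0
      rcases le_total t (1 / 2) with h | h
      · exact Or.inl ⟨t, ⟨ht.1, h⟩, rfl⟩
      · exact Or.inr ⟨t, ⟨h, by linarith [ht.2]⟩, rfl⟩

lemma exists_jordanDomain [TopologicalSpace M] [T2Space M] [JordanSurface M] [ConnectedSpace M] :
    ∃ D : Set M, IsJordanDomain D := by
  obtain ⟨x⟩ := ‹ConnectedSpace M›.toNonempty
  obtain ⟨φ, hφ, -⟩ := IsSurface.exists_chart x univ univ_mem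
  have hJ := isJordanCurve_circle hφ.continuous hφ.injective
  have : φ 0 ∉ φ '' sphere 0 1 := by
    rintro ⟨z, hz, e⟩
    rw [hφ.injective e] at hz; simp at hz
  exact ⟨_, hJ.isJordanDomain_component this⟩

lemma IsJordanCurve.exists_homeo [TopologicalSpace M] [TopologicalSpace M'] [T2Space M]
    [T2Space M'] {J : Set M} {J' : Set M'} (hJ : IsJordanCurve J) (hJ' : IsJordanCurve J') :
    ∃ (h : M → M') (h' : M' → M), ContinuousOn h J ∧ ContinuousOn h' J' ∧ MapsTo h J J' ∧
      MapsTo h' J' J ∧ (∀ x ∈ J, h' (h x) = x) ∧ (∀ y ∈ J', h (h' y) = y) := by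
  classical
  obtain ⟨A, B, a, b, hAB, rfl⟩ := hJ
  obtain ⟨A', B', a', b', hAB', rfl⟩ := hJ'
  obtain ⟨f, f', hf, hf', fm, fm', fi, fi', fa, fb, fa', fb'⟩ :=
    hAB.left.exists_inverse_maps hAB'.left
  obtain ⟨g, g', hg, hg', gm, gm', gi, gi', ga, gb, ga', gb'⟩ :=
    hAB.right.exists_inverse_maps hAB'.right
  set h : M → M' := fun x => if x ∈ A then f x else g x with hh
  set h' : M' → M := fun x => if x ∈ A' then f' x else g' x with hh'
  have hA : ∀ x ∈ A, h x = f x := fun x hx => if_pos hx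
  have hA' : ∀ x ∈ A', h' x = f' x := fun x hx => if_pos hx
  have hB : ∀ x ∈ B, h x = g x := fun x hx => by
    by_cases hxA : x ∈ A
    · rw [hA x hxA]
      rcases hAB.inter ⟨hxA, hx⟩ with rfl | rfl
      · rw [fa, ga]
      · rw [fb, gb]
    · exact if_neg hxA
  have hB' : ∀ x ∈ B', h' x = g' x := fun x hx => by
    by_cases hxA : x ∈ A'
    · rw [hA' x hxA]
      rcases hAB'.inter ⟨hxA, hx⟩ with rfl | rfl
      · rw [fa', ga']
      · rw [fb', gb']
    · exact if_neg hxA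
  refine ⟨h, h', (hf.congr hA).union_of_isClosed (hg.congr hB) hAB.left.isClosed
    hAB.right.isClosed, (hf'.congr hA').union_of_isClosed (hg'.congr hB') hAB'.left.isClosed
    hAB'.right.isClosed, ?_, ?_, ?_, ?_⟩
  · rintro x (hx | hx)
    · rw [hA x hx]; exact Or.inl (fm hx)
    · rw [hB x hx]; exact Or.inr (gm hx)
  · rintro x (hx | hx)
    · rw [hA' x hx]; exact Or.inl (fm' hx)
    · rw [hB' x hx]; exact Or.inr (gm' hx)
  · rintro x (hx | hx)
    · rw [hA x hx, hA' _ (fm hx), fi x hx]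
    · rw [hB x hx, hB' _ (gm hx), gi x hx]
  · rintro x (hx | hx)
    · rw [hA' x hx, hA _ (fm' hx), fi' x hx]
    · rw [hB' x hx, hB _ (gm' hx), gi' x hx]

variable [TopologicalSpace M] [TopologicalSpace M'] [T2Space M]
  [JordanSurface M] [PreconnectedSpace M]

lemma IsJordanDomain.isHalfMatching {D : Set M} {D' : Set M'} (hD : IsJordanDomain D)
    (hD' : IsOpen D') (he' : frontier (closure D')ᶜ = frontier D')
    {h : M → M'} {h' : M' → M} (hc : ContinuousOn h (frontier D))
    (hm : MapsTo h (frontier D) (frontier D')) (hm' : MapsTo h' (frontier D') (frontier D))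
    (hi : ∀ x ∈ frontier D, h' (h x) = x) (hi' : ∀ y ∈ frontier D', h (h' y) = y) :
    IsHalfMatching univ (fun i : Bool => if i then D else (closure D)ᶜ)
      (fun i : Bool => if i then D' else (closure D')ᶜ) h h' := by
  obtain ⟨hE, he⟩ := hD.exterior
  have dj : Disjoint D (closure D)ᶜ := disjoint_left.2 fun x hx hx' => hx' (subset_closure hx)
  have hfr : h '' frontier D = frontier D' :=
    hm.image_subset.antisymm fun y hy => ⟨h' y, hm' hy, hi' y hy⟩
  refine ⟨?_, ?_, ?_, ?_, ?_, ?_, ?_⟩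
  · rintro (_ | _) -
    · simpa using hE
    · simpa using hD
  · rintro (_ | _) - (_ | _) - hpq
    · exact absurd rfl hpq
    · simpa using dj.symm
    · simpa using dj
    · exact absurd rfl hpq
  · intro x
    by_cases hx : x ∈ closure D
    · exact ⟨true, trivial, by simpa using hx⟩
    · exact ⟨false, trivial, subset_closure (by simpa using hx)⟩
  · exact fun x hx => (hD'.forall_notMem_iff_mem_frontier _).2 (hm ((hD.isOpen.forall_notMem_iff_mem_frontier x).1 hx))
  · exact fun x hx => hi x ((hD.isOpen.forall_notMem_iff_mem_frontier x).1 hx)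
  · exact hc.mono fun x hx => (hD.isOpen.forall_notMem_iff_mem_frontier x).1 hx
  · rintro (_ | _) -
    · simpa [he, he'] using hfr
    · simpa using hfr

lemma CellMatching.exists_initial [Nonempty M] [T2Space M'] [JordanSurface M'] [ConnectedSpace M'] :
    Nonempty (CellMatching M M') := by
  have : ConnectedSpace M := ⟨inferInstance⟩
  obtain ⟨D, hD⟩ := exists_jordanDomain (M := M)
  obtain ⟨D', hD'⟩ := exists_jordanDomain (M := M')
  obtain ⟨h, h', hc, hc', hm, hm', hi, hi'⟩ := hD.isJordan.exists_homeo hD'.isJordan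
  exact ⟨{
    cells := (fun i : Bool => (if i then D else (closure D)ᶜ, if i then D' else (closure D')ᶜ)) '' univ
    toFun := h
    invFun := h'
    finite := finite_univ.image _
    left := IsHalfMatching.image (F := Prod.fst) (F' := Prod.snd)
      (hD.isHalfMatching hD'.isOpen hD'.exterior.2 hc hm hm' hi hi')
    right := IsHalfMatching.image (F := Prod.snd) (F' := Prod.fst)
      (hD'.isHalfMatching hD.isOpen hD.exterior.2 hc' hm' hm hi' hi) }⟩

end Init

/-! ### Pushing connected sets off crosscuts -/

section Sweep
variable {M : Type*} [MetricSpace M] [JordanSurface M] [PreconnectedSpace M]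
  {F S C c A B E L : Set M} {a b y z : M}

/-- Let `S` be a closed set which near a crosscut `c` coincides with `c`. Two points on the same
side `L` of `c` joined by a connected set `C` can be joined by a connected set that meets `S` only
in points of `C \ c`. -/
lemma IsCrosscut.exists_push (hF : IsJordanDomain F) (hc : IsCrosscut F c a b)
    (hθ : IsTheta F c A B E L) (hS : ∀ w ∈ c \ {a, b}, ∃ O ∈ 𝓝 w, O ∩ S ⊆ c)
    (hC : IsPreconnected C) (hCF : C ⊆ F) (hy : y ∈ C) (hz : z ∈ C) (hyL : y ∈ L) (hzL : z ∈ L) :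
    ∃ C₀ ⊆ F, IsPreconnected C₀ ∧ y ∈ C₀ ∧ z ∈ C₀ ∧ C₀ ∩ S ⊆ (C ∩ S) \ c := by
  by_cases hCc : (C ∩ c).Nonempty
  swap
  · exact ⟨C, hCF, hC, hy, hz, fun x hx => ⟨hx, fun hxc => hCc ⟨x, hx.1, hxc⟩⟩⟩
  obtain ⟨w₀, hw₀C, hw₀c⟩ := hCc
  have hends : ∀ x ∈ F, x ∈ c → x ∈ c \ {a, b} := by
    refine fun x hxF hxc => ⟨hxc, ?_⟩
    rintro (rfl | rfl)
    · exact hF.notMem_of_mem_frontier hc.left_mem hxF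
    · exact hF.notMem_of_mem_frontier hc.right_mem hxF
  have hLc : ∀ x ∈ L, x ∈ F ∧ x ∉ c := fun x hx => hθ.union.subset (Or.inr hx)
  have hcL : ∀ w ∈ c, w ∈ frontier L := fun w hw => hθ.frontier_right.symm.subset (Or.inr hw)
  have hO : ∀ w ∈ c \ {a, b}, ∃ O : Set M, IsOpen O ∧ w ∈ O ∧
      ∀ p ∈ L ∩ O, ∀ q ∈ L ∩ O, ConnIn (L \ S) p q := by
    intro w hw
    obtain ⟨O, hO, hOS⟩ := hS w hw
    obtain ⟨O', hO', hj⟩ := hθ.right.locallyJoinedAt (hcL w hw.1) O hO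
    obtain ⟨O'', h1, h2, h3⟩ := _root_.mem_nhds_iff.1 hO'
    refine ⟨O'', h2, h3, fun p hp q hq => (hj p ⟨hp.1, h1 hp.2⟩ q ⟨hq.1, h1 hq.2⟩).mono ?_⟩
    exact fun x hx => ⟨hx.2, fun hxS => (hLc x hx.2).2 (hOS ⟨hx.1, hxS⟩)⟩
  choose! O hOo hwO hOj using hO
  have hw₀ := hends w₀ (hCF hw₀C) hw₀c
  have hmeet : ∀ w ∈ c, ∀ U : Set M, IsOpen U → w ∈ U → ∃ p, p ∈ L ∧ p ∈ U := fun w hw U hU hwU => by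
    obtain ⟨p, h1, h2⟩ := mem_closure_iff.1 (frontier_subset_closure (hcL w hw)) U hU hwU
    exact ⟨p, h2, h1⟩
  obtain ⟨p₀, hp₀L, hp₀O⟩ := hmeet w₀ hw₀c _ (hOo w₀ hw₀) (hwO w₀ hw₀)
  set κ := connectedComponentIn (L \ S) p₀ with hκ
  have hκs : κ ⊆ L \ S := connectedComponentIn_subset _ _
  have hκw₀ : L ∩ O w₀ ⊆ κ := fun q hq => (hOj w₀ hw₀ p₀ ⟨hp₀L, hp₀O⟩ q hq).mem_component
  have hκall : ∀ w ∈ c \ {a, b}, L ∩ O w ⊆ κ := by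
    by_contra! hno
    obtain ⟨w₁, hw₁, hw₁κ⟩ := hno
    obtain ⟨w, hw, hwU, hwV⟩ := hc.isArc.isPreconnected_interior
      (⋃ w ∈ {w ∈ c \ {a, b} | L ∩ O w ⊆ κ}, O w) (⋃ w ∈ {w ∈ c \ {a, b} | ¬ L ∩ O w ⊆ κ}, O w)
      (isOpen_biUnion fun w hw => hOo w hw.1) (isOpen_biUnion fun w hw => hOo w hw.1)
      (fun w hw => by
        by_cases h : L ∩ O w ⊆ κ
        · exact Or.inl (mem_biUnion (show w ∈ {w ∈ c \ {a, b} | L ∩ O w ⊆ κ} from ⟨hw, h⟩) (hwO w hw))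
        · exact Or.inr (mem_biUnion (show w ∈ {w ∈ c \ {a, b} | ¬ L ∩ O w ⊆ κ} from ⟨hw, h⟩) (hwO w hw)))
      ⟨w₀, hw₀, mem_biUnion (show w₀ ∈ {w ∈ c \ {a, b} | L ∩ O w ⊆ κ} from ⟨hw₀, hκw₀⟩) (hwO w₀ hw₀)⟩
      ⟨w₁, hw₁, mem_biUnion (show w₁ ∈ {w ∈ c \ {a, b} | ¬ L ∩ O w ⊆ κ} from ⟨hw₁, hw₁κ⟩) (hwO w₁ hw₁)⟩
    obtain ⟨u, hu, hwu⟩ := mem_iUnion₂.1 hwU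
    obtain ⟨v, hv, hwv⟩ := mem_iUnion₂.1 hwV
    obtain ⟨p, hpL, hpu, hpv⟩ := hmeet w hw.1 _ ((hOo u hu.1).inter (hOo v hv.1)) ⟨hwu, hwv⟩
    refine hv.2 fun q hq => ?_
    have h1 : p ∈ κ := hu.2 ⟨hpL, hpu⟩
    have h2 := (hOj v hv.1 p ⟨hpL, hpv⟩ q hq).mem_component
    rwa [← connectedComponentIn_eq h1] at h2
  have hκp : IsPreconnected κ := isPreconnected_connectedComponentIn
  refine ⟨(C ∩ L) ∪ κ, union_subset (inter_subset_left.trans hCF) fun x hx => (hLc x (hκs hx).1).1,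
    ?_, Or.inl ⟨hy, hyL⟩, Or.inl ⟨hz, hzL⟩, ?_⟩
  swap
  · rintro x ⟨hx | hx, hxS⟩
    · exact ⟨⟨hx.1, hxS⟩, (hLc x hx.2).2⟩
    · exact absurd hxS (hκs hx).2
  have key : ∀ u v : Set M, IsOpen u → IsOpen v → (C ∩ L) ∪ κ ⊆ u ∪ v →
      ((C ∩ L ∪ κ) ∩ (u ∩ v)) = ∅ → κ ⊆ u → ∀ r ∈ (C ∩ L) ∪ κ, r ∉ v := by
    intro u v hu hv huv hd hκu r hr hrv
    have hno : ∀ x ∈ (C ∩ L) ∪ κ, x ∈ u → x ∉ v := fun x hx h1 h2 =>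
      (eq_empty_iff_forall_notMem.1 hd x) ⟨hx, h1, h2⟩
    have hrCL : r ∈ C ∩ L := hr.resolve_right fun h => hno r hr (hκu h) hrv
    obtain ⟨x, hxC, hxU, hxV⟩ := hC ((u ∩ L) ∪ E ∪ ⋃ w ∈ c \ {a, b}, O w) (v ∩ L)
      (((hu.inter hθ.right.isOpen).union hθ.left.isOpen).union (isOpen_biUnion hOo))
      (hv.inter hθ.right.isOpen)
      (fun x hx => by
        by_cases hxc : x ∈ c
        · exact Or.inl (Or.inr (mem_biUnion (hends x (hCF hx) hxc) (hwO x (hends x (hCF hx) hxc))))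
        · rcases hθ.union.symm.subset ⟨hCF hx, hxc⟩ with h | h
          · exact Or.inl (Or.inl (Or.inr h))
          · rcases huv (Or.inl ⟨hx, h⟩) with h' | h'
            · exact Or.inl (Or.inl (Or.inl ⟨h', h⟩))
            · exact Or.inr ⟨h', h⟩)
      ⟨w₀, hw₀C, Or.inr (mem_biUnion hw₀ (hwO w₀ hw₀))⟩ ⟨r, hrCL.1, hrv, hrCL.2⟩
    rcases hxU with (h | h) | h
    · exact hno x (Or.inl ⟨hxC, h.2⟩) h.1 hxV.1
    · exact disjoint_left.1 hθ.disjoint h hxV.2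
    · obtain ⟨w, hw, hxw⟩ := mem_iUnion₂.1 h
      have := hκall w hw ⟨hxV.2, hxw⟩
      exact hno x (Or.inr this) (hκu this) hxV.1
  rintro u v hu hv huv ⟨p, hp, hpu⟩ ⟨q, hq, hqv⟩
  by_contra hne
  rw [not_nonempty_iff_eq_empty] at hne
  rcases isPreconnected_iff_subset_of_disjoint.1 hκp u v hu hv (subset_union_right.trans huv)
    (subset_eq_empty (inter_subset_inter_left _ subset_union_right) hne) with h | h
  · exact key u v hu hv huv hne h q hq hqv
  · exact key v u hv hu (by rwa [union_comm v u]) (by rwa [inter_comm v u]) h p hp hpu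

/-- Iteration of `IsCrosscut.exists_push` over finitely many crosscuts. -/
lemma IsJordanDomain.exists_preconnected_disjoint (hF : IsJordanDomain F) {𝒦 : Set (Set M)}
    (hfin : 𝒦.Finite)
    (hK : ∀ c ∈ 𝒦, ∃ a b A B E L, IsCrosscut F c a b ∧ IsTheta F c A B E L ∧ y ∈ L ∧ z ∈ L ∧
      ∀ w ∈ c \ {a, b}, ∃ O ∈ 𝓝 w, O ∩ S ⊆ c)
    (hC : IsPreconnected C) (hCF : C ⊆ F) (hy : y ∈ C) (hz : z ∈ C) (hCS : C ∩ S ⊆ ⋃₀ 𝒦) :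
    ∃ C₀ ⊆ F, IsPreconnected C₀ ∧ y ∈ C₀ ∧ z ∈ C₀ ∧ Disjoint C₀ S := by
  induction 𝒦, hfin using Set.Finite.induction_on generalizing C with
  | empty =>
    refine ⟨C, hCF, hC, hy, hz, disjoint_left.2 fun x hx hxS => ?_⟩
    simpa using hCS ⟨hx, hxS⟩
  | @insert c 𝒦 _ _ ih =>
    obtain ⟨a, b, A, B, E, L, hc, hθ, hyL, hzL, hS⟩ := hK c (mem_insert _ _)
    obtain ⟨C', hC'F, hC', hy', hz', hC'S⟩ := hc.exists_push hF hθ hS hC hCF hy hz hyL hzL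
    refine ih (fun d hd => hK d (mem_insert_of_mem _ hd)) hC' hC'F hy' hz' fun x hx => ?_
    obtain ⟨h1, h2⟩ := hC'S hx
    obtain ⟨d, hd, hxd⟩ := hCS h1
    rcases hd with rfl | hd
    · exact absurd hxd h2
    · exact ⟨d, hd, hxd⟩

end Sweep

/-! ### Gaps of a closed set on a circle -/

section Gap
variable {M : Type*} {φ : ℂ → M} {Γ : Set M} {t u v : ℝ}

/-- `(u, v)` is a maximal interval parametrizing an arc of the chart circle outside `Γ`. -/
structure IsGap (φ : ℂ → M) (Γ : Set M) (u v : ℝ) : Prop where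
  lt : u < v
  sub_lt : v - u < 1
  left_mem : φ (circ u) ∈ Γ
  right_mem : φ (circ v) ∈ Γ
  notMem : ∀ s ∈ Ioo u v, φ (circ s) ∉ Γ

/-- The arc of the chart circle parametrized by `[u, v]`. -/
def circArc (φ : ℂ → M) (u v : ℝ) : Set M := (fun t => φ (circ t)) '' Icc u v

lemma circArc_subset : circArc φ u v ⊆ φ '' sphere 0 1 := by
  rintro _ ⟨t, -, rfl⟩; exact ⟨_, by simp [norm_circ], rfl⟩

lemma IsGap.mem_Ioo (h : IsGap φ Γ u v) {w : M}
    (hw : w ∈ circArc φ u v \ {φ (circ u), φ (circ v)}) : ∃ s ∈ Ioo u v, φ (circ s) = w := by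
  obtain ⟨⟨s, hs, rfl⟩, hs'⟩ := hw
  refine ⟨s, ⟨lt_of_le_of_ne hs.1 ?_, lt_of_le_of_ne hs.2 ?_⟩, rfl⟩
  · rintro rfl; exact hs' (Or.inl rfl)
  · rintro rfl; exact hs' (Or.inr rfl)

variable [TopologicalSpace M]

lemma exists_gap (hφ : Continuous φ) (hΓ : IsClosed Γ) (h2 : (φ '' sphere 0 1 ∩ Γ).Nontrivial)
    (ht : φ (circ t) ∉ Γ) : ∃ u v, IsGap φ Γ u v ∧ t ∈ Ioo u v := by
  set T : Set ℝ := {s | φ (circ s) ∈ Γ} with hT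
  have hTc : IsClosed T := hΓ.preimage (hφ.comp continuous_circ)
  have hper : ∀ s, s ∈ T → s - 1 ∈ T := fun s hs => by
    have : circ (s - 1) = circ s := by simpa [sub_eq_add_neg] using circ_add_int s (-1)
    simpa [hT, this] using hs
  obtain ⟨s₁, h1, s₂, h2', h12⟩ : ∃ s₁ ∈ T ∩ Ioo t (t + 1), ∃ s₂ ∈ T ∩ Ioo t (t + 1), s₁ < s₂ := by
    obtain ⟨_, ⟨⟨z, hz, rfl⟩, hzΓ⟩, _, ⟨⟨w, hw, rfl⟩, hwΓ⟩, hne⟩ := h2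
    obtain ⟨s₁, hs₁, rfl⟩ := exists_circ_eq hz t
    obtain ⟨s₂, hs₂, rfl⟩ := exists_circ_eq hw t
    have n1 : t ≠ s₁ := fun h => ht (h ▸ hzΓ)
    have n2 : t ≠ s₂ := fun h => ht (h ▸ hwΓ)
    have m1 : s₁ ∈ T ∩ Ioo t (t + 1) := ⟨hzΓ, lt_of_le_of_ne hs₁.1 n1, hs₁.2⟩
    have m2 : s₂ ∈ T ∩ Ioo t (t + 1) := ⟨hwΓ, lt_of_le_of_ne hs₂.1 n2, hs₂.2⟩
    rcases lt_trichotomy s₁ s₂ with h | h | h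
    · exact ⟨_, m1, _, m2, h⟩
    · exact absurd (by rw [h]) hne
    · exact ⟨_, m2, _, m1, h⟩
  have b1 : BddBelow (T ∩ Ici t) := ⟨t, fun x hx => hx.2⟩
  have b2 : BddAbove (T ∩ Iic t) := ⟨t, fun x hx => hx.2⟩
  have m1 : s₁ ∈ T ∩ Ici t := ⟨h1.1, h1.2.1.le⟩
  have m2 : s₂ - 1 ∈ T ∩ Iic t := ⟨hper _ h2'.1, by have := h2'.2.2; simp only [mem_Iic]; linarith⟩
  have v1 := (hTc.inter isClosed_Ici).csInf_mem ⟨_, m1⟩ b1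
  have u1 := (hTc.inter isClosed_Iic).csSup_mem ⟨_, m2⟩ b2
  have v2 := csInf_le b1 m1
  have u2 := le_csSup b2 m2
  set v := sInf (T ∩ Ici t)
  set u := sSup (T ∩ Iic t)
  have hv : t < v := lt_of_le_of_ne v1.2 fun h => ht (by rw [h]; exact v1.1)
  have hu : u < t := lt_of_le_of_ne u1.2 fun h => ht (by rw [← h]; exact u1.1)
  refine ⟨u, v, ⟨hu.trans hv, by linarith, u1.1, v1.1, fun s hs hsΓ => ?_⟩, hu, hv⟩
  rcases le_total s t with h | h
  · exact absurd (le_csSup b2 ⟨hsΓ, h⟩) (not_le.2 hs.1)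
  · exact absurd (csInf_le b1 ⟨hsΓ, h⟩) (not_le.2 hs.2)

lemma IsGap.isArc (h : IsGap φ Γ u v) (hφ : Continuous φ) (hi : Function.Injective φ) :
    IsArc (circArc φ u v) (φ (circ u)) (φ (circ v)) :=
  isArc_of_Icc (γ := fun t => φ (circ t)) h.lt (hφ.comp continuous_circ).continuousOn
    fun _ hs _ ht e => injOn_circ h.sub_lt hs ht (hi e)

/-- The closed arc over a gap is a crosscut of the face that it meets. -/
lemma IsGap.isCrosscut (h : IsGap φ Γ u v) (hφ : Continuous φ) (hi : Function.Injective φ)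
    {F : Set M} (hF : IsFace Γ F) (ht : t ∈ Ioo u v) (htF : φ (circ t) ∈ F) :
    IsCrosscut F (circArc φ u v) (φ (circ u)) (φ (circ v)) := by
  have hc : Continuous fun t => φ (circ t) := hφ.comp continuous_circ
  have hsub : (fun t => φ (circ t)) '' Ioo u v ⊆ F := by
    refine hF.subset_of_isPreconnected (isPreconnected_Ioo.image _ hc.continuousOn) ?_
      ⟨_, ⟨t, ht, rfl⟩, htF⟩
    rw [disjoint_left]
    rintro _ ⟨s, hs, rfl⟩
    exact h.notMem s hs
  have hcl : ∀ s ∈ Icc u v, φ (circ s) ∈ closure F := fun s hs => by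
    rw [← closure_Ioo h.lt.ne] at hs
    exact closure_mono hsub (image_closure_subset_closure_image hc ⟨s, hs, rfl⟩)
  refine ⟨h.isArc hφ hi, ?_, ?_, fun w hw => ?_⟩
  · rw [hF.isOpen.frontier_eq]
    exact ⟨hcl u ⟨le_rfl, h.lt.le⟩, fun hF' => disjoint_left.1 hF.disjoint hF' h.left_mem⟩
  · rw [hF.isOpen.frontier_eq]
    exact ⟨hcl v ⟨h.lt.le, le_rfl⟩, fun hF' => disjoint_left.1 hF.disjoint hF' h.right_mem⟩
  · obtain ⟨s, hs, rfl⟩ := h.mem_Ioo hw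
    exact hsub ⟨s, hs, rfl⟩

/-- Near an inner point of a gap the chart circle coincides with the arc over the gap. -/
lemma IsGap.exists_nhds [T2Space M] (h : IsGap φ Γ u v) (hφ : Continuous φ)
    (hi : Function.Injective φ) :
    ∀ w ∈ circArc φ u v \ {φ (circ u), φ (circ v)}, ∃ O ∈ 𝓝 w,
      O ∩ φ '' sphere 0 1 ⊆ circArc φ u v := by
  intro w hw
  obtain ⟨s, hs, rfl⟩ := h.mem_Ioo hw
  have hcl : IsClosed (circArc φ v (u + 1)) :=
    (isCompact_Icc.image (hφ.comp continuous_circ)).isClosed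
  refine ⟨_, hcl.isOpen_compl.mem_nhds ?_, ?_⟩
  · rintro ⟨r, hr, e⟩
    obtain ⟨n, hn⟩ := circ_eq_iff.1 (hi e)
    have h1 : (0 : ℝ) < n := by linarith [hs.2, hr.1]
    have h2 : (n : ℝ) < 1 := by linarith [hs.1, hr.2]
    have h3 : 0 < n := by exact_mod_cast h1
    have h4 : n < 1 := by exact_mod_cast h2
    omega
  · rintro x ⟨hx, z, hz, rfl⟩
    obtain ⟨r, hr, rfl⟩ := exists_circ_eq hz u
    rcases le_total r v with h' | h'
    · exact ⟨r, ⟨hr.1, h'⟩, rfl⟩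
    · exact absurd ⟨r, ⟨h', hr.2.le⟩, rfl⟩ hx

end Gap

section AddGaps
variable {M M' : Type*} [MetricSpace M] [MetricSpace M'] [JordanSurface M] [JordanSurface M']
  [PreconnectedSpace M] [PreconnectedSpace M'] {φ : ℂ → M}

/-- A matching can be refined so that its graph contains finitely many given points of a chart
circle, and consists on the circle of the old graph and arcs over gaps of the old graph. -/
lemma CellMatching.exists_add_gaps (S : CellMatching M M') (hφ : Continuous φ)
    (hi : Function.Injective φ) (h2 : (φ '' sphere 0 1 ∩ S.graph).Nontrivial) {K : Set ℝ}
    (hK : K.Finite) :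
    ∃ T : CellMatching M M', T.Refines S ∧ (∀ k ∈ K, φ (circ k) ∈ T.graph) ∧
      ∀ t s, φ (circ t) ∉ T.graph → (∀ r ∈ uIcc t s, φ (circ r) ∉ S.graph) →
        φ (circ s) ∉ T.graph := by
  induction K, hK using Set.Finite.induction_on with
  | empty => exact ⟨S, .refl S, by simp, fun t s _ h => h s right_mem_uIcc⟩
  | @insert k K _ _ ih =>
    obtain ⟨T, hTS, hTK, hT⟩ := ih
    by_cases hk : φ (circ k) ∈ T.graph
    · exact ⟨T, hTS, by rintro r (rfl | hr); exacts [hk, hTK r hr], hT⟩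
    obtain ⟨u, v, hg, hkuv⟩ := exists_gap hφ T.isClosed_graph
      (h2.mono (inter_subset_inter_right _ hTS.graph_subset)) hk
    obtain ⟨p, hp, hkp⟩ := T.exists_cell hk
    obtain ⟨U, hUT, hUg⟩ := T.exists_split hp (hg.isCrosscut hφ hi (T.isFace hp) hkuv hkp)
    refine ⟨U, hUT.trans hTS, ?_, ?_⟩
    · rintro r (rfl | hr)
      · rw [hUg]; exact Or.inr ⟨r, ⟨hkuv.1.le, hkuv.2.le⟩, rfl⟩
      · exact hUT.graph_subset (hTK r hr)
    · intro t s ht hts hs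
      have htT : φ (circ t) ∉ T.graph := fun h => ht (hUT.graph_subset h)
      have hsT := hT t s htT hts
      rw [hUg] at hs ht
      obtain ⟨s', hs', e⟩ := hs.resolve_left hsT
      obtain ⟨n, hn⟩ := circ_eq_iff.1 (hi e)
      have per : ∀ r : ℝ, circ (r - n) = circ r := fun r => by
        simpa [sub_eq_add_neg] using circ_add_int r (-n)
      have key : ∀ r ∈ Icc u v, r - n ∈ uIcc t s → φ (circ r) ∉ T.graph := fun r hr hr' => by
        rw [← per r]
        exact hT t _ htT fun q hq => hts q (uIcc_subset_uIcc_left hr' hq)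
      have hn' : s' - n = s := by linarith
      have ht' : ¬ (t + n ∈ Icc u v) := fun h =>
        ht (Or.inr ⟨t + n, h, by simp [circ_add_int]⟩)
      rw [mem_Icc, not_and_or, not_le, not_le] at ht'
      rcases ht' with h | h
      · refine key u ⟨le_rfl, hg.lt.le⟩ ?_ hg.left_mem
        exact Icc_subset_uIcc ⟨by linarith, by linarith [hs'.1]⟩
      · refine key v ⟨hg.lt.le, le_rfl⟩ ?_ hg.right_mem
        exact Icc_subset_uIcc' ⟨by linarith [hs'.2], by linarith⟩

end AddGaps

/-! ### Refining the mesh -/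

section Refine
variable {M M' : Type*} [MetricSpace M] [MetricSpace M'] {φ : ℂ → M}

lemma isFace_chart_ball (hφ : IsOpenEmbedding φ) :
    IsFace (φ '' sphere 0 1) (φ '' ball 0 1) := by
  have ho : IsOpen (φ '' ball 0 1) := hφ.isOpenMap _ isOpen_ball
  refine ⟨ho, fun x hx => ?_, ?_⟩
  · rw [ho.frontier_eq] at hx
    exact mem_sphere_of_mem_closure_chart hφ.continuous hx.2 hx.1
  · rw [disjoint_image_iff hφ.injective]
    exact sphere_disjoint_ball.symm

/-- A connected set with a point inside and a point off the chart disc crosses the chart circle. -/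
lemma IsPreconnected.inter_chart_sphere_nonempty (hφ : IsOpenEmbedding φ) {C : Set M}
    (hC : IsPreconnected C) {y z : M} (hy : y ∈ C) (hz : z ∈ C) (hyI : y ∈ φ '' ball 0 1)
    (hzI : z ∉ φ '' ball 0 1) : (C ∩ φ '' sphere 0 1).Nonempty := by
  by_contra h
  exact hzI ((isFace_chart_ball hφ).subset_of_isPreconnected hC
    (disjoint_iff_inter_eq_empty.2 (not_nonempty_iff_eq_empty.1 h)) ⟨y, hy, hyI⟩ hz)

lemma CellMatching.graph_nontrivial (S : CellMatching M M') [Nonempty M] : S.graph.Nontrivial := by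
  obtain ⟨x⟩ := ‹Nonempty M›
  obtain ⟨p, hp, -⟩ := S.left.cover x
  exact (S.left.jordan p hp).isJordan.nontrivial.mono (S.frontier_subset_graph hp)

variable [JordanSurface M] [JordanSurface M'] [PreconnectedSpace M] [PreconnectedSpace M']

/-- A Jordan domain that meets a chart circle and misses a point off the chart has boundary
points outside the chart disc. -/
lemma IsJordanDomain.exists_frontier_notMem {F : Set M} (hF : IsJordanDomain F)
    (hφ : IsOpenEmbedding φ) {s g : M} (hs : s ∈ φ '' sphere 0 1) (hsF : s ∈ F)
    (hg : g ∉ range φ) (hgF : g ∉ F) : ∃ a ∈ frontier F, a ∉ φ '' closedBall 0 1 := by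
  by_contra! hno
  obtain ⟨z, hz, rfl⟩ := hs
  have hz1 : ‖z‖ = 1 := by simpa using hz
  have hφ₂ : IsOpenEmbedding fun w : ℂ => φ (2 * w) :=
    hφ.comp (Homeomorph.mulLeft₀ (2 : ℂ) two_ne_zero).isOpenEmbedding
  have hX := isPreconnected_compl_chart_ball hφ₂
  set X := ((fun w : ℂ => φ (2 * w)) '' ball 0 1)ᶜ with hXdef
  set R : Set M := (fun r : ℝ => φ (r * z)) '' Icc 1 2 with hR
  have hRp : IsPreconnected R :=
    isPreconnected_Icc.image _ (hφ.continuous.comp (by fun_prop)).continuousOn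
  have h2X : φ (2 * z) ∈ X := by
    rintro ⟨w, hw, e⟩
    have := hφ.injective e
    have : w = z := mul_left_cancel₀ two_ne_zero this
    rw [this, mem_ball_zero_iff] at hw; linarith
  have hgX : g ∈ X := fun ⟨w, _, e⟩ => hg ⟨_, e⟩
  have h2R : φ (2 * z) ∈ R := ⟨2, by norm_num, by simp⟩
  have h1R : φ z ∈ R := ⟨1, by norm_num, by simp⟩
  have hU : IsPreconnected (X ∪ R) := hX.union _ h2X h2R hRp
  have hd : Disjoint (X ∪ R) (frontier F) := by
    rw [disjoint_left]
    intro x hx hxF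
    obtain ⟨w, hw, rfl⟩ := hno x hxF
    have hw1 : ‖w‖ ≤ 1 := by simpa using hw
    rcases hx with hx | ⟨r, hr, e⟩
    · refine hx ⟨w / 2, ?_, by simp [mul_div_cancel₀]⟩
      rw [mem_ball_zero_iff, norm_div]; norm_num; linarith
    · have e' := hφ.injective e
      have : r = 1 := by
        refine le_antisymm ?_ hr.1
        have h3 : ‖(r : ℂ) * z‖ ≤ 1 := e' ▸ hw1
        rw [norm_mul, hz1, mul_one, Complex.norm_real, Real.norm_eq_abs] at h3
        exact (le_abs_self r).trans h3
      rw [this, Complex.ofReal_one, one_mul] at e'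
      rw [← e'] at hxF
      exact hF.notMem_of_mem_frontier hxF hsF
  exact hgF (hF.isFace.subset_of_isPreconnected hU hd ⟨_, Or.inr h1R, hsF⟩ (Or.inl hgX))

namespace CellMatching

lemma exists_refines_nontrivial (S : CellMatching M M') (hφ : IsOpenEmbedding φ) {g : M}
    (hg : g ∈ S.graph) (hgφ : g ∉ range φ) :
    ∃ T : CellMatching M M', T.Refines S ∧ (φ '' sphere 0 1 ∩ T.graph).Nontrivial := by
  by_cases hn : (φ '' sphere 0 1 ∩ S.graph).Nontrivial
  · exact ⟨S, .refl S, hn⟩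
  obtain ⟨s, hs, hsΓ⟩ : ∃ s ∈ φ '' sphere 0 1, s ∉ S.graph := by
    by_contra! h
    exact hn ((isJordanCurve_circle hφ.continuous hφ.injective).nontrivial.mono
      fun x hx => ⟨hx, h x hx⟩)
  obtain ⟨p, hp, hsp⟩ := S.exists_cell hsΓ
  have hF := S.left.jordan p hp
  obtain ⟨a, ha, haI⟩ := hF.exists_frontier_notMem hφ hs hsp hgφ (hg p hp)
  have hcl : IsClosed (φ '' closedBall 0 1) :=
    ((isCompact_closedBall _ _).image hφ.continuous).isClosed
  obtain ⟨b, ⟨hbI, hb⟩, hba⟩ := preperfect_iff_nhds.1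
    (hF.isJordan.isPreconnected.preperfect_of_nontrivial hF.isJordan.nontrivial) a ha _
    (hcl.isOpen_compl.mem_nhds haI)
  have hIo : IsOpen (φ '' ball 0 1) := hφ.isOpenMap _ isOpen_ball
  have hFI : (p.1 ∩ φ '' ball 0 1).Nonempty := by
    obtain ⟨z, hz, rfl⟩ := hs
    have : φ z ∈ closure (φ '' ball 0 1) := by
      refine image_closure_subset_closure_image hφ.continuous ⟨z, ?_, rfl⟩
      rw [closure_ball _ one_ne_zero]
      exact sphere_subset_closedBall hz
    exact mem_closure_iff.1 this _ hF.isOpen hsp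
  obtain ⟨c, hc, x, hxc, hxI⟩ := hF.exists_crosscut_meeting ha hb hba.symm hIo hFI
  obtain ⟨T, hTS, hT⟩ := S.exists_split hp hc
  refine ⟨T, hTS, ?_⟩
  have haI' : a ∉ φ '' ball 0 1 := fun h => haI (image_mono ball_subset_closedBall h)
  have hbI' : b ∉ φ '' ball 0 1 := fun h => hbI (image_mono ball_subset_closedBall h)
  obtain ⟨γ, hγ, hi, rfl, rfl, rfl⟩ := hc.isArc
  obtain ⟨t, ht, rfl⟩ := hxc
  have side : ∀ u v : ℝ, Icc u v ⊆ Icc 0 1 → t ∈ Icc u v → (∃ r ∈ Icc u v, γ r ∉ φ '' ball 0 1) →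
      ∃ r ∈ Icc u v, γ r ∈ φ '' sphere 0 1 := by
    rintro u v huv htuv ⟨r, hr, hrI⟩
    obtain ⟨_, ⟨q, hq, rfl⟩, hqS⟩ := (isPreconnected_Icc.image _ (hγ.mono huv)).inter_chart_sphere_nonempty
      hφ (mem_image_of_mem γ htuv) (mem_image_of_mem γ hr) hxI hrI
    exact ⟨q, hq, hqS⟩
  obtain ⟨r₁, hr₁, h₁⟩ := side 0 t (Icc_subset_Icc_right ht.2) ⟨ht.1, le_rfl⟩
    ⟨0, ⟨le_rfl, ht.1⟩, haI'⟩
  obtain ⟨r₂, hr₂, h₂⟩ := side t 1 (Icc_subset_Icc_left ht.1) ⟨le_rfl, ht.2⟩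
    ⟨1, ⟨ht.2, le_rfl⟩, hbI'⟩
  have m₁ : r₁ ∈ Icc (0 : ℝ) 1 := ⟨hr₁.1, hr₁.2.trans ht.2⟩
  have m₂ : r₂ ∈ Icc (0 : ℝ) 1 := ⟨ht.1.trans hr₂.1, hr₂.2⟩
  refine ⟨γ r₁, ⟨h₁, ?_⟩, γ r₂, ⟨h₂, ?_⟩, fun e => ?_⟩
  · rw [hT]; exact Or.inr ⟨r₁, m₁, rfl⟩
  · rw [hT]; exact Or.inr ⟨r₂, m₂, rfl⟩
  · have e' := hi m₁ m₂ e
    have : r₁ = t := le_antisymm hr₁.2 (e' ▸ hr₂.1)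
    rw [this] at h₁
    exact disjoint_left.1 (isFace_chart_ball hφ).disjoint hxI h₁

/-- After a refinement, cells that reach the inner part of a chart disc stay in the chart. -/
lemma exists_refines_chart [CompactSpace M] (S : CellMatching M M') (hφ : IsOpenEmbedding φ)
    (h2 : (φ '' sphere 0 1 ∩ S.graph).Nontrivial) :
    ∃ T : CellMatching M M', T.Refines S ∧
      ∀ p ∈ T.cells, (p.1 ∩ φ '' ball 0 (1 / 2)).Nonempty → p.1 ⊆ range φ := by
  obtain ⟨η, hη, hηO⟩ := ((isCompact_sphere (0 : ℂ) 1).image hφ.continuous).exists_thickening_subset_open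
    (t := range φ \ φ '' closedBall 0 (1 / 2))
    (hφ.isOpen_range.sdiff ((isCompact_closedBall _ _).image hφ.continuous).isClosed) (by
      rintro _ ⟨z, hz, rfl⟩
      refine ⟨⟨z, rfl⟩, ?_⟩
      rintro ⟨w, hw, e⟩
      rw [hφ.injective e, mem_closedBall_zero_iff] at hw
      rw [mem_sphere_zero_iff_norm] at hz
      norm_num [hz] at hw)
  have hT3 : ∃ δ > 0, ∀ p ∈ S.cells, ∀ c a b, IsCrosscut p.1 c a b →
      (∀ x ∈ c, ∀ y ∈ c, dist x y < δ) → ∃ A B E L, IsArcPair A B a b ∧ A ∪ B = frontier p.1 ∧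
        IsTheta p.1 c A B E L ∧ ∀ x ∈ E, ∀ y ∈ E, dist x y < η / 2 := by
    have h : ∀ p ∈ S.cells, ∃ δ > 0, ∀ c a b, IsCrosscut p.1 c a b →
      (∀ x ∈ c, ∀ y ∈ c, dist x y < δ) → ∃ A B E L, IsArcPair A B a b ∧ A ∪ B = frontier p.1 ∧
        IsTheta p.1 c A B E L ∧ ∀ x ∈ E, ∀ y ∈ E, dist x y < η / 2 :=
      fun p hp => (S.left.jordan p hp).exists_small_theta (half_pos hη)
    choose! δ hδ h using h
    have hev : ∀ᶠ d : ℝ in 𝓝[>] 0, ∀ p ∈ S.cells, d < δ p := by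
      rw [S.finite.eventually_all]
      exact fun p hp => nhdsWithin_le_nhds (Iio_mem_nhds (hδ p hp))
    obtain ⟨d, hd, hd0⟩ := (hev.and self_mem_nhdsWithin).exists
    exact ⟨d, hd0, fun p hp c a b hc hcd => h p hp c a b hc
      fun x hx y hy => (hcd x hx y hy).trans (hd p hp)⟩
  obtain ⟨δ, hδ, hT3⟩ := hT3
  have hθ : Continuous fun t => φ (circ t) := hφ.continuous.comp continuous_circ
  obtain ⟨ρ, hρ, huc⟩ := Metric.uniformContinuousOn_iff.1
    ((isCompact_Icc (a := (-1 : ℝ)) (b := 2)).uniformContinuousOn_of_continuous hθ.continuousOn) δ hδ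
  obtain ⟨m, hm⟩ := exists_nat_one_div_lt hρ
  have hm0 : (0 : ℝ) < m + 1 := by positivity
  obtain ⟨T, hTS, hTK, hT⟩ := S.exists_add_gaps hφ.continuous hφ.injective h2
    (K := (fun k : ℤ => (k : ℝ) / (m + 1)) '' Icc (-(m + 1 : ℤ)) (2 * (m + 1)))
    ((finite_Icc _ _).image _)
  refine ⟨T, hTS, fun q hq hqN => ?_⟩
  obtain ⟨y, hyq, hyN⟩ := hqN
  by_contra hsub
  obtain ⟨z, hzq, hzφ⟩ := not_subset.1 hsub
  obtain ⟨p, hp, hqp, -⟩ := hTS q hq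
  have hF := S.left.jordan p hp
  have hQ := T.left.jordan q hq
  have hyI : y ∈ φ '' ball 0 1 := image_mono (ball_subset_ball (by norm_num)) hyN
  have hyz : y ≠ z := by
    rintro rfl
    exact hzφ (image_subset_range _ _ hyN)
  have hyO : y ∉ range φ \ φ '' closedBall 0 (1 / 2) :=
    fun h => h.2 (image_mono ball_subset_closedBall hyN)
  have hzO : z ∉ range φ \ φ '' closedBall 0 (1 / 2) := fun h => hzφ h.1
  obtain ⟨C, hCq, hC⟩ := hQ.isConnected.isPreconnected.exists_arc hQ.isOpen hyq hzq hyz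
  have gap : ∀ t : ℝ, φ (circ t) ∈ C → ∃ u v, IsGap φ S.graph u v ∧ t ∈ Ioo u v := fun t ht =>
    exists_gap hφ.continuous S.isClosed_graph h2 fun h => h p hp (hqp (hCq ht))
  choose! u v hg htuv using gap
  have small : ∀ t ∈ Icc (0 : ℝ) 1, φ (circ t) ∈ C →
      ∀ x ∈ circArc φ (u t) (v t), ∀ x' ∈ circArc φ (u t) (v t), dist x x' < δ := by
    intro t ht htC
    have hgt := hg t htC
    have hlt := htuv t htC
    have hlen : v t - u t ≤ 1 / (m + 1) := by
      by_contra! hlen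
      have hk := Int.floor_le (u t * (m + 1))
      have hk' := Int.lt_floor_add_one (u t * (m + 1))
      set k := ⌊u t * (m + 1)⌋ + 1 with hkdef
      have h1 : u t < (k : ℝ) / (m + 1) := by rw [lt_div_iff₀ hm0, hkdef]; push_cast; linarith
      have h2 : (k : ℝ) / (m + 1) < v t := by
        rw [div_lt_iff₀ hm0, hkdef]
        rw [div_lt_iff₀ hm0] at hlen
        push_cast; nlinarith
      have hs := hgt.sub_lt
      have hk1 : -(m + 1 : ℤ) ≤ k := by
        have : (-1 : ℝ) < (k : ℝ) / (m + 1) := by linarith [ht.1, hlt.2]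
        rw [lt_div_iff₀ hm0] at this
        have h4 : ((-(m + 1 : ℤ) : ℤ) : ℝ) < (k : ℝ) := by push_cast; linarith
        exact (Int.cast_lt.1 h4).le
      have hk2 : k ≤ 2 * (m + 1) := by
        have : (k : ℝ) / (m + 1) < 2 := by linarith [ht.2, hlt.1]
        rw [div_lt_iff₀ hm0] at this
        have h4 : (k : ℝ) < ((2 * (m + 1 : ℤ) : ℤ) : ℝ) := by push_cast; linarith
        exact (Int.cast_lt.1 h4).le
      refine hT t (k / (m + 1)) (fun h => h q hq (hCq htC)) (fun r hr => hgt.notMem r ?_)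
        (hTK _ ⟨k, ⟨hk1, hk2⟩, rfl⟩)
      have : uIcc t ((k : ℝ) / (m + 1)) ⊆ Ioo (u t) (v t) := ordConnected_Ioo.uIcc_subset hlt ⟨h1, h2⟩
      exact this hr
    have hin : Icc (u t) (v t) ⊆ Icc (-1) 2 := Icc_subset_Icc
      (by linarith [hgt.sub_lt, ht.1, hlt.2]) (by linarith [hgt.sub_lt, ht.2, hlt.1])
    rintro _ ⟨r, hr, rfl⟩ _ ⟨r', hr', rfl⟩
    refine huc r (hin hr) r' (hin hr') ?_
    rw [Real.dist_eq]
    refine lt_of_le_of_lt (abs_le.2 ⟨?_, ?_⟩) hm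
    · linarith [hr.1, hr'.2]
    · linarith [hr'.1, hr.2]
  have hKc : IsCompact ({t : ℝ | φ (circ t) ∈ C} ∩ Icc 0 1) :=
    isCompact_Icc.inter_left (hC.isClosed.preimage hθ)
  obtain ⟨I, hIs, hIf, hIc⟩ := hKc.elim_finite_subcover_image
    (b := {t : ℝ | φ (circ t) ∈ C} ∩ Icc 0 1) (c := fun t => Ioo (u t) (v t))
    (fun t _ => isOpen_Ioo) (fun t ht => mem_biUnion ht (htuv t ht.1))
  obtain ⟨C₀, -, hC₀, hy₀, hz₀, hd⟩ := hF.exists_preconnected_disjoint (y := y) (z := z)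
    (S := φ '' sphere 0 1) (𝒦 := (fun t => circArc φ (u t) (v t)) '' I) (hIf.image _) (by
      rintro _ ⟨t, ht, rfl⟩
      obtain ⟨htC, ht01⟩ := hIs ht
      have hcr := (hg t htC).isCrosscut hφ.continuous hφ.injective (S.isFace hp) (htuv t htC)
        (hqp (hCq htC))
      obtain ⟨A, B, E, L, -, -, hθ, hE⟩ := hT3 p hp _ _ _ hcr (small t ht01 htC)
      have hEO : E ⊆ range φ \ φ '' closedBall 0 (1 / 2) := by
        intro x hx
        have hcl : φ (circ (u t)) ∈ closure E :=
          frontier_subset_closure (hθ.frontier_left.symm.subset (Or.inr hcr.isArc.left_mem))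
        obtain ⟨x', hx', hd⟩ := Metric.mem_closure_iff.1 hcl (η / 2) (half_pos hη)
        refine hηO (mem_thickening_iff.2 ⟨_, circArc_subset hcr.isArc.left_mem, ?_⟩)
        have := hE x hx x' hx'
        rw [dist_comm] at hd
        linarith [dist_triangle x x' (φ (circ (u t)))]
      have side : ∀ x ∈ q.1, x ∉ range φ \ φ '' closedBall 0 (1 / 2) → x ∈ L := by
        intro x hx hxO
        have hxc : x ∉ circArc φ (u t) (v t) := fun h =>
          hxO (hηO (self_subset_thickening hη _ (circArc_subset h)))
        exact (hθ.union.symm.subset ⟨hqp hx, hxc⟩).resolve_left fun h => hxO (hEO h)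
      exact ⟨_, _, A, B, E, L, hcr, hθ, side y hyq hyO, side z hzq hzO,
        (hg t htC).exists_nhds hφ.continuous hφ.injective⟩)
    hC.isPreconnected (hCq.trans hqp) hC.left_mem hC.right_mem (by
      rintro _ ⟨hxC, w, hw, rfl⟩
      obtain ⟨t, ht, rfl⟩ := exists_circ_eq hw 0
      obtain ⟨s, hs, hts⟩ := mem_iUnion₂.1 (hIc ⟨hxC, ht.1, by linarith [ht.2]⟩)
      exact ⟨_, ⟨s, hs, rfl⟩, t, ⟨hts.1.le, hts.2.le⟩, rfl⟩)
  obtain ⟨x, hx, hxS⟩ := hC₀.inter_chart_sphere_nonempty hφ hy₀ hz₀ hyI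
    fun h => hzφ (image_subset_range _ _ h)
  exact disjoint_left.1 hd hx hxS

/-- Every matching can be refined so that all cells in the first space are small. -/
lemma exists_refines_left [CompactSpace M] [Nonempty M] (S : CellMatching M M') {ε : ℝ}
    (hε : 0 < ε) :
    ∃ T : CellMatching M M', T.Refines S ∧ ∀ p ∈ T.cells, ∀ x ∈ p.1, ∀ y ∈ p.1, dist x y < ε := by
  have h : ∀ x : M, ∃ φ : ℂ → M, IsOpenEmbedding φ ∧ φ 0 = x ∧ range φ ⊆ ball x (ε / 2) ∧
      ∃ g ∈ S.graph, g ∉ range φ := by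
    intro x
    obtain ⟨g, hg, hgx⟩ := S.graph_nontrivial.exists_ne x
    obtain ⟨φ, h1, h2, h3⟩ := IsSurface.exists_chart x _
      (inter_mem (ball_mem_nhds x (half_pos hε)) (isOpen_compl_singleton.mem_nhds hgx.symm))
    exact ⟨φ, h1, h2, fun y hy => (h3 hy).1, g, hg, fun h => (h3 h).2 rfl⟩
  choose φ hφ hφ0 hφr g hg hgφ using h
  obtain ⟨I, hI⟩ := isCompact_univ.elim_finite_subcover (fun x : M => φ x '' ball 0 (1 / 2))
    (fun x => (hφ x).isOpenMap _ isOpen_ball)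
    (fun x _ => mem_iUnion.2 ⟨x, 0, by simp, hφ0 x⟩)
  have key : ∃ T : CellMatching M M', T.Refines S ∧ ∀ x ∈ I, ∀ p ∈ T.cells,
      (p.1 ∩ φ x '' ball 0 (1 / 2)).Nonempty → p.1 ⊆ range (φ x) := by
    clear hI
    classical
    induction I using Finset.induction_on with
    | empty => exact ⟨S, .refl S, by simp⟩
    | insert x I _ ih =>
      obtain ⟨T, hTS, hT⟩ := ih
      obtain ⟨U, hUT, hU⟩ := T.exists_refines_nontrivial (hφ x) (hTS.graph_subset (hg x)) (hgφ x)
      obtain ⟨V, hVU, hV⟩ := U.exists_refines_chart (hφ x) hU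
      refine ⟨V, (hVU.trans hUT).trans hTS, fun y hy q hq hne => ?_⟩
      rcases Finset.mem_insert.1 hy with rfl | hy
      · exact hV q hq hne
      · obtain ⟨p, hp, hqp, -⟩ := (hVU.trans hUT) q hq
        exact hqp.trans (hT y hy p hp (hne.mono (inter_subset_inter_left _ hqp)))
  obtain ⟨T, hTS, hT⟩ := key
  refine ⟨T, hTS, fun p hp y hy z hz => ?_⟩
  obtain ⟨x, hx, hyx⟩ := mem_iUnion₂.1 (hI (mem_univ y))
  have hsub := hT x hx p hp ⟨y, hy, hyx⟩
  have h1 := mem_ball.1 (hφr x (hsub hy))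
  have h2 := mem_ball.1 (hφr x (hsub hz))
  linarith [dist_triangle_right y z x]

/-- Every matching can be refined so that all cells are small. -/
lemma exists_refines [CompactSpace M] [Nonempty M] [CompactSpace M'] [Nonempty M']
    (S : CellMatching M M') {ε : ℝ} (hε : 0 < ε) :
    ∃ T : CellMatching M M', T.Refines S ∧ ∀ p ∈ T.cells,
      (∀ x ∈ p.1, ∀ y ∈ p.1, dist x y < ε) ∧ ∀ x ∈ p.2, ∀ y ∈ p.2, dist x y < ε := by
  obtain ⟨T, hTS, hT⟩ := S.exists_refines_left hε
  obtain ⟨U, hUT, hU⟩ := T.swap.exists_refines_left hε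
  have hUT' : U.swap.Refines T := by
    intro q hq
    obtain ⟨p, hp, h1, h2⟩ := hUT _ (U.mem_of_swap hq)
    exact ⟨p.swap, T.mem_of_swap hp, h2, h1⟩
  refine ⟨U.swap, hUT'.trans hTS, fun q hq => ⟨fun x hx y hy => ?_, fun x hx y hy => ?_⟩⟩
  · obtain ⟨p, hp, h1, -⟩ := hUT' q hq
    exact hT p hp x (h1 hx) y (h1 hy)
  · exact hU _ (U.mem_of_swap hq) x hx y hy

end CellMatching

end Refine

/-! ### The homeomorphism -/

/-- A decreasing sequence of closed relations gives a closed relation whose fibres are nonempty. -/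
lemma exists_forall_mem_of_antitone {X Y : Type*} [TopologicalSpace X]
    [TopologicalSpace Y] [CompactSpace Y] {R : ℕ → Set (X × Y)} (hR : ∀ n, R (n + 1) ⊆ R n)
    (hc : ∀ n, IsClosed (R n)) {x : X} (hx : ∀ n, ∃ y, (x, y) ∈ R n) :
    ∃ y, ∀ n, (x, y) ∈ R n := by
  have hcl : ∀ n, IsClosed {y | (x, y) ∈ R n} := fun n =>
    (hc n).preimage (Continuous.prodMk_right x)
  obtain ⟨y, hy⟩ := IsCompact.nonempty_iInter_of_sequence_nonempty_isCompact_isClosed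
    (fun n => {y | (x, y) ∈ R n}) (fun n y hy => hR n hy) hx (hcl 0).isCompact hcl
  exact ⟨y, fun n => mem_iInter.1 hy n⟩

namespace CellMatching
variable {M M' : Type*} [MetricSpace M] [MetricSpace M']

/-- Pairs of points lying in matching closed cells. -/
def rel (S : CellMatching M M') : Set (M × M') :=
  ⋃ p ∈ S.cells, closure p.1 ×ˢ closure p.2

lemma mem_rel {S : CellMatching M M'} {x : M} {y : M'} :
    (x, y) ∈ S.rel ↔ ∃ p ∈ S.cells, x ∈ closure p.1 ∧ y ∈ closure p.2 := by
  simp only [rel, mem_iUnion₂, mem_prod, exists_prop]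

lemma isClosed_rel (S : CellMatching M M') : IsClosed S.rel :=
  S.finite.isClosed_biUnion fun _ _ => isClosed_closure.prod isClosed_closure

lemma mem_rel_swap {S : CellMatching M M'} {x : M} {y : M'} :
    (y, x) ∈ S.swap.rel ↔ (x, y) ∈ S.rel := by
  rw [mem_rel, mem_rel]
  constructor
  · rintro ⟨p, hp, h1, h2⟩
    exact ⟨p.swap, S.mem_of_swap hp, h2, h1⟩
  · rintro ⟨p, hp, h1, h2⟩
    exact ⟨p.swap, S.swap_cells hp, h2, h1⟩

lemma Refines.rel_subset {S T : CellMatching M M'} (h : T.Refines S) : T.rel ⊆ S.rel := by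
  rintro ⟨x, y⟩ hxy
  obtain ⟨q, hq, hx, hy⟩ := mem_rel.1 hxy
  obtain ⟨p, hp, h1, h2⟩ := h q hq
  exact mem_rel.2 ⟨p, hp, closure_mono h1 hx, closure_mono h2 hy⟩

lemma exists_mem_rel (S : CellMatching M M') (x : M) : ∃ y, (x, y) ∈ S.rel := by
  obtain ⟨p, hp, hx⟩ := S.left.cover x
  obtain ⟨y, hy⟩ := (S.right.jordan p hp).isConnected.nonempty
  exact ⟨y, mem_rel.2 ⟨p, hp, hx, subset_closure hy⟩⟩

lemma dist_le_of_mem_rel {S : CellMatching M M'} {ε : ℝ}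
    (hS : ∀ p ∈ S.cells, ∀ y ∈ p.2, ∀ z ∈ p.2, dist y z < ε) {x : M} {y z : M'}
    (hy : (x, y) ∈ S.rel) (hz : (x, z) ∈ S.rel) : dist y z ≤ ε + ε := by
  have hcl : ∀ p ∈ S.cells, ∀ y ∈ closure p.2, ∀ z ∈ closure p.2, dist y z ≤ ε := by
    intro p hp y hy z hz
    have hyz : (y, z) ∈ closure (p.2 ×ˢ p.2) := by rw [closure_prod_eq]; exact ⟨hy, hz⟩
    exact closure_minimal (t := {q : M' × M' | dist q.1 q.2 ≤ ε})
      (fun q hq => (hS p hp q.1 hq.1 q.2 hq.2).le)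
      (isClosed_le (continuous_fst.dist continuous_snd) continuous_const) hyz
  obtain ⟨p, hp, hxp, hyp⟩ := mem_rel.1 hy
  obtain ⟨q, hq, hxq, hzq⟩ := mem_rel.1 hz
  rcases eq_or_ne p q with rfl | hpq
  · have := hcl p hp y hyp z hzq
    linarith [dist_nonneg (x := y) (y := z)]
  have hf : ∀ p ∈ S.cells, ∀ q ∈ S.cells, p ≠ q → x ∈ closure p.1 → x ∈ closure q.1 →
      S.toFun x ∈ closure p.2 := fun p hp q hq hpq hxp hxq => by
    refine frontier_subset_closure (S.left.frontier p hp ▸ mem_image_of_mem _ ?_)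
    rw [(S.left.jordan p hp).isOpen.frontier_eq]
    exact ⟨hxp, fun h => disjoint_left.1 ((S.left.disjoint p hp q hq hpq).closure_right
      (S.left.jordan p hp).isOpen) h hxq⟩
  linarith [dist_triangle y (S.toFun x) z, hcl p hp y hyp _ (hf p hp q hq hpq hxp hxq),
    hcl q hq _ (hf q hq p hp hpq.symm hxq hxp) z hzq]

variable [JordanSurface M] [JordanSurface M'] [PreconnectedSpace M] [PreconnectedSpace M']
  [CompactSpace M] [Nonempty M] [CompactSpace M'] [Nonempty M']

/-- A sequence of finer and finer matchings yields a homeomorphism. -/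
theorem nonempty_homeomorph (S : CellMatching M M') : Nonempty (M ≃ₜ M') := by
  choose! next hnext hsmall using
    fun (ε : ℝ) (T : CellMatching M M') (hε : 0 < ε) => T.exists_refines hε
  let T : ℕ → CellMatching M M' := fun n => n.rec S fun n T => next (1 / (n + 1)) T
  have hpos : ∀ n : ℕ, (0 : ℝ) < 1 / (n + 1) := fun n => by positivity
  have hR : ∀ n, (T (n + 1)).rel ⊆ (T n).rel := fun n => (hnext _ (T n) (hpos n)).rel_subset
  have hd : ∀ n, ∀ p ∈ (T (n + 1)).cells, (∀ x ∈ p.1, ∀ y ∈ p.1, dist x y < 1 / ((n : ℝ) + 1)) ∧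
      ∀ x ∈ p.2, ∀ y ∈ p.2, dist x y < 1 / ((n : ℝ) + 1) := fun n => hsmall _ (T n) (hpos n)
  have hlim : Tendsto (fun n : ℕ => 1 / ((n : ℝ) + 1) + 1 / ((n : ℝ) + 1)) atTop (𝓝 0) := by
    have h := tendsto_one_div_add_atTop_nhds_zero_nat (𝕜 := ℝ)
    simpa only [add_zero] using h.add h
  have zero : ∀ r : ℝ, (∀ n : ℕ, r ≤ 1 / ((n : ℝ) + 1) + 1 / ((n : ℝ) + 1)) → r ≤ 0 :=
    fun r hr => ge_of_tendsto' hlim hr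
  have ex : ∀ x, ∃ y, ∀ n, (x, y) ∈ (T n).rel := fun x =>
    exists_forall_mem_of_antitone hR (fun n => (T n).isClosed_rel) fun n => (T n).exists_mem_rel x
  have ex' : ∀ y, ∃ x, ∀ n, (x, y) ∈ (T n).rel := fun y => by
    obtain ⟨x, hx⟩ := exists_forall_mem_of_antitone (R := fun n => (T n).swap.rel) (x := y)
      (fun n z hz => mem_rel_swap.2 (hR n (mem_rel_swap.1 hz)))
      (fun n => (T n).swap.isClosed_rel) fun n => (T n).swap.exists_mem_rel y
    exact ⟨x, fun n => mem_rel_swap.1 (hx n)⟩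
  have uniq : ∀ x y z, (∀ n, (x, y) ∈ (T n).rel) → (∀ n, (x, z) ∈ (T n).rel) → y = z :=
    fun x y z hy hz => dist_le_zero.1 <| zero _ fun n =>
      dist_le_of_mem_rel (fun p hp => (hd n p hp).2) (hy (n + 1)) (hz (n + 1))
  have uniq' : ∀ x z y, (∀ n, (x, y) ∈ (T n).rel) → (∀ n, (z, y) ∈ (T n).rel) → x = z :=
    fun x z y hx hz => dist_le_zero.1 <| zero _ fun n =>
      dist_le_of_mem_rel (S := (T (n + 1)).swap) (fun p hp => (hd n _ ((T (n + 1)).mem_of_swap hp)).1)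
        (mem_rel_swap.2 (hx (n + 1))) (mem_rel_swap.2 (hz (n + 1)))
  choose f hf using ex
  have hcont : Continuous f := by
    refine continuous_iff_isClosed.2 fun C hC => ?_
    have : f ⁻¹' C = Prod.fst '' ((⋂ n, (T n).rel) ∩ Prod.snd ⁻¹' C) := by
      ext x
      constructor
      · exact fun hx => ⟨(x, f x), ⟨mem_iInter.2 (hf x), hx⟩, rfl⟩
      · rintro ⟨⟨x, y⟩, ⟨hxy, hy⟩, rfl⟩
        exact (uniq x _ _ (hf x) (mem_iInter.1 hxy)).symm ▸ hy
    rw [this]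
    exact isClosedMap_fst_of_compactSpace _
      ((isClosed_iInter fun n => (T n).isClosed_rel).inter (hC.preimage continuous_snd))
  have hbij : Function.Bijective f :=
    ⟨fun x z h => uniq' x z _ (hf x) (h ▸ hf z), fun y => by
      obtain ⟨x, hx⟩ := ex' y
      exact ⟨x, uniq x _ _ (hf x) hx⟩⟩
  exact ⟨hcont.homeoOfEquivCompactToT2 (f := Equiv.ofBijective f hbij)⟩

end CellMatching

/-! ### Simply connected surfaces and the sphere -/

lemma isSurface_of_chartedSpace (M : Type*) [TopologicalSpace M]
    [ChartedSpace (EuclideanSpace ℝ (Fin 2)) M] : IsSurface M where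
  exists_chart x O hO := by
    let e := chartAt (EuclideanSpace ℝ (Fin 2)) x
    have hx : x ∈ e.source := mem_chart_source _ x
    obtain ⟨r, hr, hrs⟩ := Metric.mem_nhds_iff.1 (inter_mem (e.open_target.mem_nhds (e.map_source hx))
      ((e.continuousAt_symm (e.map_source hx)).preimage_mem_nhds (by rwa [e.left_inv hx])))
    let u := OpenPartialHomeomorph.univBall (e x) r
    let l := Complex.orthonormalBasisOneI.repr.toHomeomorph.toOpenPartialHomeomorph
    have ht : u.target = ball (e x) r := OpenPartialHomeomorph.univBall_target _ hr
    have hu : ∀ z, u z ∈ ball (e x) r := fun z =>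
      ht ▸ u.map_source (by simp [u, OpenPartialHomeomorph.univBall_source])
    refine ⟨((l.trans u).trans e.symm), ?_, ?_, ?_⟩
    · refine OpenPartialHomeomorph.isOpenEmbedding _ (eq_univ_of_forall fun z => ?_)
      simp only [OpenPartialHomeomorph.trans_source]
      refine ⟨⟨mem_univ _, ?_⟩, (hrs (hu _)).1⟩
      simp [u, OpenPartialHomeomorph.univBall_source]
    · simp only [OpenPartialHomeomorph.trans_apply, l, u]
      simp [e]
    · rintro _ ⟨z, rfl⟩
      exact (hrs (hu _)).2

lemma jordanSurface_of_simplyConnected {M : Type*} [TopologicalSpace M]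
    [T2Space M] [IsSurface M] [LocallyPathConnectedSpace M] [SimplyConnectedSpace M] :
    JordanSurface M where
  not_isPreconnected_compl _ hJ := not_isPreconnected_compl_of_twoSided hJ.isClosed hJ.nonempty
    fun _ hy => hJ.twoSidedAt hy

instance : JordanSurface ℂ :=
  have : ContractibleSpace ℂ := inferInstance
  have : IsSurface ℂ :=
    letI : ChartedSpace (EuclideanSpace ℝ (Fin 2)) ℂ :=
      Complex.orthonormalBasisOneI.repr.toHomeomorph.isOpenEmbedding.singletonChartedSpace
    isSurface_of_chartedSpace ℂ
  jordanSurface_of_simplyConnected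

lemma IsJordanCurve.image {M N : Type*} [TopologicalSpace M] [TopologicalSpace N] {J : Set M}
    {f : M → N} (h : IsJordanCurve J) (hf : ContinuousOn f J) (hi : InjOn f J) :
    IsJordanCurve (f '' J) := by
  obtain ⟨A, B, a, b, h, rfl⟩ := h
  exact ⟨_, _, _, _, h.image hf hi, (image_union ..).symm⟩

lemma IsJordanCurve.ne_univ {M : Type*} [MetricSpace M] [IsSurface M] [Nonempty M]
    {J : Set M} (hJ : IsJordanCurve J) : J ≠ univ := by
  obtain ⟨A, B, a, b, h, rfl⟩ := hJ
  obtain ⟨x, -, hx⟩ := h.right.exists_notMem_open isOpen_univ univ_nonempty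
  obtain ⟨y, hy, hyA⟩ := h.left.exists_notMem_open h.right.isCompact.isClosed.isOpen_compl ⟨x, hx⟩
  exact fun e => (e ▸ mem_univ y : y ∈ A ∪ B).elim hyA hy

/-- The Jordan curve theorem passes from the plane to any surface that becomes a plane when a
point is deleted. -/
lemma jordanSurface_of_punctured {M : Type*} [MetricSpace M] [IsSurface M]
    [Nonempty M]
    (h : ∀ x : M, ∃ φ : ℂ → M, IsOpenEmbedding φ ∧ range φ = {x}ᶜ) : JordanSurface M where
  not_isPreconnected_compl J hJ hc := by
    obtain ⟨x, hx⟩ := (ne_univ_iff_exists_notMem J).1 hJ.ne_univ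
    obtain ⟨φ, hφ, hr⟩ := h x
    obtain ⟨ψ, hcont, hψ⟩ := hφ.exists_inverse
    have hJr : J ⊆ range φ := fun y hy => hr ▸ fun e => hx (e ▸ hy)
    have hψ' : ∀ y ∈ range φ, φ (ψ y) = y := by
      rintro _ ⟨z, rfl⟩; rw [hψ z]
    have hd := hc.diff_singleton_of_surface hJ.isClosed.isOpen_compl (a := x) hx
    refine JordanSurface.not_isPreconnected_compl _
      (hJ.image (hcont.mono hJr) fun y hy z hz e => ?_) ?_
    · rw [← hψ' y (hJr hy), e, hψ' z (hJr hz)]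
    · convert hd.image ψ (hcont.mono fun y hy => hr ▸ hy.2) using 1
      ext z
      constructor
      · intro hz
        have hzr : φ z ∈ ({x}ᶜ : Set M) := hr ▸ mem_range_self z
        exact ⟨φ z, ⟨fun h => hz ⟨φ z, h, hψ z⟩, hzr⟩, hψ z⟩
      · rintro ⟨y, hy, rfl⟩ ⟨w, hw, e⟩
        have hyr : y ∈ range φ := hr ▸ hy.2
        exact hy.1 (by rwa [← hψ' y hyr, ← e, hψ' w (hJr hw)])

instance : JordanSurface (sphere (0 : EuclideanSpace ℝ (Fin 3)) 1) :=
  have : IsSurface (sphere (0 : EuclideanSpace ℝ (Fin 3)) 1) := isSurface_of_chartedSpace _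
  have : Nonempty (sphere (0 : EuclideanSpace ℝ (Fin 3)) 1) :=
    (NormedSpace.sphere_nonempty.2 zero_le_one).to_subtype
  jordanSurface_of_punctured fun x => by
    have := Fact.mk (@finrank_euclideanSpace_fin ℝ _ (2 + 1))
    let e := stereographic' 2 x
    have he : e.symm.source = univ := stereographic'_target x
    let l := Complex.orthonormalBasisOneI.repr.toHomeomorph
    refine ⟨e.symm ∘ l, (e.symm.isOpenEmbedding he).comp l.isOpenEmbedding, ?_⟩
    rw [l.surjective.range_comp, ← image_univ, ← he, e.symm.image_source_eq_target]
    exact stereographic'_source x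

/-- Every nonempty, compact, connected, simply connected topological 2-manifold
without boundary (Hausdorff and second countable) is homeomorphic to the 2-sphere. -/
theorem compact_simplyConnected_closed_surface_homeomorph_sphere
    (M : Type*) [TopologicalSpace M] [ChartedSpace (EuclideanSpace ℝ (Fin 2)) M]
    [T2Space M] [SecondCountableTopology M] [Nonempty M] [CompactSpace M]
    [ConnectedSpace M] [SimplyConnectedSpace M] :
    Nonempty (M ≃ₜ (Metric.sphere (0 : EuclideanSpace ℝ (Fin 3)) 1)) := by
  have : LocallyPathConnectedSpace M :=
    ChartedSpace.locallyPathConnectedSpace (EuclideanSpace ℝ (Fin 2)) M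
  have : IsSurface M := isSurface_of_chartedSpace M
  have : JordanSurface M := jordanSurface_of_simplyConnected
  let := TopologicalSpace.metrizableSpaceMetric M
  have : ConnectedSpace (sphere (0 : EuclideanSpace ℝ (Fin 3)) 1) :=
    isConnected_iff_connectedSpace.1 (isConnected_sphere
      (by rw [← Module.finrank_eq_rank, finrank_euclideanSpace_fin]; norm_num) _ zero_le_one)
  obtain ⟨S⟩ := CellMatching.exists_initial (M := M)
    (M' := sphere (0 : EuclideanSpace ℝ (Fin 3)) 1)
  exact S.nonempty_homeomorph
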